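/- Let q be a power of an odd prime, F_q a finite field with q elements, and G = GL(n, F_q). Let R be a complete set of irreducible complex representations of G. Then the sum of the degrees of the real-valued irreducible characters of G satisfies Σ_{ρ ∈ R, character of ρ real-valued} dim ρ = Σ_{k=0}^{n} q^{k(n−k)} · binom(n,k)_q (as real numbers). -/

import Mathlib

open Matrix CategoryTheory
open scoped Classical

noncomputable section

/-- The Frobenius–Schur indicator of a complex-valued function on a finite group. -/
def fsIndicator (G : Type*) [Group G] [Fintype G] (χ : G → ℂ) : ℂ :=
  (Fintype.card G : ℂ)⁻¹ * ∑ g : G, χ (g * g)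

/-- The twisted Frobenius–Schur indicator of a complex-valued function on a finite group,
with respect to a map `σ`. -/
def twistedFSIndicator (G : Type*) [Group G] [Fintype G] (σ : G → G) (χ : G → ℂ) : ℂ :=
  (Fintype.card G : ℂ)⁻¹ * ∑ g : G, χ (g * σ g)

/-- A complex-valued function is real-valued if all its values are real. -/
def IsRealValued {G : Type*} (χ : G → ℂ) : Prop := ∀ g : G, ∃ r : ℝ, χ g = (r : ℂ)

/-- The Gaussian binomial coefficient `binom(m,k)_q` as a real number. -/
def gbinom (m k : ℕ) (q : ℝ) : ℝ := ∏ i ∈ Finset.Icc 1 k, (q ^ (m - k + i) - 1) / (q ^ i - 1)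

section Groups

variable {N F : Type*} [Fintype N] [DecidableEq N] [Field F]

theorem sim_one (J : Matrix N N F) :
    ((1 : GL N F) : Matrix N N F)ᵀ * J * ((1 : GL N F) : Matrix N N F) = ((1 : Fˣ) : F) • J := by
  simp

theorem sim_mul {J : Matrix N N F} (a b : GL N F) (c d : Fˣ)
    (hc : (a : Matrix N N F)ᵀ * J * (a : Matrix N N F) = (c : F) • J)
    (hd : (b : Matrix N N F)ᵀ * J * (b : Matrix N N F) = (d : F) • J) :
    ((a * b : GL N F) : Matrix N N F)ᵀ * J * ((a * b : GL N F) : Matrix N N F)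
      = ((c * d : Fˣ) : F) • J := by
  calc ((a * b : GL N F) : Matrix N N F)ᵀ * J * ((a * b : GL N F) : Matrix N N F)
      = (b : Matrix N N F)ᵀ * ((a : Matrix N N F)ᵀ * J * (a : Matrix N N F)) *
          (b : Matrix N N F) := by
        rw [show ((a * b : GL N F) : Matrix N N F) = (a : Matrix N N F) * b from rfl,
          transpose_mul]
        simp only [Matrix.mul_assoc]
    _ = (b : Matrix N N F)ᵀ * ((c : F) • J) * (b : Matrix N N F) := by rw [hc]
    _ = (c : F) • ((b : Matrix N N F)ᵀ * J * (b : Matrix N N F)) := by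
        rw [Matrix.mul_smul, Matrix.smul_mul]
    _ = (c : F) • ((d : F) • J) := by rw [hd]
    _ = ((c * d : Fˣ) : F) • J := by rw [smul_smul, Units.val_mul]

theorem sim_inv {J : Matrix N N F} (a : GL N F) (c : Fˣ)
    (hc : (a : Matrix N N F)ᵀ * J * (a : Matrix N N F) = (c : F) • J) :
    ((a⁻¹ : GL N F) : Matrix N N F)ᵀ * J * ((a⁻¹ : GL N F) : Matrix N N F)
      = ((c⁻¹ : Fˣ) : F) • J := by
  have ht : ((a⁻¹ : GL N F) : Matrix N N F)ᵀ * (a : Matrix N N F)ᵀ = 1 := by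
    rw [← transpose_mul, a.mul_inv, transpose_one]
  have key : ((a⁻¹ : GL N F) : Matrix N N F)ᵀ * ((a : Matrix N N F)ᵀ * J * (a : Matrix N N F)) *
      ((a⁻¹ : GL N F) : Matrix N N F) = J := by
    calc ((a⁻¹ : GL N F) : Matrix N N F)ᵀ * ((a : Matrix N N F)ᵀ * J * (a : Matrix N N F)) *
        ((a⁻¹ : GL N F) : Matrix N N F)
        = (((a⁻¹ : GL N F) : Matrix N N F)ᵀ * (a : Matrix N N F)ᵀ) * J *
          ((a : Matrix N N F) * ((a⁻¹ : GL N F) : Matrix N N F)) := by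
          simp only [Matrix.mul_assoc]
      _ = J := by rw [ht, a.mul_inv, Matrix.one_mul, Matrix.mul_one]
  have key2 : ((a⁻¹ : GL N F) : Matrix N N F)ᵀ * ((c : F) • J) * ((a⁻¹ : GL N F) : Matrix N N F)
      = (c : F) • (((a⁻¹ : GL N F) : Matrix N N F)ᵀ * J * ((a⁻¹ : GL N F) : Matrix N N F)) := by
    rw [Matrix.mul_smul, Matrix.smul_mul]
  have h3 : (c : F) • (((a⁻¹ : GL N F) : Matrix N N F)ᵀ * J *
      ((a⁻¹ : GL N F) : Matrix N N F)) = J := by rw [← key2, ← hc, key]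
  calc ((a⁻¹ : GL N F) : Matrix N N F)ᵀ * J * ((a⁻¹ : GL N F) : Matrix N N F)
      = ((c⁻¹ : Fˣ) : F) • ((c : F) • (((a⁻¹ : GL N F) : Matrix N N F)ᵀ * J *
          ((a⁻¹ : GL N F) : Matrix N N F))) := by
        rw [smul_smul, ← Units.val_mul, inv_mul_cancel, Units.val_one, one_smul]
    _ = ((c⁻¹ : Fˣ) : F) • J := by rw [h3]

/-- The similitude group of the bilinear form given by the matrix `J`:  all invertible
matrices `g` with `gᵀ * J * g = c • J` for some nonzero scalar `c` (the similitude of `g`). -/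
def similitudeGroup (J : Matrix N N F) : Subgroup (GL N F) where
  carrier := {g | ∃ c : Fˣ, (g : Matrix N N F)ᵀ * J * (g : Matrix N N F) = (c : F) • J}
  one_mem' := ⟨1, sim_one J⟩
  mul_mem' := by rintro a b ⟨c, hc⟩ ⟨d, hd⟩; exact ⟨c * d, sim_mul a b c d hc hd⟩
  inv_mem' := by rintro a ⟨c, hc⟩; exact ⟨c⁻¹, sim_inv a c hc⟩

/-- The isometry group of the bilinear form given by the matrix `J`:  all invertible
matrices `g` with `gᵀ * J * g = J`. -/
def fixGroup (J : Matrix N N F) : Subgroup (GL N F) where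
  carrier := {g | (g : Matrix N N F)ᵀ * J * (g : Matrix N N F) = J}
  one_mem' := by simp
  mul_mem' := by
    intro a b ha hb
    have := sim_mul (J := J) a b 1 1 (by simpa using ha) (by simpa using hb)
    simpa using this
  inv_mem' := by
    intro a ha
    have := sim_inv (J := J) a 1 (by simpa using ha)
    simpa using this

/-- The group of isometries of determinant one of the bilinear form given by the matrix `J`. -/
def specialFixGroup (J : Matrix N N F) : Subgroup (GL N F) where
  carrier := {g | (g : Matrix N N F)ᵀ * J * (g : Matrix N N F) = J ∧
    ((g : Matrix N N F)).det = 1}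
  one_mem' := ⟨by simp, by simp⟩
  mul_mem' := by
    rintro a b ⟨ha1, ha2⟩ ⟨hb1, hb2⟩
    refine ⟨(fixGroup J).mul_mem ha1 hb1, ?_⟩
    rw [show ((a * b : GL N F) : Matrix N N F) = (a : Matrix N N F) * b from rfl,
      Matrix.det_mul, ha2, hb2, one_mul]
  inv_mem' := by
    rintro a ⟨ha1, ha2⟩
    refine ⟨(fixGroup J).inv_mem ha1, ?_⟩
    have h := congrArg Matrix.det a.mul_inv
    rw [Matrix.det_mul, ha2, one_mul, Matrix.det_one] at h
    exact h

/-- The connected component of the similitude group of the symmetric bilinear form on a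
`2 * m`-dimensional space given by the matrix `J`:  all similitudes `g`, with similitude
character `μ`, such that `det g = μ(g) ^ m`. -/
def connSimilitudeGroup (J : Matrix N N F) (m : ℕ) : Subgroup (GL N F) where
  carrier := {g | ∃ c : Fˣ, (g : Matrix N N F)ᵀ * J * (g : Matrix N N F) = (c : F) • J ∧
    ((g : Matrix N N F)).det = (c : F) ^ m}
  one_mem' := ⟨1, sim_one J, by simp⟩
  mul_mem' := by
    rintro a b ⟨c, hc1, hc2⟩ ⟨d, hd1, hd2⟩
    refine ⟨c * d, sim_mul a b c d hc1 hd1, ?_⟩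
    rw [show ((a * b : GL N F) : Matrix N N F) = (a : Matrix N N F) * b from rfl,
      Matrix.det_mul, hc2, hd2, Units.val_mul, mul_pow]
  inv_mem' := by
    rintro a ⟨c, hc1, hc2⟩
    refine ⟨c⁻¹, sim_inv a c hc1, ?_⟩
    have h := congrArg Matrix.det a.mul_inv
    rw [Matrix.det_mul, hc2, Matrix.det_one] at h
    have hc : ((c : F) ^ m)⁻¹ = ((c⁻¹ : Fˣ) : F) ^ m := by
      rw [← inv_pow]
      norm_cast
    rw [← hc]
    exact (inv_eq_of_mul_eq_one_right h).symm

theorem neg_one_mem_similitudeGroup (J : Matrix N N F) : (-1 : GL N F) ∈ similitudeGroup J := by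
  refine ⟨1, ?_⟩
  have h : ((-1 : GL N F) : Matrix N N F) = -1 := by simp
  rw [h]
  simp

/-- The standard symplectic form matrix `[[0, I], [-I, 0]]`. -/
def Jsp (n : ℕ) (F : Type*) [Field F] : Matrix (Fin n ⊕ Fin n) (Fin n ⊕ Fin n) F :=
  Matrix.fromBlocks 0 1 (-1) 0

/-- The standard split symmetric form matrix `[[0, I], [I, 0]]`. -/
def Jsplit (n : ℕ) (F : Type*) [Field F] : Matrix (Fin n ⊕ Fin n) (Fin n ⊕ Fin n) F :=
  Matrix.fromBlocks 0 1 1 0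

/-- A symmetric matrix `J` of size `2n` is split if it is congruent to `[[0, I], [I, 0]]`. -/
def IsSplit {n : ℕ} (J : Matrix (Fin n ⊕ Fin n) (Fin n ⊕ Fin n) F) : Prop :=
  ∃ P : GL (Fin n ⊕ Fin n) F,
    (P : Matrix (Fin n ⊕ Fin n) (Fin n ⊕ Fin n) F)ᵀ * J * P = Jsplit n F

/-- The symplectic similitude group `GSp(2n, F)`. -/
def GSp (n : ℕ) (F : Type*) [Field F] : Subgroup (GL (Fin n ⊕ Fin n) F) :=
  similitudeGroup (Jsp n F)

/-- The symplectic group `Sp(2n, F)`. -/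
def Sp (n : ℕ) (F : Type*) [Field F] : Subgroup (GL (Fin n ⊕ Fin n) F) :=
  fixGroup (Jsp n F)


/-- The underlying matrix of an element of a matrix subgroup. -/
def matOf {S : Subgroup (GL N F)} (g : ↥S) : Matrix N N F := ((g : GL N F) : Matrix N N F)

end Groups

noncomputable instance subgroupFintype {G : Type*} [Group G] [Finite G] (S : Subgroup G) :
    Fintype S := Fintype.ofFinite _

namespace AsymForms
variable {F : Type} [Field F] {V V' : Type} [AddCommGroup V] [Module F V] [AddCommGroup V']
    [Module F V']

/-- `g`-invariant bilinear forms `b`, for `g = 1 + t`, with `b x y = c * b (g ^ m y) (g x)` and `v` in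
the radical. -/
def forms (t : Module.End F V) (c : F) (m : ℕ) (v : V) : AddSubgroup (V →ₗ[F] V →ₗ[F] F) where
  carrier := {b | (∀ x y, b ((1 + t) x) ((1 + t) y) = b x y) ∧
    (∀ x y, b x y = c * b (((1 + t) ^ m) y) ((1 + t) x)) ∧ ∀ y, b v y = 0}
  add_mem' := by
    rintro a b ⟨h1, h2, h3⟩ ⟨h4, h5, h6⟩
    refine ⟨fun x y => ?_, fun x y => ?_, fun y => ?_⟩
    · rw [LinearMap.add_apply, LinearMap.add_apply, h1, h4]; rfl
    · rw [LinearMap.add_apply, LinearMap.add_apply, h2, h5, ← mul_add]; rfl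
    · simp [h3, h6]
  zero_mem' := by simp
  neg_mem' := by
    rintro a ⟨h1, h2, h3⟩
    refine ⟨fun x y => ?_, fun x y => ?_, fun y => ?_⟩
    · rw [LinearMap.neg_apply, LinearMap.neg_apply, h1]; rfl
    · rw [LinearMap.neg_apply, LinearMap.neg_apply, h2, ← mul_neg]; rfl
    · simp [h3]

lemma forms_pow_inv {t : Module.End F V} {b : V →ₗ[F] V →ₗ[F] F}
    (h : ∀ x y, b ((1 + t) x) ((1 + t) y) = b x y) (m : ℕ) (x y : V) :
    b (((1 + t) ^ m) x) (((1 + t) ^ m) y) = b x y := by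
  induction m generalizing x y with
  | zero => rfl
  | succ k ih => rw [pow_succ]; simp only [Module.End.mul_apply]; rw [ih, h]

lemma forms_rad_step [FiniteDimensional F V] {t : Module.End F V} {b : V →ₗ[F] V →ₗ[F] F}
    (ht : Function.Injective (1 + t : Module.End F V))
    (h : ∀ x y, b ((1 + t) x) ((1 + t) y) = b x y) {v : V} (hv : ∀ y, b v y = 0) (y : V) :
    b ((1 + t) v) y = 0 := by
  obtain ⟨z, rfl⟩ := (LinearMap.injective_iff_surjective.1 ht) y
  rw [h, hv]

lemma forms_rad_pow [FiniteDimensional F V] {t : Module.End F V} {b : V →ₗ[F] V →ₗ[F] F}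
    (ht : Function.Injective (1 + t : Module.End F V))
    (h : ∀ x y, b ((1 + t) x) ((1 + t) y) = b x y) {v : V} (hv : ∀ y, b v y = 0) (m : ℕ) (y : V) :
    b (((1 + t) ^ m) v) y = 0 := by
  induction m generalizing y with
  | zero => exact hv y
  | succ k ih => rw [pow_succ']; exact forms_rad_step ht h ih y

lemma forms_rad_right [FiniteDimensional F V] {t : Module.End F V} {c : F} {m : ℕ} {v : V}
    (ht : Function.Injective (1 + t : Module.End F V))
    {b : V →ₗ[F] V →ₗ[F] F} (hb : b ∈ forms t c m v) (x : V) : b x v = 0 := by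
  rw [hb.2.1, forms_rad_pow ht hb.1 hb.2.2, mul_zero]

variable (p : V →ₗ[F] V') (i : V' →ₗ[F] V)

lemma pow_comm_i (m : ℕ) (x : V') : ((1 + i ∘ₗ p : Module.End F V) ^ m) (i x)
    = i (((1 + p ∘ₗ i : Module.End F V') ^ m) x) := by
  induction m generalizing x with
  | zero => rfl
  | succ k ih =>
    rw [pow_succ, pow_succ]; simp only [Module.End.mul_apply]
    rw [← ih]; simp

lemma injective_one_add_swap (hi : Function.Injective i)
    (h : Function.Injective (1 + i ∘ₗ p : Module.End F V)) :
    Function.Injective (1 + p ∘ₗ i : Module.End F V') := by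
  intro x y hxy
  apply hi; apply h
  have := congrArg i hxy
  simpa using this

/-- the value of an invariant form on the image of `i` -/
lemma inv_left {b : V →ₗ[F] V →ₗ[F] F}
    (h : ∀ x y, b ((1 + i ∘ₗ p : Module.End F V) x) ((1 + i ∘ₗ p : Module.End F V) y) = b x y)
    (x y : V) : b (i (p x)) y = - b ((1 + i ∘ₗ p : Module.End F V) x) (i (p y)) := by
  have := h x y
  simp only [LinearMap.add_apply, Module.End.one_apply, LinearMap.comp_apply, map_add] at this ⊢
  linear_combination this

/-- descent of an invariant form along `p` -/
def descend (hp : Function.Surjective p) : (V →ₗ[F] V →ₗ[F] F) →ₗ[F] (V' →ₗ[F] V' →ₗ[F] F) where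
  toFun b := (b.compl₂ i).comp (p.exists_rightInverse_of_surjective
      (LinearMap.range_eq_top.2 hp)).choose
  map_add' _ _ := by ext; simp
  map_smul' _ _ := by ext; simp

lemma descend_apply (hp : Function.Surjective p) {b : V →ₗ[F] V →ₗ[F] F}
    (h : ∀ x y, b ((1 + i ∘ₗ p : Module.End F V) x) ((1 + i ∘ₗ p : Module.End F V) y) = b x y)
    (x : V) (y : V') : descend p i hp b (p x) y = b x (i y) := by
  have hs := (p.exists_rightInverse_of_surjective (LinearMap.range_eq_top.2 hp)).choose_spec
  set s := (p.exists_rightInverse_of_surjective (LinearMap.range_eq_top.2 hp)).choose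
  have hps : ∀ z, p (s z) = z := fun z => LinearMap.congr_fun hs z
  obtain ⟨y, rfl⟩ := hp y
  have h1 : p (s (p x) - x) = 0 := by rw [map_sub, hps, sub_self]
  have h2 := inv_left p i h (s (p x) - x) y
  simp only [h1, map_zero, LinearMap.zero_apply, LinearMap.add_apply, Module.End.one_apply,
    LinearMap.comp_apply, map_sub, map_add, LinearMap.sub_apply, hps] at h2
  change b (s (p x)) (i (p y)) = b x (i (p y))
  linear_combination h2

variable {p i}

lemma descend_mem (hp : Function.Surjective p) {c : F} {m : ℕ} {v : V} {b : V →ₗ[F] V →ₗ[F] F}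
    (hb : b ∈ forms (i ∘ₗ p) c m v) : descend p i hp b ∈ forms (p ∘ₗ i) (-c) (m + 1) 0 := by
  have hd := descend_apply p i hp hb.1
  have hpg : ∀ x, (1 + p ∘ₗ i : Module.End F V') (p x) = p ((1 + i ∘ₗ p : Module.End F V) x) := by
    intro x; simp
  refine ⟨fun x y => ?_, fun x y => ?_, by simp⟩
  · obtain ⟨x, rfl⟩ := hp x
    rw [hpg, hd, hd, ← hb.1 x (i y)]
    simp
  · obtain ⟨x, rfl⟩ := hp x
    obtain ⟨y, rfl⟩ := hp y
    rw [hd, hb.2.1, pow_comm_i]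
    have : ((1 + p ∘ₗ i : Module.End F V') ^ m) (p y) =
        p (((1 + i ∘ₗ p : Module.End F V) ^ m) y) := by
      clear * - hpg
      induction m generalizing y with
      | zero => rfl
      | succ k ih =>
        rw [pow_succ, pow_succ]; simp only [Module.End.mul_apply]
        rw [hpg, ih]
    rw [pow_succ', Module.End.mul_apply, this, hpg, hpg, hd, inv_left p i hb.1]
    simp
    ring

variable (p i) in
/-- a form on `V` with prescribed restriction to `V × V'` -/
def extend (P : V →ₗ[F] V') (b : V' →ₗ[F] V' →ₗ[F] F) : V →ₗ[F] V →ₗ[F] F :=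
  b.compl₁₂ p P - b.compl₁₂ ((1 + p ∘ₗ i) ∘ₗ P) (p - p ∘ₗ i ∘ₗ P)

lemma extend_apply (P : V →ₗ[F] V') (b : V' →ₗ[F] V' →ₗ[F] F) (x y : V) :
    extend p i P b x y = b (p x) (P y) - b ((1 + p ∘ₗ i : Module.End F V') (P x))
        (p y - p (i (P y))) :=
  rfl

lemma extend_right {P : V →ₗ[F] V'} (hP : ∀ x, P (i x) = x) (b : V' →ₗ[F] V' →ₗ[F] F) (x : V)
    (y : V') :
    extend p i P b x (i y) = b (p x) y := by
  simp [extend_apply, hP]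

lemma extend_left {P : V →ₗ[F] V'} (hP : ∀ x, P (i x) = x) {b : V' →ₗ[F] V' →ₗ[F] F}
    (hb : ∀ x y, b ((1 + p ∘ₗ i : Module.End F V') x) ((1 + p ∘ₗ i : Module.End F V') y) = b x y)
    (x : V') (y : V) :
    extend p i P b (i x) y = - b ((1 + p ∘ₗ i : Module.End F V') x) (p y) := by
  rw [extend_apply, hP]
  have := hb x (P y)
  simp only [LinearMap.add_apply, Module.End.one_apply, LinearMap.comp_apply, map_add,
    map_sub] at this ⊢
  linear_combination this

lemma extend_inv {P : V →ₗ[F] V'} (hP : ∀ x, P (i x) = x) {b : V' →ₗ[F] V' →ₗ[F] F}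
    (hb : ∀ x y, b ((1 + p ∘ₗ i : Module.End F V') x) ((1 + p ∘ₗ i : Module.End F V') y) = b x y)
    (x y : V) : extend p i P b ((1 + i ∘ₗ p : Module.End F V) x) ((1 + i ∘ₗ p : Module.End F V) y)
      = extend p i P b x y := by
  have h1 := extend_left hP hb (p x) y
  have h2 := extend_right (p := p) hP b x (p y)
  have h3 := extend_right (p := p) hP b (i (p x)) (p y)
  simp only [LinearMap.add_apply, Module.End.one_apply, LinearMap.comp_apply, map_add] at *
  linear_combination h1 + h2 + h3

/-- the symmetrization of an invariant form -/
def symm (t : Module.End F V) (c : F) (m : ℕ) (b : V →ₗ[F] V →ₗ[F] F) : V →ₗ[F] V →ₗ[F] F :=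
  (2⁻¹ : F) • (b + c • (b.compl₁₂ ((1 + t) ^ m) (1 + t)).flip)

lemma symm_apply (t : Module.End F V) (c : F) (m : ℕ) (b : V →ₗ[F] V →ₗ[F] F) (x y : V) :
    symm t c m b x y = 2⁻¹ * (b x y + c * b (((1 + t) ^ m) y) ((1 + t) x)) := rfl

lemma symm_mem {t : Module.End F V} {c : F} (hc : c * c = 1) (m : ℕ) {b : V →ₗ[F] V →ₗ[F] F}
    (h : ∀ x y, b ((1 + t) x) ((1 + t) y) = b x y) {v : V} (h1 : ∀ y, b v y = 0)
    (h2 : ∀ y, b y ((1 + t) v) = 0) : symm t c m b ∈ forms t c m v := by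
  have hcomm : ∀ x, ((1 + t) ^ m) ((1 + t) x) = (1 + t) (((1 + t) ^ m) x) := by
    intro x; rw [← Module.End.mul_apply, ← Module.End.mul_apply, ← pow_succ, ← pow_succ']
  refine ⟨fun x y => ?_, fun x y => ?_, fun y => ?_⟩
  · rw [symm_apply, symm_apply, h, hcomm, h]
  · rw [symm_apply, symm_apply, hcomm, h, forms_pow_inv h]
    linear_combination (-2⁻¹ * b x y) * hc
  · rw [symm_apply, h1, h2]; ring

lemma symm_extend_right [FiniteDimensional F V'] (h2 : (2 : F) ≠ 0) {P : V →ₗ[F] V'}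
    (hP : ∀ x, P (i x) = x)
    {c : F} {m : ℕ} {b : V' →ₗ[F] V' →ₗ[F] F} {v' : V'} (hb : b ∈ forms (p ∘ₗ i) (-c) (m + 1) v')
    (x : V) (y : V') :
    symm (i ∘ₗ p) c m (extend p i P b) x (i y) = b (p x) y := by
  rw [symm_apply, extend_right hP, pow_comm_i, extend_left hP hb.1, ← Module.End.mul_apply,
      ← pow_succ']
  have := hb.2.1 (p x) y
  simp only [LinearMap.add_apply, Module.End.one_apply, LinearMap.comp_apply, map_add] at this ⊢
  field_simp
  linear_combination -this

lemma extend_rad_range [FiniteDimensional F V'] (hinj : Function.Injective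
    (1 + p ∘ₗ i : Module.End F V'))
    {P : V →ₗ[F] V'} (hP : ∀ x, P (i x) = x) {c : F} (hc : c * c = 1) {m : ℕ} {v' : V'}
    {b : V' →ₗ[F] V' →ₗ[F] F} (hb : b ∈ forms (p ∘ₗ i) (-c) (m + 1) v') :
    symm (i ∘ₗ p) c m (extend p i P b) ∈ forms (i ∘ₗ p) c m (i v') := by
  have hb' : b ∈ forms (p ∘ₗ i) (-c) (m + 1) ((1 + p ∘ₗ i : Module.End F V') v') :=
    ⟨hb.1, hb.2.1, forms_rad_step hinj hb.1 hb.2.2⟩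
  refine symm_mem hc m (extend_inv hP hb.1) (fun y => ?_) fun y => ?_
  · rw [extend_left hP hb.1, hb'.2.2, neg_zero]
  · have : (1 + i ∘ₗ p : Module.End F V) (i v') = i ((1 + p ∘ₗ i : Module.End F V') v') := by simp
    rw [this, extend_right hP, forms_rad_right hinj hb']

lemma extend_rad_compl [FiniteDimensional F V'] (hinj : Function.Injective
    (1 + p ∘ₗ i : Module.End F V'))
    {P : V →ₗ[F] V'} (hP : ∀ x, P (i x) = x) {c : F} (hc : c * c = 1) {m : ℕ} {v : V} (hv : P v = 0)
    {b : V' →ₗ[F] V' →ₗ[F] F} (hb : b ∈ forms (p ∘ₗ i) (-c) (m + 1) (p v)) :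
    symm (i ∘ₗ p) c m (extend p i P b) ∈ forms (i ∘ₗ p) c m v := by
  have hr := forms_rad_right hinj hb
  refine symm_mem hc m (extend_inv hP hb.1) (fun y => ?_) fun y => ?_
  · rw [extend_apply, hb.2.2, hv]; simp
  · have : (1 + i ∘ₗ p : Module.End F V) v = v + i (p v) := by simp
    rw [this, map_add, extend_right hP, hr, extend_apply, hv]
    simp [hr]

/-- bilinear forms with `b x y = c * b y x` whose radical contains `A` -/
def symForms (A : Submodule F V) (c : F) : AddSubgroup (V →ₗ[F] V →ₗ[F] F) where
  carrier := {b | (∀ x y, b x y = c * b y x) ∧ ∀ v ∈ A, ∀ y, b v y = 0}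
  add_mem' := by
    rintro a b ⟨h1, h2⟩ ⟨h4, h5⟩
    refine ⟨fun x y => ?_, fun x hx y => ?_⟩
    · rw [LinearMap.add_apply, LinearMap.add_apply, h1, h4, ← mul_add]; rfl
    · simp [h2 x hx, h5 x hx]
  zero_mem' := by simp
  neg_mem' := by
    rintro a ⟨h1, h2⟩
    refine ⟨fun x y => ?_, fun x hx y => ?_⟩
    · rw [LinearMap.neg_apply, LinearMap.neg_apply, h1, ← mul_neg]; rfl
    · simp [h2 x hx]

lemma forms_and_vanish_iff {c : F} {m : ℕ} {v : V} (b : V →ₗ[F] V →ₗ[F] F) :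
    (b ∈ forms (i ∘ₗ p) c m v ∧ ∀ x y, b x (i y) = 0) ↔
      b ∈ symForms (LinearMap.range i ⊔ Submodule.span F {v}) c := by
  have key : (∀ x y, b x (i y) = 0) → (∀ x y, b (i x) y = 0) →
      (∀ m x y, b (((1 + i ∘ₗ p : Module.End F V) ^ m) x) y = b x y) ∧
      (∀ x y, b x ((1 + i ∘ₗ p : Module.End F V) y) = b x y) := by
    intro h1 h2
    refine ⟨fun m x y => ?_, fun x y => by simp [h1]⟩
    induction m generalizing x with
    | zero => rfl
    | succ k ih => rw [pow_succ, Module.End.mul_apply, ih]; simp [h2]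
  constructor
  · rintro ⟨hb, h⟩
    have hl : ∀ x y, b (i x) y = 0 := fun x y => by
      rw [hb.2.1, LinearMap.add_apply, Module.End.one_apply, LinearMap.comp_apply, ← map_add, h,
          mul_zero]
    obtain ⟨k1, k2⟩ := key h hl
    refine ⟨fun x y => ?_, fun w hw y => ?_⟩
    · rw [hb.2.1, k1, k2]
    · obtain ⟨_, ⟨a, rfl⟩, z, hz, rfl⟩ := Submodule.mem_sup.1 hw
      obtain ⟨r, rfl⟩ := Submodule.mem_span_singleton.1 hz
      simp [hl, hb.2.2]
  · rintro ⟨h1, h2⟩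
    have hl : ∀ x y, b (i x) y = 0 := fun x y =>
      h2 _ (Submodule.mem_sup_left ⟨x, rfl⟩) y
    have hr : ∀ x y, b x (i y) = 0 := fun x y => by rw [h1, hl, mul_zero]
    obtain ⟨k1, k2⟩ := key hr hl
    refine ⟨⟨fun x y => ?_, fun x y => ?_, fun y => ?_⟩, hr⟩
    · rw [k2]; simpa using k1 1 x y
    · rw [k1, k2, h1]
    · exact h2 _ (Submodule.mem_sup_right (Submodule.mem_span_singleton_self v)) y

lemma card_eq_card_ker_mul {A B : Type} [AddGroup A] [AddGroup B]
    (f : A →+ B) (hf : Function.Surjective f) :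
    Nat.card A = Nat.card f.ker * Nat.card B := by
  rw [AddSubgroup.card_eq_card_quotient_mul_card_addSubgroup f.ker,
    Nat.card_congr (QuotientAddGroup.quotientKerEquivOfSurjective f hf).toEquiv, mul_comm]

lemma card_forms_eq [FiniteDimensional F V] [FiniteDimensional F V'] (h2 : (2 : F) ≠ 0)
    (hp : Function.Surjective p) {c : F}
    {m : ℕ} {v : V} {v' : V'} (hdesc : ∀ b ∈ forms (i ∘ₗ p) c m v, ∀ y,
      descend p i hp b v' y = 0)
    (P : V →ₗ[F] V') (hP : ∀ x, P (i x) = x)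
    (hlift : ∀ b ∈ forms (p ∘ₗ i) (-c) (m + 1) v', symm (i ∘ₗ p) c m (extend p i P b) ∈ forms
        (i ∘ₗ p) c m v) :
    Nat.card (forms (i ∘ₗ p) c m v) = Nat.card (symForms (LinearMap.range i ⊔ Submodule.span F {v})
        c) *
      Nat.card (forms (p ∘ₗ i) (-c) (m + 1) v') := by
  let f : forms (i ∘ₗ p) c m v →+ forms (p ∘ₗ i) (-c) (m + 1) v' :=
    ((descend p i hp).toAddMonoidHom.comp (forms (i ∘ₗ p) c m v).subtype).codRestrict _
      fun b => ⟨(descend_mem hp b.2).1, (descend_mem hp b.2).2.1, fun y => hdesc b.1 b.2 y⟩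
  have hf : Function.Surjective f := by
    rintro ⟨b, hb⟩
    refine ⟨⟨_, hlift b hb⟩, Subtype.ext ?_⟩
    ext x y
    obtain ⟨x, rfl⟩ := hp x
    change descend p i hp (symm (i ∘ₗ p) c m (extend p i P b)) (p x) y = b (p x) y
    rw [descend_apply p i hp (hlift b hb).1, symm_extend_right h2 hP hb]
  rw [card_eq_card_ker_mul f hf]
  congr 1
  refine Nat.card_congr ⟨fun b => ⟨b.1.1, (forms_and_vanish_iff (p := p) _).1 ⟨b.1.2, fun x y =>
      ?_⟩⟩,
    fun b => ⟨⟨b.1, ((forms_and_vanish_iff (p := p) _).2 b.2).1⟩, ?_⟩, fun b => rfl, fun b => rfl⟩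
  · have := congrArg Subtype.val (AddMonoidHom.mem_ker.1 b.2)
    have h3 := LinearMap.congr_fun₂ this (p x) y
    rw [← descend_apply p i hp b.1.2.1]; exact h3
  · rw [AddMonoidHom.mem_ker]
    apply Subtype.ext; ext x y
    obtain ⟨x, rfl⟩ := hp x
    have h3 := ((forms_and_vanish_iff (p := p) (m := m) _).2 b.2)
    change descend p i hp b.1 (p x) y = 0
    rw [descend_apply p i hp h3.1.1, h3.2]

section Count

lemma card_symForms {A : Submodule F V} {k : ℕ} (e : (V ⧸ A) ≃ₗ[F] (Fin k → F)) {c : F} :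
    Nat.card (symForms A c) = Nat.card {M : Fin k → Fin k → F // ∀ i j, M i j = c * M j i} := by
  obtain ⟨σ, hσ⟩ := (e.toLinearMap ∘ₗ A.mkQ).exists_rightInverse_of_surjective
    (LinearMap.range_eq_top.2 (e.surjective.comp A.mkQ_surjective))
  set π := e.toLinearMap ∘ₗ A.mkQ with hπ
  have hσ' : ∀ z, π (σ z) = z := fun z => LinearMap.congr_fun hσ z
  have hker : ∀ x, π x = 0 ↔ x ∈ A := by simp [hπ]
  let f : symForms A c → {M : Fin k → Fin k → F // ∀ i j, M i j = c * M j i} :=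
    fun b => ⟨fun i j => b.1 (σ (Pi.single i 1)) (σ (Pi.single j 1)), fun i j => b.2.1 _ _⟩
  have hb : ∀ b : symForms A c, ∀ x y, b.1 x y = b.1 (σ (π x)) (σ (π y)) := by
    intro b x y
    have h1 : ∀ x y, b.1 x y = b.1 (σ (π x)) y := by
      intro x y
      have := b.2.2 (x - σ (π x)) ((hker _).1 (by rw [map_sub, hσ', sub_self])) y
      rwa [map_sub b.1, LinearMap.sub_apply, sub_eq_zero] at this
    rw [h1, b.2.1, h1, ← b.2.1]
  refine Nat.card_congr (Equiv.ofBijective f ⟨fun b b' h => Subtype.ext ?_, fun M => ?_⟩)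
  · have h2 : (b.1.compl₁₂ σ σ : (Fin k → F) →ₗ[F] (Fin k → F) →ₗ[F] F) = b'.1.compl₁₂ σ σ := by
      apply (Pi.basisFun F (Fin k)).ext; intro i
      apply (Pi.basisFun F (Fin k)).ext; intro j
      have := congrFun₂ (congrArg Subtype.val h) i j
      simpa [f] using this
    ext x y
    rw [hb, hb b']
    exact LinearMap.congr_fun₂ h2 (π x) (π y)
  · have hM : ∀ x y : Fin k → F, (Matrix.toLinearMap₂' F (Matrix.of M.1)) x y =
        c * (Matrix.toLinearMap₂' F (Matrix.of M.1)) y x := by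
      intro x y
      simp only [Matrix.toLinearMap₂'_apply, Finset.mul_sum]
      rw [Finset.sum_comm]
      refine Finset.sum_congr rfl fun i _ => Finset.sum_congr rfl fun j _ => ?_
      simp only [Matrix.of_apply, smul_eq_mul]
      rw [M.2 j i]; ring
    refine ⟨⟨(Matrix.toLinearMap₂' F (Matrix.of M.1)).compl₁₂ π π, fun x y => hM _ _, fun v hv y =>
        ?_⟩, ?_⟩
    · rw [LinearMap.compl₁₂_apply, (hker v).2 hv, map_zero, LinearMap.zero_apply]
    · apply Subtype.ext
      funext i j
      simp only [f, LinearMap.compl₁₂_apply, hσ']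
      rw [Matrix.toLinearMap₂'_apply]
      simp [Pi.single_apply]

lemma card_symForms_one [Finite F] [FiniteDimensional F V] (A : Submodule F V) :
    Nat.card (symForms A (1 : F)) = Nat.card F ^ (∑ j ∈ Finset.range (Module.finrank F (V ⧸ A)),
        (j + 1)) := by
  rw [card_symForms (Module.finBasis F (V ⧸ A)).equivFun]
  set k := Module.finrank F (V ⧸ A)
  have : Nat.card {p : Fin k × Fin k // p.1 ≤ p.2} = ∑ j ∈ Finset.range k, (j + 1) := by
    rw [Nat.card_eq_fintype_card, Fintype.card_subtype, Finset.card_filter, Fintype.sum_prod_type,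
      Finset.sum_comm, ← Fin.sum_univ_eq_sum_range (fun j => j + 1)]
    refine Finset.sum_congr rfl fun j _ => ?_
    rw [← Finset.card_filter, ← Fin.card_Iic]
    congr 1; ext; simp
  rw [← this, ← Nat.card_fun]
  refine Nat.card_congr ⟨fun M p => M.1 p.1.1 p.1.2, fun f => ⟨fun i j =>
    if h : i ≤ j then f ⟨(i, j), h⟩ else f ⟨(j, i), le_of_not_ge h⟩, fun i j => ?_⟩, fun M =>
        ?_, fun f => ?_⟩
  · rcases lt_trichotomy i j with h | h | h
    · simp [h.le, h.not_ge]
    · subst h; simp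
    · simp [h.le, h.not_ge]
  · apply Subtype.ext; funext i j
    by_cases h : i ≤ j
    · simp [h]
    · simp only [h]; simpa using (M.2 i j).symm
  · funext p; simp [p.2]

lemma card_symForms_neg_one [Finite F] [FiniteDimensional F V] (h2 : (2 : F) ≠ 0)
    (A : Submodule F V) :
    Nat.card (symForms A (-1 : F)) = Nat.card F ^ (∑ j ∈ Finset.range (Module.finrank F (V ⧸ A)),
        j) := by
  rw [card_symForms (Module.finBasis F (V ⧸ A)).equivFun]
  set k := Module.finrank F (V ⧸ A)
  have : Nat.card {p : Fin k × Fin k // p.1 < p.2} = ∑ j ∈ Finset.range k, j := by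
    rw [Nat.card_eq_fintype_card, Fintype.card_subtype, Finset.card_filter, Fintype.sum_prod_type,
      Finset.sum_comm, ← Fin.sum_univ_eq_sum_range (fun j => j)]
    refine Finset.sum_congr rfl fun j _ => ?_
    rw [← Finset.card_filter, ← Fin.card_Iio]
    congr 1; ext; simp
  rw [← this, ← Nat.card_fun]
  refine Nat.card_congr ⟨fun M p => M.1 p.1.1 p.1.2, fun f => ⟨fun i j =>
    if h : i < j then f ⟨(i, j), h⟩ else if h : j < i then - f ⟨(j, i), h⟩ else 0, fun i j => ?_⟩,
    fun M => ?_, fun f => ?_⟩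
  · rcases lt_trichotomy i j with h | h | h
    · simp [h, h.not_gt]
    · subst h; simp
    · simp [h, h.not_gt]
  · apply Subtype.ext; funext i j
    have hM := M.2 i j
    rcases lt_trichotomy i j with h | h | h
    · simp [h]
    · subst h
      simp only [lt_irrefl, dite_false]
      have : 2 * M.1 i i = 0 := by linear_combination hM
      exact ((mul_eq_zero.1 this).resolve_left h2).symm
    · simp only [h, h.not_gt, dite_true, dite_false]
      linear_combination -hM
  · funext p; simp [p.2]

end Count

/-- `(-1) ^ r` where `r` is minimal with `t ^ r v = 0`, or `0` if there is no such `r` -/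
def weight (t : Module.End F V) (v : V) : ℤ :=
  if h : ∃ r : ℕ, (t ^ r) v = 0 then (-1) ^ Nat.find h else 0

lemma weight_zero (t : Module.End F V) : weight t 0 = 1 := by
  have h : ∃ r : ℕ, (t ^ r) (0 : V) = 0 := ⟨0, rfl⟩
  rw [weight, dif_pos h, (Nat.find_eq_zero h).2 rfl, pow_zero]

lemma weight_eq_of_iff {t : Module.End F V} {t' : Module.End F V'} {v : V} {v' : V'}
    (h : ∀ r : ℕ, (t ^ r) v = 0 ↔ (t' ^ r) v' = 0) : weight t v = weight t' v' := by
  simp only [weight, h]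

lemma weight_of_succ {t : Module.End F V} {t' : Module.End F V'} {v : V} {v' : V'} (hv : v ≠ 0)
    (h : ∀ r : ℕ, (t ^ (r + 1)) v = 0 ↔ (t' ^ r) v' = 0) : weight t v = - weight t' v' := by
  unfold weight
  by_cases h' : ∃ r : ℕ, (t' ^ r) v' = 0
  · have h1 : ∃ r : ℕ, (t ^ r) v = 0 := let ⟨r, hr⟩ := h'; ⟨r + 1, (h r).2 hr⟩
    rw [dif_pos h', dif_pos h1]
    have h2 : ∃ r : ℕ, (t ^ (r + 1)) v = 0 := let ⟨r, hr⟩ := h'; ⟨r, (h r).2 hr⟩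
    rw [Nat.find_comp_succ h1 h2 hv, pow_succ]
    simp only [h, mul_neg, mul_one]
  · rw [dif_neg h', dif_neg, neg_zero]
    rintro ⟨r, hr⟩
    cases r with
    | zero => exact hv hr
    | succ r => exact h' ⟨r, (h r).1 hr⟩

lemma t_pow_i (r : ℕ) (x : V') : ((i ∘ₗ p : Module.End F V) ^ r) (i x) =
    i (((p ∘ₗ i : Module.End F V') ^ r) x) := by
  induction r generalizing x with
  | zero => rfl
  | succ k ih =>
    rw [pow_succ, pow_succ]
    simp only [Module.End.mul_apply, LinearMap.comp_apply]
    rw [ih]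

lemma weight_i (hi : Function.Injective i) (x : V') : weight (i ∘ₗ p) (i x) = weight (p ∘ₗ i) x :=
  weight_eq_of_iff fun r => by rw [t_pow_i, map_eq_zero_iff i hi]

lemma weight_p (hi : Function.Injective i) {v : V} (hv : v ≠ 0) : weight (i ∘ₗ p) v =
    - weight (p ∘ₗ i) (p v) :=
  weight_of_succ hv fun r => by
    rw [pow_succ, Module.End.mul_apply, LinearMap.comp_apply, t_pow_i, map_eq_zero_iff i hi]

lemma sum_comp_of_surjective [Fintype V] [Fintype V'] (hp : Function.Surjective p) (f : V' → ℤ) :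
    ∑ v, f (p v) = Nat.card (LinearMap.ker p) * ∑ v', f v' := by
  obtain ⟨s, hs⟩ := p.exists_rightInverse_of_surjective (LinearMap.range_eq_top.2 hp)
  have hs' : ∀ z, p (s z) = z := fun z => LinearMap.congr_fun hs z
  let e : (LinearMap.ker p) × V' ≃ V := ⟨fun x => x.1 + s x.2, fun v =>
      (⟨v - s (p v), by simp [hs']⟩, p v),
    fun x => by
      have : p x.1 = 0 := x.1.2
      ext <;> simp [hs', this], fun v => by simp⟩
  rw [← e.sum_comp, Fintype.sum_prod_type, Nat.card_eq_fintype_card]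
  have : ∀ (a : LinearMap.ker p) (b : V'), p (e (a, b)) = b := by
    intro a b
    have : p a = 0 := a.2
    change p (a + s b) = b
    simp [hs', this]
  simp [this]

lemma card_forms_range [FiniteDimensional F V] [FiniteDimensional F V'] (h2 : (2 : F) ≠ 0)
    (hp : Function.Surjective p) (hi : Function.Injective i)
    (hinj : Function.Injective (1 + i ∘ₗ p : Module.End F V)) {c : F} (hc : c * c = 1) (m : ℕ)
        (v' : V') :
    Nat.card (forms (i ∘ₗ p) c m (i v')) = Nat.card (symForms (LinearMap.range i) c) *
      Nat.card (forms (p ∘ₗ i) (-c) (m + 1) v') := by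
  have hinj' := injective_one_add_swap p i hi hinj
  obtain ⟨P, hP⟩ := i.exists_leftInverse_of_injective (LinearMap.ker_eq_bot.2 hi)
  have hP' : ∀ z, P (i z) = z := fun z => LinearMap.congr_fun hP z
  have h := card_forms_eq h2 hp (c := c) (m := m) (v := i v') (v' := v') (fun b hb y => ?_) P hP'
    (fun b hb => extend_rad_range hinj' hP' hc hb)
  · rwa [sup_eq_left.2] at h
    rw [Submodule.span_singleton_le_iff_mem]; exact ⟨v', rfl⟩
  · rw [(descend_mem hp hb).2.1]
    obtain ⟨z, hz⟩ := hp (((1 + p ∘ₗ i : Module.End F V') ^ (m + 1)) y)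
    have h3 : (1 + i ∘ₗ p : Module.End F V) (i v') = i ((1 + p ∘ₗ i : Module.End F V') v') :=
        by simp
    rw [← hz, descend_apply p i hp hb.1, ← h3, forms_rad_right hinj (t := i ∘ₗ p) (c := c)
        (m := m), mul_zero]
    exact ⟨hb.1, hb.2.1, forms_rad_step hinj hb.1 hb.2.2⟩

lemma card_forms_not_range [FiniteDimensional F V] [FiniteDimensional F V'] (h2 : (2 : F) ≠ 0)
    (hp : Function.Surjective p) (hi : Function.Injective i)
    (hinj : Function.Injective (1 + i ∘ₗ p : Module.End F V)) {c : F} (hc : c * c = 1)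
        (m : ℕ) {v : V}
    (hv : v ∉ LinearMap.range i) :
    Nat.card (forms (i ∘ₗ p) c m v) = Nat.card (symForms (LinearMap.range i ⊔ Submodule.span F {v})
        c) *
      Nat.card (forms (p ∘ₗ i) (-c) (m + 1) (p v)) := by
  have hinj' := injective_one_add_swap p i hi hinj
  obtain ⟨P, hP⟩ := ((Submodule.span F {v}).mkQ ∘ₗ i).exists_leftInverse_of_injective (by
    rw [LinearMap.ker_eq_bot']
    intro z hz
    rw [LinearMap.comp_apply, Submodule.mkQ_apply, Submodule.Quotient.mk_eq_zero,
      Submodule.mem_span_singleton] at hz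
    obtain ⟨a, ha⟩ := hz
    by_cases h0 : a = 0
    · rw [h0, zero_smul] at ha
      exact hi (by rw [← ha, map_zero])
    · exact absurd ⟨a⁻¹ • z, by rw [map_smul, ← ha, smul_smul, inv_mul_cancel₀ h0, one_smul]⟩ hv)
  have hP' : ∀ z, (P ∘ₗ (Submodule.span F {v}).mkQ) (i z) = z := fun z => LinearMap.congr_fun hP z
  have hPv : (P ∘ₗ (Submodule.span F {v}).mkQ) v = 0 := by
    rw [LinearMap.comp_apply, Submodule.mkQ_apply, (Submodule.Quotient.mk_eq_zero _).2
      (Submodule.mem_span_singleton_self v), map_zero]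
  refine card_forms_eq h2 hp (fun b hb y => ?_) _ hP'
    (fun b hb => extend_rad_compl hinj' hP' hc hPv hb)
  rw [descend_apply p i hp hb.1, hb.2.2]

/-- One descent step for the weighted counts of forms. -/
lemma sum_weight_step [Finite F] [Fintype V] [Fintype V'] (h2 : (2 : F) ≠ 0)
    (hp : Function.Surjective p) (hi : Function.Injective i)
    (hinj : Function.Injective (1 + i ∘ₗ p : Module.End F V)) (m : ℕ)
    (hS : ∑ v, weight (p ∘ₗ i) v * Nat.card (forms (p ∘ₗ i) 1 (m + 1) v) =
      Nat.card (forms (p ∘ₗ i) (-1) (m + 2) 0))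
    (hT : ∑ v, weight (p ∘ₗ i) ((p ∘ₗ i) v) * Nat.card (forms (p ∘ₗ i) (-1) (m + 1) ((p ∘ₗ i) v)) =
      Nat.card (forms (p ∘ₗ i) 1 (m + 2) 0)) :
    (∑ v, weight (i ∘ₗ p) v * Nat.card (forms (i ∘ₗ p) 1 m v) =
      Nat.card (forms (i ∘ₗ p) (-1) (m + 1) 0)) ∧
    (∑ v, weight (i ∘ₗ p) ((i ∘ₗ p) v) * Nat.card (forms (i ∘ₗ p) (-1) m ((i ∘ₗ p) v)) =
      Nat.card (forms (i ∘ₗ p) 1 (m + 1) 0)) := by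
  set κ := Module.finrank F (V ⧸ LinearMap.range i) with hκ
  have hker : Nat.card (LinearMap.ker p) = Nat.card F ^ κ := by
    rw [Module.natCard_eq_pow_finrank (K := F)]
    congr 1
    have h1 := p.finrank_range_add_finrank_ker
    have h3 := i.finrank_range_add_finrank_ker
    have h4 := (LinearMap.range i).finrank_quotient_add_finrank
    rw [LinearMap.range_eq_top.2 hp, finrank_top] at h1
    rw [LinearMap.ker_eq_bot.2 hi, finrank_bot] at h3
    omega
  have hm1 : ((-1 : F) * -1) = 1 := by ring
  set K : ℕ := Nat.card (symForms (LinearMap.range i) (-1 : F)) with hK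
  have hK' : Nat.card (symForms (LinearMap.range i) (1 : F)) = Nat.card F ^ κ * K := by
    rw [hK, card_symForms_one, card_symForms_neg_one h2, ← hκ, ← pow_add, Finset.sum_add_distrib]
    simp [add_comm]
  have hr0 : ∀ c : F, c * c = 1 → ∀ m v', Nat.card (forms (i ∘ₗ p) c m (i v')) = _ * _ :=
    fun c hc m v' => card_forms_range h2 hp hi hinj hc m v'
  have hz : ∀ (c : F) (m : ℕ), c * c = 1 → Nat.card (forms (i ∘ₗ p) c m 0) =
      Nat.card (symForms (LinearMap.range i) c) * Nat.card (forms (p ∘ₗ i) (-c) (m + 1) 0) := by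
    intro c m hc
    have := hr0 c hc m 0
    rwa [map_zero] at this
  constructor
  · have hK2 : ∀ v ∉ LinearMap.range i, Nat.card (forms (i ∘ₗ p) 1 m v) =
        K * Nat.card (forms (p ∘ₗ i) (-1) (m + 1) (p v)) := by
      intro v hv
      rw [card_forms_not_range h2 hp hi hinj (one_mul 1) m hv]
      congr 1
      have h5 := LinearEquiv.finrank_quotient_sup_span_singleton hv
      rw [hK, card_symForms_one, card_symForms_neg_one h2, ← hκ]
      have h6 : κ = Module.finrank F (V ⧸ (LinearMap.range i ⊔ Submodule.span F {v})) + 1 :=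
          by omega
      rw [h6, Finset.sum_range_succ' (fun j => j), add_zero]
    have hsplit : ∀ f : V → ℤ, ∑ v, f v = ∑ v', f (i v') + ∑ v with v ∉ LinearMap.range i, f v := by
      intro f
      rw [← Finset.sum_filter_add_sum_filter_not Finset.univ (fun v => v ∈ LinearMap.range i)]
      congr 1
      symm
      exact Finset.sum_bij (fun v' _ => i v') (by simp) (fun a _ b _ h => hi h)
        (fun v hv => by simpa using hv) (fun _ _ => rfl)
    rw [hsplit]
    have e1 : ∑ v', weight (i ∘ₗ p) (i v') * (Nat.card (forms (i ∘ₗ p) 1 m (i v')) : ℤ) =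
        Nat.card F ^ κ * K * ∑ v', weight (p ∘ₗ i) v' *
          Nat.card (forms (p ∘ₗ i) (-1) (m + 1) v') := by
      rw [Finset.mul_sum]
      refine Finset.sum_congr rfl fun v' _ => ?_
      rw [weight_i hi, hr0 1 (one_mul 1), hK']
      push_cast; ring
    have e2 : ∑ v with v ∉ LinearMap.range i, weight (i ∘ₗ p) v * (Nat.card (forms (i ∘ₗ p) 1 m v) :
        ℤ) =
        - (K * ∑ v with v ∉ LinearMap.range i,
          weight (p ∘ₗ i) (p v) * (Nat.card (forms (p ∘ₗ i) (-1) (m + 1) (p v)) : ℤ)) := by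
      rw [Finset.mul_sum, ← Finset.sum_neg_distrib]
      refine Finset.sum_congr rfl fun v hv => ?_
      have hv' := (Finset.mem_filter.1 hv).2
      rw [weight_p hi (by rintro rfl; exact hv' (zero_mem _)), hK2 v hv']
      push_cast; ring
    have e3 := sum_comp_of_surjective hp
      (fun v' => weight (p ∘ₗ i) v' * (Nat.card (forms (p ∘ₗ i) (-1) (m + 1) v') : ℤ))
    rw [hsplit, hker] at e3
    rw [e1, e2, hz _ _ hm1, neg_neg]
    push_cast at e3 hT ⊢
    rw [← hT]
    simp only [Function.comp_apply]
    linear_combination (-K : ℤ) * e3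
  · have e1 : ∀ v, weight (i ∘ₗ p) ((i ∘ₗ p) v) * (Nat.card (forms (i ∘ₗ p) (-1) m ((i ∘ₗ p) v)) :
        ℤ) =
        K * (weight (p ∘ₗ i) (p v) * Nat.card (forms (p ∘ₗ i) 1 (m + 1) (p v))) := by
      intro v
      rw [LinearMap.comp_apply, weight_i hi, hr0 _ hm1, neg_neg]
      push_cast; ring
    simp only [e1]
    rw [← Finset.mul_sum, sum_comp_of_surjective hp
      (fun v' => weight (p ∘ₗ i) v' * (Nat.card (forms (p ∘ₗ i) 1 (m + 1) v') : ℤ)), hS,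
      hz _ _ (one_mul 1), hK', hker]
    push_cast; ring

lemma sum_weight_aux [Finite F] (h2 : (2 : F) ≠ 0) (n : ℕ) :
    ∀ (V : Type) [AddCommGroup V] [Module F V] [Fintype V], Module.finrank F V = n →
    ∀ (t : Module.End F V), Function.Injective (1 + t : Module.End F V) → ∀ m : ℕ,
    (∑ v, weight t v * Nat.card (forms t 1 m v) = (Nat.card (forms t (-1) (m + 1) 0) : ℤ)) ∧
    (∑ v, weight t (t v) * Nat.card (forms t (-1) m (t v)) =
        (Nat.card (forms t 1 (m + 1) 0) : ℤ)) := by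
  induction n using Nat.strong_induction_on with
  | _ n ih =>
  intro V _ _ _ hn t hinj m
  by_cases ht : Function.Injective t
  · have hsurj := LinearMap.injective_iff_surjective.1 ht
    have hpow : ∀ r : ℕ, Function.Injective (t ^ r : Module.End F V) := by
      intro r
      induction r with
      | zero => exact fun _ _ h => h
      | succ k ih' => rw [pow_succ]; exact ih'.comp ht
    have hw : ∀ v : V, v ≠ 0 → weight t v = 0 := by
      intro v hv
      rw [weight, dif_neg]
      rintro ⟨r, hr⟩
      exact hv ((map_eq_zero_iff _ (hpow r)).1 hr)
    have hid : (LinearMap.id : V →ₗ[F] V) ∘ₗ t = t := rfl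
    have hid' : t ∘ₗ (LinearMap.id : V →ₗ[F] V) = t := rfl
    have hA : LinearMap.range (LinearMap.id : V →ₗ[F] V) = ⊤ := LinearMap.range_id
    have hfr : Module.finrank F (V ⧸ (⊤ : Submodule F V)) = 0 :=
      Module.finrank_zero_of_subsingleton
    have hc := fun (c : F) (hc : c * c = 1) => card_forms_range (p := t)
        (i := LinearMap.id) h2 hsurj
      (fun _ _ h => h) (by simpa using hinj) hc m 0
    constructor
    · rw [Finset.sum_eq_single 0 (fun v _ hv => by rw [hw v hv, zero_mul]) (by simp), weight_zero]
      have := hc 1 (one_mul 1)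
      rw [hA, card_symForms_one, hfr] at this
      simpa [hid, hid'] using this
    · rw [Finset.sum_eq_single 0 (fun v _ hv => by
        rw [hw _ fun h => hv ((map_eq_zero_iff _ ht).1 h), zero_mul]) (by simp), map_zero,
            weight_zero]
      have := hc (-1) (by ring)
      rw [hA, card_symForms_neg_one h2, hfr] at this
      simpa [hid, hid'] using this
  · set i := (LinearMap.range t).subtype with hi
    set p := t.rangeRestrict with hp
    have hip : i ∘ₗ p = t := rfl
    have hi' : Function.Injective i := Subtype.val_injective
    have hlt : Module.finrank F (LinearMap.range t) < n := by
      rw [← hn]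
      apply Submodule.finrank_lt
      intro h
      exact ht (LinearMap.injective_iff_surjective.2 (LinearMap.range_eq_top.1 h))
    let _ : Fintype (LinearMap.range t) := Fintype.ofFinite _
    have h := ih _ hlt (LinearMap.range t) rfl (p ∘ₗ i) (injective_one_add_swap p i hi' hinj)
        (m + 1)
    exact sum_weight_step h2 t.surjective_rangeRestrict hi' hinj m h.1 h.2

/-- The weighted count of the forms `b` with `b x y = b y (g x)` and a vector in the radical equals
the number of `g`-invariant alternating forms, `g = 1 + t`. -/
theorem sum_weight_card_forms [Finite F] (h2 : (2 : F) ≠ 0) [Fintype V] (t : Module.End F V)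
    (hinj : Function.Injective (1 + t : Module.End F V)) :
    ∑ v, weight t v * Nat.card (forms t 1 0 v) = (Nat.card (forms t (-1) 1 0) : ℤ) :=
  (sum_weight_aux h2 _ V rfl t hinj 0).1

end AsymForms

namespace SymplecticTrace

open Module

/-- `x` is `2 * m` times an algebraic integer. -/
def IsEvenMultiple (m : ℕ) (x : ℂ) : Prop := ∃ z : ℂ, IsIntegral ℤ z ∧ x = 2 * m * z

/-- A complex representation is symplectic if it preserves a nondegenerate alternating form. -/
def IsSymplectic {G E : Type*} [Monoid G] [AddCommGroup E] [Module ℂ E]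
    (ρ : Representation ℂ G E) : Prop :=
  ∃ B : E →ₗ[ℂ] E →ₗ[ℂ] ℂ, B.IsAlt ∧ B.SeparatingLeft ∧ ∀ g v w, B (ρ g v) (ρ g w) = B v w

/-- A weight `N` on `L` is even if its pairing with the character of any symplectic representation
of `L` is `2 * |L|` times an algebraic integer. -/
def IsEvenWeight {L : Type*} [Group L] [Fintype L] (N : L → ℂ) : Prop :=
  ∀ (E : Type) [AddCommGroup E] [Module ℂ E] [FiniteDimensional ℂ E] (ρ : Representation ℂ L E),
    IsSymplectic ρ → IsEvenMultiple (Nat.card L) (∑ l, ρ.character l * N l)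

lemma even_finrank {E : Type*} [AddCommGroup E] [Module ℂ E] [FiniteDimensional ℂ E]
    {B : E →ₗ[ℂ] E →ₗ[ℂ] ℂ} (h1 : B.IsAlt) (h2 : B.SeparatingLeft) : Even (finrank ℂ E) := by
  set b := finBasis ℂ E
  have h3 := (LinearMap.separatingLeft_iff_det_ne_zero b).1 h2
  set A := LinearMap.toMatrix₂ b b B
  have hA : A.transpose = -A := by
    ext i j
    simp [A, LinearMap.toMatrix₂_apply, h1.neg]
  have h4 := Matrix.det_transpose A
  rw [hA, Matrix.det_neg, Fintype.card_fin] at h4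
  rcases Nat.even_or_odd (finrank ℂ E) with h | h
  · exact h
  · rw [h.neg_one_pow] at h4
    exact absurd (by linear_combination (-1 / 2 : ℂ) * h4) h3

/-- The projection onto the `ζ`-eigenspace of an endomorphism of order dividing `m`. -/
def eigenProj {E : Type*} [AddCommGroup E] [Module ℂ E] (U : End ℂ E) (m : ℕ) (ζ : ℂ) : End ℂ E :=
  (m : ℂ)⁻¹ • ∑ i ∈ Finset.range m, ζ⁻¹ ^ i • U ^ i

section eigenProj

variable {E : Type*} [AddCommGroup E] [Module ℂ E] {U : End ℂ E} {m : ℕ} {ζ ω : ℂ}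

lemma sum_eigenProj (hm : 0 < m) (hU : U ^ m = 1) (hω : IsPrimitiveRoot ω m) :
    ∑ k ∈ Finset.range m, ω ^ k • eigenProj U m (ω ^ k) = U := by
  have hω0 : ω ≠ 0 := hω.ne_zero hm.ne'
  have key : ∀ i ∈ Finset.range m, (∑ k ∈ Finset.range m, ω ^ k * (ω ^ k)⁻¹ ^ i) • U ^ i =
      if i = 1 % m then (m : ℂ) • U else 0 := by
    intro i hi
    have e : ∀ k, ω ^ k * (ω ^ k)⁻¹ ^ i = (ω * ω⁻¹ ^ i) ^ k := by
      intro k; rw [mul_pow, inv_pow, inv_pow, inv_pow, ← pow_mul, ← pow_mul, mul_comm k i]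
    simp_rw [e]
    split_ifs with h
    · have h1 : ω * ω⁻¹ ^ i = 1 := by
        rw [inv_pow, mul_inv_eq_one₀ (pow_ne_zero _ hω0), h]
        conv_lhs => rw [← pow_one ω]
        rw [pow_eq_pow_mod 1 hω.pow_eq_one]
      have h2 : U ^ i = U := by
        conv_rhs => rw [← pow_one U]
        rw [pow_eq_pow_mod 1 hU, h]
      simp only [h1, h2, one_pow, Finset.sum_const, Finset.card_range, nsmul_eq_mul, mul_one]
    · have h1 : ω * ω⁻¹ ^ i ≠ 1 := by
        intro h1
        replace h1 : ω = ω ^ i := by rwa [inv_pow, mul_inv_eq_one₀ (pow_ne_zero _ hω0)] at h1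
        apply h
        have : ω ^ (1 % m) = ω ^ i := by rw [← pow_eq_pow_mod 1 hω.pow_eq_one, pow_one]; exact h1
        exact (hω.pow_inj (Nat.mod_lt _ hm) (Finset.mem_range.1 hi) this).symm
      have h2 : (ω * ω⁻¹ ^ i) ^ m = 1 := by
        rw [mul_pow, ← pow_mul, mul_comm i m, pow_mul, inv_pow, hω.pow_eq_one]; simp
      have h3 := geom_sum_mul (ω * ω⁻¹ ^ i) m
      rw [h2, sub_self] at h3
      rw [(mul_eq_zero.1 h3).resolve_right (sub_ne_zero.2 h1), zero_smul]
  have h1 : ∑ k ∈ Finset.range m, ω ^ k • eigenProj U m (ω ^ k) =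
      (m : ℂ)⁻¹ • ∑ i ∈ Finset.range m, (∑ k ∈ Finset.range m, ω ^ k * (ω ^ k)⁻¹ ^ i) • U ^ i := by
    simp only [eigenProj, Finset.sum_smul, Finset.smul_sum, smul_smul]
    rw [Finset.sum_comm]
    refine Finset.sum_congr rfl fun i _ => Finset.sum_congr rfl fun k _ => ?_
    congr 1; ring
  rw [h1, Finset.sum_congr rfl key, Finset.sum_ite_eq' ,
      if_pos (Finset.mem_range.2 (Nat.mod_lt _ hm)),
    smul_smul, inv_mul_cancel₀ (by exact_mod_cast hm.ne'), one_smul]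

lemma mul_eigenProj (hU : U ^ m = 1) (hζ : ζ ^ m = 1) (hm : 0 < m) :
    U * eigenProj U m ζ = ζ • eigenProj U m ζ := by
  have hζ0 : ζ ≠ 0 := by rintro rfl; simp [hm.ne'] at hζ
  have h1 : (∑ i ∈ Finset.range m, ζ⁻¹ ^ (i + 1) • U ^ (i + 1) : End ℂ E) =
      ∑ i ∈ Finset.range m, ζ⁻¹ ^ i • U ^ i := by
    have h2 := Finset.sum_range_succ (fun i : ℕ => ζ⁻¹ ^ i • U ^ i) m
    have h3 := Finset.sum_range_succ' (fun i : ℕ => ζ⁻¹ ^ i • U ^ i) m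
    rw [h2, inv_pow ζ m, hζ, hU] at h3
    simp only [inv_one, pow_zero] at h3
    exact (add_right_cancel h3).symm
  have h4 : U * ∑ i ∈ Finset.range m, ζ⁻¹ ^ i • U ^ i =
      ζ • ∑ i ∈ Finset.range m, ζ⁻¹ ^ (i + 1) • U ^ (i + 1) := by
    rw [Finset.mul_sum, Finset.smul_sum]
    refine Finset.sum_congr rfl fun i _ => ?_
    rw [mul_smul_comm, smul_smul, pow_succ' U, pow_succ' ζ⁻¹, mul_inv_cancel_left₀ hζ0]
  rw [eigenProj, mul_smul_comm, h4, h1, smul_comm]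

lemma eigenProj_apply_of_eq (hm : 0 < m) (hζ : ζ ^ m = 1) {v : E} (hv : U v = ζ • v) :
    eigenProj U m ζ v = v := by
  have hζ0 : ζ ≠ 0 := by rintro rfl; simp [hm.ne'] at hζ
  have h1 : ∀ i, (U ^ i) v = ζ ^ i • v := by
    intro i
    induction i with
    | zero => simp
    | succ i ih => rw [pow_succ', Module.End.mul_apply, ih, map_smul, hv, smul_smul, pow_succ]
  simp only [eigenProj, LinearMap.smul_apply, LinearMap.sum_apply, h1, smul_smul, inv_pow]
  simp [inv_mul_cancel₀ (pow_ne_zero _ hζ0), ← Nat.cast_smul_eq_nsmul ℂ, smul_smul,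
    inv_mul_cancel₀ (show (m : ℂ) ≠ 0 by exact_mod_cast hm.ne')]

lemma apply_eigenProj_right (hm : 0 < m) (hζ : ζ ^ m = 1) {v : E} (hv : U v = ζ • v)
    {B : E →ₗ[ℂ] E →ₗ[ℂ] ℂ} (hB : ∀ x y, B (U x) (U y) = B x y) (y : E) :
    B v (eigenProj U m ζ⁻¹ y) = B v y := by
  have hζ0 : ζ ≠ 0 := by rintro rfl; simp [hm.ne'] at hζ
  have h1 : ∀ i, ζ ^ i * B v ((U ^ i) y) = B v y := by
    intro i
    induction i with
    | zero => simp
    | succ i ih =>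
      rw [← ih, ← hB v ((U ^ i) y), hv, pow_succ' U, Module.End.mul_apply, map_smul]
      simp only [LinearMap.smul_apply, smul_eq_mul]; ring
  simp only [eigenProj, LinearMap.smul_apply, LinearMap.sum_apply, inv_inv, map_smul, map_sum,
    smul_eq_mul, h1]
  simp [inv_mul_cancel_left₀ (show (m : ℂ) ≠ 0 by exact_mod_cast hm.ne')]

end eigenProj

/-- The average of a representation over a subgroup. -/
def avg {G E : Type*} [Group G] [AddCommGroup E] [Module ℂ E] (ρ : Representation ℂ G E)
    (H : Subgroup G) [Fintype H] : End ℂ E := (Fintype.card H : ℂ)⁻¹ • ∑ h : H, ρ h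

section avg
variable {G E : Type*} [Group G] [AddCommGroup E] [Module ℂ E] (ρ : Representation ℂ G E)
    (H : Subgroup G) [Fintype H]

lemma card_smul_avg : (Fintype.card H : ℂ) • avg ρ H = ∑ h : H, ρ h := by
  rw [avg, smul_smul, mul_inv_cancel₀ (by exact_mod_cast Fintype.card_ne_zero), one_smul]

lemma avg_commute {g : G} (hg : ∀ h ∈ H, g * h * g⁻¹ ∈ H) : ρ g * avg ρ H = avg ρ H * ρ g := by
  rw [avg, mul_smul_comm, smul_mul_assoc, Finset.mul_sum, Finset.sum_mul]
  congr 1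
  let f : H → H := fun h => ⟨g * h * g⁻¹, hg h h.2⟩
  have hf : Function.Bijective f := Finite.injective_iff_bijective.1 fun a b hab => by
    have := congrArg Subtype.val hab
    exact Subtype.ext (by simpa [f] using this)
  refine Fintype.sum_bijective f hf _ _ fun h => ?_
  rw [← map_mul, ← map_mul]; simp [f]

lemma mul_avg {h : G} (hh : h ∈ H) : ρ h * avg ρ H = avg ρ H := by
  rw [avg, mul_smul_comm, Finset.mul_sum]
  congr 1
  refine Fintype.sum_equiv (Equiv.mulLeft (⟨h, hh⟩ : H)) _ _ fun x => ?_
  simp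

lemma avg_apply_of_fixed {v : E} (hv : ∀ h ∈ H, ρ h v = v) : avg ρ H v = v := by
  have : ∀ h : H, ρ h v = v := fun h => hv h h.2
  simp only [avg, LinearMap.smul_apply, LinearMap.sum_apply, this, Finset.sum_const,
      Finset.card_univ]
  rw [← Nat.cast_smul_eq_nsmul ℂ, smul_smul, inv_mul_cancel₀
      (by exact_mod_cast Fintype.card_ne_zero), one_smul]

lemma apply_avg_right {B : E →ₗ[ℂ] E →ₗ[ℂ] ℂ} (hB : ∀ g v w, B (ρ g v) (ρ g w) = B v w) {v : E}
    (hv : ∀ h ∈ H, ρ h v = v) (y : E) : B v (avg ρ H y) = B v y := by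
  have : ∀ h : H, B v (ρ h y) = B v y := fun h => by
    conv_lhs => rw [← hv h h.2, hB]
  simp only [avg, LinearMap.smul_apply, LinearMap.sum_apply, map_smul, map_sum, this]
  simp

end avg

lemma IsEvenMultiple.sum {ι : Type*} {s : Finset ι} {m : ℕ} {f : ι → ℂ}
    (h : ∀ i ∈ s, IsEvenMultiple m (f i)) : IsEvenMultiple m (∑ i ∈ s, f i) := by
  choose! z hz using h
  exact ⟨∑ i ∈ s, z i, IsIntegral.sum _ fun i hi => (hz i hi).1, by
    rw [Finset.mul_sum]; exact Finset.sum_congr rfl fun i hi => (hz i hi).2⟩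

lemma IsEvenMultiple.integral_mul {m : ℕ} {x a : ℂ} (h : IsEvenMultiple m x) (ha : IsIntegral ℤ a) :
    IsEvenMultiple m (a * x) := by
  obtain ⟨z, hz, rfl⟩ := h
  exact ⟨a * z, ha.mul hz, by ring⟩

lemma IsEvenMultiple.natCast_mul {m k : ℕ} {x : ℂ} (h : IsEvenMultiple m x) :
    IsEvenMultiple (k * m) (k * x) := by
  obtain ⟨z, hz, rfl⟩ := h
  exact ⟨z, hz, by push_cast; ring⟩

lemma isEvenWeight_trivial : IsEvenWeight (fun _ : Unit => (1 : ℂ)) := by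
  intro E _ _ _ ρ hρ
  obtain ⟨B, h1, h2, -⟩ := hρ
  obtain ⟨k, hk⟩ := even_finrank h1 h2
  refine ⟨k, isIntegral_algebraMap (x := (k : ℤ)), ?_⟩
  have : ∑ l : Unit, ρ.character l * 1 = ρ.character 1 := by
    rw [Fintype.sum_unique, mul_one]
  rw [this, Representation.char_one, hk]
  simp; ring

theorem isEvenMultiple_sum_character {G L E : Type} [Group G] [Group L] [Fintype L] (H : Subgroup G)
    [Fintype H] [AddCommGroup E] [Module ℂ E] [FiniteDimensional ℂ E] (ρ : Representation ℂ G E)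
    (hρ : IsSymplectic ρ) (j : L →* G) (u τ : G) {m : ℕ} (hm : 0 < m) (hum : u ^ m = 1)
    (hτ : τ * τ = 1) (hτu : τ * u * τ = u⁻¹)
    (hHu : ∀ h ∈ H, u * h * u⁻¹ ∈ H) (hHτ : ∀ h ∈ H, τ * h * τ⁻¹ ∈ H)
    (hHj : ∀ l, ∀ h ∈ H, j l * h * (j l)⁻¹ ∈ H)
    (huj : ∀ l, u * j l = j l * u) (hτj : ∀ l, τ * j l = j l * τ)
    (N : L → ℂ) (hN : IsEvenWeight N) :
    IsEvenMultiple (Nat.card H * Nat.card L) (∑ h : H, ∑ l, ρ.character (u * h * j l) * N l) := by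
  obtain ⟨B, hB1, hB2, hB3⟩ := hρ
  have hUm : ρ u ^ m = 1 := by rw [← map_pow, hum, map_one]
  obtain ⟨ω, hω⟩ : ∃ ω : ℂ, IsPrimitiveRoot ω m := ⟨_, Complex.isPrimitiveRoot_exp m hm.ne'⟩
  set P := avg ρ H
  have hcomm : ∀ ζ, ∀ T : End ℂ E, ρ u * T = T * ρ u → eigenProj (ρ u) m ζ * T =
      T * eigenProj (ρ u) m ζ := by
    intro ζ T h
    have h' : Commute (ρ u) T := h
    rw [eigenProj, smul_mul_assoc, mul_smul_comm, Finset.mul_sum, Finset.sum_mul]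
    congr 1
    refine Finset.sum_congr rfl fun i _ => ?_
    rw [smul_mul_assoc, mul_smul_comm, (h'.pow_left i).eq]
  have hjP := fun l => avg_commute ρ H (hHj l)
  have huP := avg_commute ρ H hHu
  have hujρ : ∀ l, ρ u * ρ (j l) = ρ (j l) * ρ u := fun l => by rw [← map_mul, huj, map_mul]
  -- the isotypic pieces
  have piece : ∀ ζ : ℂ, ζ ^ m = 1 → IsEvenMultiple (Nat.card L)
      (∑ l, LinearMap.trace ℂ E (eigenProj (ρ u) m ζ * P * ρ (j l)) * N l) := by
    intro ζ hζ
    have hζ0 : ζ ≠ 0 := by rintro rfl; simp [hm.ne'] at hζ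
    let W : Submodule ℂ E :=
      { carrier := {v | (∀ h ∈ H, ρ h v = v) ∧ ρ u v = ζ • v}
        zero_mem' := by simp
        add_mem' := by
          rintro a b ⟨ha, ha'⟩ ⟨hb, hb'⟩
          exact ⟨fun h hh => by rw [map_add, ha h hh, hb h hh], by rw [map_add, ha', hb', smul_add]⟩
        smul_mem' := by
          rintro c a ⟨ha, ha'⟩
          exact ⟨fun h hh => by rw [map_smul, ha h hh], by rw [map_smul, ha', smul_comm]⟩ }
    have hproj : ∀ ζ', ζ' ^ m = 1 → ∀ x, (∀ h ∈ H, ρ h ((eigenProj (ρ u) m ζ' * P) x) =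
        (eigenProj (ρ u) m ζ' * P) x) ∧
        ρ u ((eigenProj (ρ u) m ζ' * P) x) = ζ' • (eigenProj (ρ u) m ζ' * P) x := by
      intro ζ' hζ' x
      refine ⟨fun h hh => ?_, ?_⟩
      · rw [hcomm ζ' P huP, ← Module.End.mul_apply, ← mul_assoc, mul_avg ρ H hh]
      · rw [← Module.End.mul_apply, ← mul_assoc, mul_eigenProj hUm hζ' hm, smul_mul_assoc,
            LinearMap.smul_apply]
    have hWj : ∀ l, ∀ x ∈ W, ρ (j l) x ∈ W := by
      rintro l x ⟨hx, hx'⟩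
      refine ⟨fun h hh => ?_, ?_⟩
      · have h2 := hHj l⁻¹ h hh
        have : h * j l = j l * (j l⁻¹ * h * (j l⁻¹)⁻¹) := by simp [mul_assoc]
        rw [← Module.End.mul_apply, ← map_mul, this, map_mul, Module.End.mul_apply, hx _ h2]
      · rw [← Module.End.mul_apply, hujρ, Module.End.mul_apply, hx', map_smul]
    let σ : Representation ℂ L W :=
      { toFun := fun l => (ρ (j l)).restrict (hWj l)
        map_one' := by ext x; simp
        map_mul' := by intro a b; ext x; simp }
    have hσ : IsSymplectic σ := by
      refine ⟨B.compl₁₂ W.subtype (ρ τ ∘ₗ W.subtype), ?_, ?_, ?_⟩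
      · intro v
        simp only [LinearMap.compl₁₂_apply, Submodule.subtype_apply, LinearMap.comp_apply]
        have h1 := hB3 τ v (ρ τ v)
        rw [← Module.End.mul_apply, ← map_mul, hτ, map_one, Module.End.one_apply, ← hB1.neg] at h1
        have : (2 : ℂ) * B v (ρ τ v) = 0 := by linear_combination -h1
        simpa using this
      · intro v hv
        apply Subtype.ext
        refine hB2 _ fun y => ?_
        have h1 := apply_avg_right ρ H hB3 v.2.1 y
        have h2 := apply_eigenProj_right hm hζ v.2.2 (hB3 u) (P y)
        have h3 := hproj ζ⁻¹ (by rw [inv_pow, hζ, inv_one]) y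
        rw [← Module.End.mul_apply] at h2
        set w := (eigenProj (ρ u) m ζ⁻¹ * P) y
        have hw : ρ τ w ∈ W := by
          refine ⟨fun h hh => ?_, ?_⟩
          · have h4 := hHτ h hh
            have h5 : h * τ = τ * (τ * h * τ⁻¹) := by
              rw [← mul_assoc, ← mul_assoc, hτ, one_mul]
              congr 1; exact eq_inv_of_mul_eq_one_left hτ
            rw [← Module.End.mul_apply, ← map_mul, h5, map_mul, Module.End.mul_apply, h3.1 _ h4]
          · have h5 : τ * u⁻¹ = u * τ := by
              rw [← hτu, ← mul_assoc, ← mul_assoc, hτ, one_mul]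
            rw [← Module.End.mul_apply, ← map_mul, ← h5, map_mul, Module.End.mul_apply]
            rw [← map_smul]; congr 1
            have h6 : w = ρ u⁻¹ (ρ u w) := by
              rw [← Module.End.mul_apply, ← map_mul]; simp
            rw [h3.2, map_smul] at h6
            conv_rhs => rw [h6, smul_smul, mul_inv_cancel₀ hζ0, one_smul]
        have h7 := hv ⟨_, hw⟩
        simp only [LinearMap.compl₁₂_apply, Submodule.subtype_apply, LinearMap.comp_apply] at h7
        rw [← Module.End.mul_apply, ← map_mul, hτ, map_one, Module.End.one_apply] at h7
        rw [← h1, ← h2, h7]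
      · intro l v w
        simp only [LinearMap.compl₁₂_apply, Submodule.subtype_apply, LinearMap.comp_apply]
        change B (ρ (j l) v) (ρ τ (ρ (j l) w)) = _
        rw [← Module.End.mul_apply, ← map_mul, hτj, map_mul, Module.End.mul_apply, hB3]
    convert hN W σ hσ using 3 with l
    rw [Representation.character]
    have hmem : ∀ x, (ρ (j l) * (eigenProj (ρ u) m ζ * P)) x ∈ W := fun x => hWj l _ (hproj ζ hζ x)
    have h1 := LinearMap.trace_restrict_eq_of_forall_mem W _ hmem
    rw [LinearMap.trace_mul_comm, ← h1]
    congr 1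
    ext x
    have : (eigenProj (ρ u) m ζ * P) x = x := by
      rw [Module.End.mul_apply, avg_apply_of_fixed ρ H x.2.1, eigenProj_apply_of_eq hm hζ x.2.2]
    change (ρ (j l) * (eigenProj (ρ u) m ζ * P)) x = ρ (j l) x
    rw [Module.End.mul_apply, this]
  have hsum : ∑ h : H, ∑ l, ρ.character (u * h * j l) * N l =
      (Nat.card H : ℂ) * ∑ k ∈ Finset.range m, ω ^ k *
        ∑ l, LinearMap.trace ℂ E (eigenProj (ρ u) m (ω ^ k) * P * ρ (j l)) * N l := by
    have h1 : ∀ l, ∑ h : H, ρ.character (u * h * j l) = (Nat.card H : ℂ) *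
        ∑ k ∈ Finset.range m, ω ^ k * LinearMap.trace ℂ E (eigenProj (ρ u) m (ω ^ k) * P * ρ
            (j l)) := by
      intro l
      have h2 := sum_eigenProj hm hUm hω
      simp only [Representation.character]
      rw [← map_sum]
      have : ∑ h : H, ρ (u * h * j l) = (Fintype.card H : ℂ) • (ρ u * P * ρ (j l)) := by
        simp only [map_mul]
        rw [← Finset.sum_mul, ← Finset.mul_sum, ← card_smul_avg, mul_smul_comm, smul_mul_assoc]
      rw [this, map_smul, smul_eq_mul, Nat.card_eq_fintype_card]
      congr 1
      conv_lhs => rw [← h2]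
      simp only [Finset.sum_mul, map_sum, smul_mul_assoc, map_smul, smul_eq_mul]
    rw [Finset.sum_comm]
    simp_rw [← Finset.sum_mul, h1, Finset.mul_sum, Finset.sum_mul]
    rw [Finset.sum_comm]
    refine Finset.sum_congr rfl fun k _ => Finset.sum_congr rfl fun l _ => ?_
    ring
  rw [hsum]
  refine IsEvenMultiple.natCast_mul (IsEvenMultiple.sum fun k _ =>
      IsEvenMultiple.integral_mul ?_ ?_)
  · exact piece _ (by rw [← pow_mul, mul_comm, pow_mul, hω.pow_eq_one, one_pow])
  · exact (hω.isIntegral hm).pow k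

/-- Summation over the orbits of a finite group action. -/
theorem isEvenMultiple_sum_of_stabilizer {G X : Type*} [Group G] [Finite G] [MulAction G X]
    [Fintype X]
    (c : X → ℂ) (hc : ∀ (g : G) x, c (g • x) = c x)
    (h : ∀ x, IsEvenMultiple (Nat.card (MulAction.stabilizer G x)) (c x)) :
    IsEvenMultiple (Nat.card G) (∑ x, c x) := by
  rw [← Finset.sum_fiberwise Finset.univ (fun x => (Quotient.mk'' x : MulAction.orbitRel.Quotient G
      X))]
  refine IsEvenMultiple.sum fun ω _ => ?_
  obtain ⟨x, rfl⟩ := Quotient.exists_rep ω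
  obtain ⟨z, hz, hx⟩ := h x
  refine ⟨z, hz, ?_⟩
  have hmem : ∀ y, y ∈ (Finset.univ.filter fun y =>
      (Quotient.mk'' y : MulAction.orbitRel.Quotient G X) = ⟦x⟧) ↔
      y ∈ MulAction.orbit G x := by
    intro y
    rw [Finset.mem_filter, and_iff_right (Finset.mem_univ _)]
    exact Quotient.eq''
  have h1 : ∀ y ∈ (Finset.univ.filter fun y => (Quotient.mk'' y : MulAction.orbitRel.Quotient G X) =
      ⟦x⟧),
      c y = c x := by
    intro y hy
    obtain ⟨g, rfl⟩ := (hmem y).1 hy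
    exact hc g x
  have h3 : (Finset.univ.filter fun y => (Quotient.mk'' y : MulAction.orbitRel.Quotient G X) =
      ⟦x⟧).card =
      Nat.card (MulAction.orbit G x) := by
    rw [Nat.card_eq_card_toFinset]
    congr 1; ext y; rw [hmem, Set.mem_toFinset]
  have := Fintype.ofFinite G
  have h2 := MulAction.card_orbit_mul_card_stabilizer_eq_card_group G x
  rw [← Nat.card_eq_fintype_card, ← Nat.card_eq_fintype_card, ← Nat.card_eq_fintype_card] at h2
  rw [Finset.sum_congr rfl h1, Finset.sum_const, h3, hx, ← h2, nsmul_eq_mul]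
  push_cast; ring

end SymplecticTrace

namespace JordanCell

open Polynomial

variable (F : Type) [Field F] (r : ℕ)

/-- The cyclic module `F[X] / (X - 1)^r`. -/
abbrev Cell := F[X] ⧸ Ideal.span {(X - 1 : F[X]) ^ r}

/-- The class of the variable. -/
abbrev gen : Cell F r := Ideal.Quotient.mk _ X

lemma gen_sub_one_pow : (gen F r - 1) ^ r = 0 := by
  rw [gen, ← map_one (Ideal.Quotient.mk (Ideal.span {(X - 1 : F[X]) ^ r})), ← map_sub, ← map_pow,
    Ideal.Quotient.eq_zero_iff_mem]
  exact Ideal.mem_span_singleton_self _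

lemma isUnit_gen : IsUnit (gen F r) := by
  have : IsNilpotent (gen F r - 1) := ⟨r, gen_sub_one_pow F r⟩
  simpa using this.isUnit_one_add

/-- The class of the variable as a unit. -/
def genUnit : (Cell F r)ˣ := (isUnit_gen F r).unit

lemma inv_mul_gen : ((genUnit F r)⁻¹ : (Cell F r)ˣ).1 * gen F r = 1 := (genUnit F r).inv_mul

lemma gen_mul_inv : gen F r * ((genUnit F r)⁻¹ : (Cell F r)ˣ).1 = 1 := (genUnit F r).mul_inv

/-- Multiplication by the variable. -/
def shift : Cell F r ≃ₗ[F] Cell F r where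
  toFun y := gen F r * y
  invFun y := ((genUnit F r)⁻¹ : (Cell F r)ˣ).1 * y
  map_add' := mul_add _
  map_smul' c y := mul_smul_comm c _ y
  left_inv y := by beta_reduce; rw [← mul_assoc, inv_mul_gen, one_mul]
  right_inv y := by beta_reduce; rw [← mul_assoc, gen_mul_inv, one_mul]

lemma shift_apply (y : Cell F r) : shift F r y = gen F r * y := rfl

lemma mk_monomial (n : ℕ) (a : F) :
    Ideal.Quotient.mk (Ideal.span {(X - 1 : F[X]) ^ r}) (monomial n a) = a • gen F r ^ n := by
  rw [← C_mul_X_pow_eq_monomial, ← smul_eq_C_mul]; rfl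

/-- The algebra endomorphism inverting the variable. -/
def invHom : Cell F r →ₐ[F] Cell F r :=
  Ideal.Quotient.liftₐ _ (aeval ((genUnit F r)⁻¹ : (Cell F r)ˣ).1) (by
    intro a ha
    obtain ⟨b, rfl⟩ := Ideal.mem_span_singleton'.1 ha
    have h1 : ((genUnit F r)⁻¹ : (Cell F r)ˣ).1 - 1 = -((genUnit F r)⁻¹ : (Cell F r)ˣ).1 *
        (gen F r - 1) := by
      linear_combination inv_mul_gen F r
    have h2 : (((genUnit F r)⁻¹ : (Cell F r)ˣ).1 - 1) ^ r = 0 := by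
      rw [h1, mul_pow, gen_sub_one_pow, mul_zero]
    simp [h2])

lemma invHom_gen : invHom F r (gen F r) = ((genUnit F r)⁻¹ : (Cell F r)ˣ).1 := by
  change aeval _ X = _
  rw [aeval_X]

lemma invHom_inv : invHom F r ((genUnit F r)⁻¹ : (Cell F r)ˣ).1 = gen F r := by
  have h := congrArg (invHom F r) (inv_mul_gen F r)
  rw [map_mul, invHom_gen, map_one] at h
  calc _ = invHom F r ((genUnit F r)⁻¹ : (Cell F r)ˣ).1 * (((genUnit F r)⁻¹ : (Cell F r)ˣ).1 * gen F
      r) := by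
        rw [inv_mul_gen, mul_one]
    _ = gen F r := by rw [← mul_assoc, h, one_mul]

lemma invHom_invHom (x : Cell F r) : invHom F r (invHom F r x) = x := by
  have : (invHom F r).comp (invHom F r) = AlgHom.id F _ := by
    apply Ideal.Quotient.algHom_ext
    apply Polynomial.algHom_ext
    change invHom F r (invHom F r (gen F r)) = gen F r
    rw [invHom_gen, invHom_inv]
  exact DFunLike.congr_fun this x

/-- The involution inverting the variable. -/
def flip : Cell F r ≃ₗ[F] Cell F r :=
  LinearEquiv.ofInvolutive (invHom F r).toLinearMap (invHom_invHom F r)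

lemma flip_mul_flip : flip F r * flip F r = 1 := by
  ext x; exact invHom_invHom F r x

lemma flip_shift_flip : flip F r * shift F r * flip F r = (shift F r)⁻¹ := by
  ext x
  change invHom F r (gen F r * invHom F r x) = ((genUnit F r)⁻¹ : (Cell F r)ˣ).1 * x
  rw [map_mul, invHom_invHom, invHom_gen]

instance : Module.Finite F (Cell F r) := by
  have : ((X - 1 : F[X]) ^ r).Monic := (monic_X_sub_C 1).pow r
  exact this.finite_quotient

variable {F r} {V : Type} [AddCommGroup V] [Module F V]

lemma apply_gen_pow {g : V ≃ₗ[F] V} {ι : Cell F r →ₗ[F] V} (h : ∀ y, ι (shift F r y) = g (ι y))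
    (k : ℕ) :
    ι ((gen F r - 1) ^ k) = (((g : V →ₗ[F] V) - 1 : Module.End F V) ^ k) (ι 1) := by
  induction k with
  | zero => simp
  | succ k ih =>
    rw [pow_succ' _ k, pow_succ' _ k, Module.End.mul_apply, ← ih, sub_mul, one_mul, map_sub]
    have := h ((gen F r - 1) ^ k)
    rw [shift_apply] at this
    rw [this]; rfl

lemma gen_pow_eq_zero_iff (k : ℕ) : (gen F r - 1) ^ k = 0 ↔ r ≤ k := by
  rw [gen, ← map_one (Ideal.Quotient.mk (Ideal.span {(X - 1 : F[X]) ^ r})), ← map_sub, ← map_pow,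
    Ideal.Quotient.eq_zero_iff_mem, Ideal.mem_span_singleton, pow_dvd_pow_iff]
  · exact (monic_X_sub_C (1 : F)).ne_zero
  · exact not_isUnit_X_sub_C (1 : F)

lemma ext_of_apply_one {g : V ≃ₗ[F] V} {ι ι' : Cell F r →ₗ[F] V} (h : ∀ y, ι (shift F r y) =
    g (ι y))
    (h' : ∀ y, ι' (shift F r y) = g (ι' y)) (h1 : ι 1 = ι' 1) : ι = ι' := by
  refine LinearMap.ext fun y => ?_
  obtain ⟨p, rfl⟩ := Ideal.Quotient.mk_surjective y
  induction p using Polynomial.induction_on' with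
  | add p q hp hq => rw [map_add, map_add, map_add, hp, hq]
  | monomial n a =>
    have hn : ∀ n : ℕ, ι (gen F r ^ n) = ι' (gen F r ^ n) := by
      intro n
      induction n with
      | zero => simpa using h1
      | succ n ih =>
        rw [pow_succ']
        exact (h _).trans ((congrArg g ih).trans (h' _).symm)
    rw [mk_monomial, map_smul, map_smul, hn]

lemma exists_of_pow_eq_zero (g : V ≃ₗ[F] V) {v : V}
    (hv : (((g : V →ₗ[F] V) - 1 : Module.End F V) ^ r) v = 0) :
    ∃ ι : Cell F r →ₗ[F] V, (∀ y, ι (shift F r y) = g (ι y)) ∧ ι 1 = v ∧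
      ((∀ k < r, (((g : V →ₗ[F] V) - 1 : Module.End F V) ^ k) v ≠ 0) → Function.Injective ι) := by
  set f : Module.End F V := (g : V →ₗ[F] V) with hf
  let of := Module.AEval'.of f
  have hpow : ∀ k : ℕ, (X - 1 : F[X]) ^ k • of v = of (((f - 1) ^ k) v) := by
    intro k
    induction k with
    | zero => simp
    | succ k ih =>
      rw [pow_succ' _ k, mul_smul, ih, pow_succ' _ k, sub_smul, one_smul, Module.AEval'.X_smul_of,
          Module.End.mul_apply]
      simp [of]
  let s := LinearMap.toSpanSingleton F[X] (Module.AEval' f) (of v)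
  have hs : Ideal.span {(X - 1 : F[X]) ^ r} ≤ LinearMap.ker s := by
    rw [Ideal.span_singleton_le_iff_mem, LinearMap.mem_ker, LinearMap.toSpanSingleton_apply, hpow,
        hv, map_zero]
  let l := Submodule.liftQ _ s hs
  refine ⟨of.symm.toLinearMap ∘ₗ l.restrictScalars F, fun y => ?_, ?_, fun hk => ?_⟩
  · have : l ((X : F[X]) • y) = (X : F[X]) • l y := map_smul _ _ _
    have h2 : (X : F[X]) • l y = of (f (of.symm (l y))) := by
      conv_lhs => rw [← of.apply_symm_apply (l y)]
      exact Module.AEval'.X_smul_of (φ := f) _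
    change of.symm (l ((X : F[X]) • y)) = f (of.symm (l y))
    rw [this, h2, LinearEquiv.symm_apply_apply]
  · change of.symm (l (Submodule.Quotient.mk 1)) = v
    rw [Submodule.liftQ_apply, LinearMap.toSpanSingleton_apply, one_smul,
        LinearEquiv.symm_apply_apply]
  · rw [LinearMap.coe_comp]
    refine of.symm.injective.comp ?_
    change Function.Injective l
    rw [← LinearMap.ker_eq_bot]
    apply Submodule.ker_liftQ_eq_bot
    intro p hp
    have hd : Submodule.IsPrincipal.generator (LinearMap.ker s : Ideal F[X]) ∣ (X - 1) ^ r :=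
      (Submodule.IsPrincipal.mem_iff_generator_dvd _).1 (hs (Ideal.mem_span_singleton_self _))
    obtain ⟨k, hkr, hk2⟩ := (dvd_prime_pow (prime_X_sub_C (1 : F)) r).1 hd
    have h3 : (X - 1 : F[X]) ^ k ∈ (LinearMap.ker s : Ideal F[X]) :=
      (Submodule.IsPrincipal.mem_iff_generator_dvd _).2 hk2.dvd
    rw [LinearMap.mem_ker, LinearMap.toSpanSingleton_apply, hpow, LinearEquiv.map_eq_zero_iff] at h3
    have h4 : k = r := le_antisymm hkr (not_lt.1 fun h => hk k h h3)
    subst h4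
    rw [Ideal.mem_span_singleton]
    exact hk2.symm.dvd.trans ((Submodule.IsPrincipal.mem_iff_generator_dvd _).1 hp)

/-- Embeddings of a cell into an invariant subspace correspond to vectors of exact order. -/
lemma card_embeddings (g : V ≃ₗ[F] V) (W : Submodule F V) (hW : ∀ w ∈ W, g w ∈ W) :
    Nat.card {ι : Cell F r →ₗ[F] V // Function.Injective ι ∧ LinearMap.range ι ≤ W ∧
      ∀ y, ι (shift F r y) = g (ι y)} =
    Nat.card {v : V // v ∈ W ∧ (((g : V →ₗ[F] V) - 1 : Module.End F V) ^ r) v = 0 ∧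
      ∀ k < r, (((g : V →ₗ[F] V) - 1 : Module.End F V) ^ k) v ≠ 0} := by
  have hmem : ∀ ι : Cell F r →ₗ[F] V, (∀ y, ι (shift F r y) = g (ι y)) → ι 1 ∈ W → LinearMap.range ι
      ≤ W := by
    rintro ι h h1 _ ⟨y, rfl⟩
    obtain ⟨p, rfl⟩ := Ideal.Quotient.mk_surjective y
    induction p using Polynomial.induction_on' with
    | add p q hp hq => rw [map_add, map_add]; exact W.add_mem hp hq
    | monomial n a =>
      have hn : ∀ n : ℕ, ι (gen F r ^ n) ∈ W := by
        intro n
        induction n with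
        | zero => simpa using h1
        | succ n ih =>
          rw [pow_succ']
          exact (h (gen F r ^ n)).symm ▸ hW _ ih
      rw [mk_monomial, map_smul]; exact W.smul_mem _ (hn n)
  refine Nat.card_congr (Equiv.ofBijective (fun ι => ⟨ι.1 1, ι.2.2.1 ⟨1, rfl⟩, ?_, fun k hk => ?_⟩)
      ⟨?_, ?_⟩)
  · rw [← apply_gen_pow ι.2.2.2, gen_sub_one_pow, map_zero]
  · rw [← apply_gen_pow ι.2.2.2]
    intro h
    exact absurd ((gen_pow_eq_zero_iff k).1 (ι.2.1 (h.trans (map_zero _).symm))) (by omega)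
  · intro ι ι' h
    exact Subtype.ext (ext_of_apply_one ι.2.2.2 ι'.2.2.2 (congrArg Subtype.val h))
  · rintro ⟨v, hvW, hv, hk⟩
    obtain ⟨ι, h1, h2, h3⟩ := exists_of_pow_eq_zero g hv
    exact ⟨⟨ι, h3 hk, hmem ι h1 (h2.symm ▸ hvW), h1⟩, Subtype.ext h2⟩

end JordanCell

namespace AsymForms

open JordanCell

section Rad

local instance (priority := 10) (α : Type*) [Finite α] : Fintype α := Fintype.ofFinite α

variable {F : Type} [Field F] {V : Type} [AddCommGroup V] [Module F V]

/-- The forms with asymmetry `g` and radical `W`. -/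
abbrev RadForms (g : V ≃ₗ[F] V) (W : Submodule F V) :=
  {b : V →ₗ[F] V →ₗ[F] F // (∀ x y, b x y = b y (g x)) ∧ ∀ v, (∀ y, b v y = 0) ↔ v ∈ W}

/-- The number of nondegenerate forms with asymmetry `g`. -/
def asymCount (g : V ≃ₗ[F] V) : ℕ :=
  Nat.card {b : V →ₗ[F] V →ₗ[F] F // (∀ x y, b x y = b y (g x)) ∧ b.SeparatingLeft}

/-- The number of alternating forms invariant under `g`. -/
def altCount (g : V ≃ₗ[F] V) : ℕ :=
  Nat.card {b : V →ₗ[F] V →ₗ[F] F // b.IsAlt ∧ ∀ x y, b (g x) (g y) = b x y}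

lemma card_radForms_bot (g : V ≃ₗ[F] V) : Nat.card (RadForms g ⊥) = asymCount g := by
  refine Nat.card_congr (Equiv.subtypeEquivRight fun b => and_congr_right fun _ => ?_)
  exact ⟨fun h v hv => (h v).1 hv, fun h v => ⟨fun hv => h v hv, fun hv y => by
    rw [(Submodule.mem_bot F).1 hv, map_zero, LinearMap.zero_apply]⟩⟩

lemma mem_of_radForms {g : V ≃ₗ[F] V} {W : Submodule F V} (b : RadForms g W) {w : V} (hw : w ∈ W) :
    g w ∈ W := by
  rw [← b.2.2]
  intro y
  have h : b.1 (g w) (g (g.symm y)) = b.1 w (g.symm y) := by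
    rw [← b.2.1 (g.symm y), ← b.2.1]
  rw [LinearEquiv.apply_symm_apply] at h
  rw [h, (b.2.2 w).2 hw]

lemma card_radForms_conj (γ g : V ≃ₗ[F] V) (W : Submodule F V) :
    Nat.card (RadForms (γ * g * γ⁻¹) (W.map γ.toLinearMap)) = Nat.card (RadForms g W) := by
  refine Nat.card_congr ⟨fun b => ⟨b.1.compl₁₂ γ.toLinearMap γ.toLinearMap, fun x y => ?_, fun v =>
      ?_⟩,
    fun b => ⟨b.1.compl₁₂ γ.symm.toLinearMap γ.symm.toLinearMap, fun x y => ?_, fun v =>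
        ?_⟩, fun b => ?_, fun b => ?_⟩
  · have := b.2.1 (γ x) (γ y)
    have h : (γ * g * γ⁻¹) (γ x) = γ (g x) := congrArg (fun z => γ (g z)) (γ.symm_apply_apply x)
    rw [h] at this
    exact this
  · have := b.2.2 (γ v)
    rw [Submodule.mem_map] at this
    constructor
    · intro h
      obtain ⟨w, hw, hw2⟩ := this.1 fun y => by
        have := h (γ.symm y)
        simpa using this
      exact γ.injective hw2 ▸ hw
    · intro h y
      exact this.2 ⟨v, h, rfl⟩ _
  · exact (b.2.1 (γ.symm x) (γ.symm y)).trans (congrArg (b.1 (γ.symm y))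
        (γ.symm_apply_apply _).symm)
  · have := b.2.2 (γ.symm v)
    rw [Submodule.mem_map]
    constructor
    · intro h
      refine ⟨γ.symm v, this.1 fun y => ?_, γ.apply_symm_apply v⟩
      have := h (γ y)
      simpa using this
    · rintro ⟨w, hw, rfl⟩ y
      exact (b.2.2 _).2 (by simpa using hw) _
  · apply Subtype.ext; ext x y; simp
  · apply Subtype.ext; ext x y; simp

lemma card_radForms_quotient (g : V ≃ₗ[F] V) (W : Submodule F V) (a : (V ⧸ W) ≃ₗ[F] (V ⧸ W))
    (h : ∀ v, W.mkQ (g v) = a (W.mkQ v)) : Nat.card (RadForms g W) = asymCount a := by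
  symm
  let f : {b : (V ⧸ W) →ₗ[F] (V ⧸ W) →ₗ[F] F // (∀ x y, b x y = b y (a x)) ∧ b.SeparatingLeft} →
      RadForms g W :=
    fun b => ⟨b.1.compl₁₂ W.mkQ W.mkQ, fun x y => by
      simp only [LinearMap.compl₁₂_apply]; rw [b.2.1, h], fun v => by
      simp only [LinearMap.compl₁₂_apply]
      rw [← Submodule.Quotient.mk_eq_zero W, ← Submodule.mkQ_apply]
      refine ⟨fun hv => b.2.2 _ fun y => ?_, fun hv y => by rw [hv, map_zero, LinearMap.zero_apply]⟩
      obtain ⟨y, rfl⟩ := W.mkQ_surjective y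
      exact hv y⟩
  refine Nat.card_congr (Equiv.ofBijective f ⟨fun b b' hb => ?_, fun b => ?_⟩)
  · apply Subtype.ext
    apply LinearMap.ext₂
    intro x y
    obtain ⟨x, rfl⟩ := W.mkQ_surjective x
    obtain ⟨y, rfl⟩ := W.mkQ_surjective y
    exact LinearMap.congr_fun₂ (congrArg Subtype.val hb) x y
  · have h1 : ∀ v ∈ W, ∀ y, b.1 v y = 0 := fun v hv => (b.2.2 v).2 hv
    have h2 : ∀ y, W ≤ LinearMap.ker (b.1 y) := by
      intro y v hv
      rw [LinearMap.mem_ker, b.2.1, h1 v hv]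
    let c : (V ⧸ W) →ₗ[F] (V ⧸ W) →ₗ[F] F :=
      W.liftQ
        { toFun := fun x => W.liftQ (b.1 x) (h2 x)
          map_add' := fun x y => by
            apply Submodule.linearMap_qext; ext z; simp
          map_smul' := fun x y => by
            apply Submodule.linearMap_qext; ext z; simp }
        (by
          intro v hv
          rw [LinearMap.mem_ker]
          apply Submodule.linearMap_qext; ext z
          exact h1 v hv z)
    have hc : ∀ x y, c (W.mkQ x) (W.mkQ y) = b.1 x y := fun x y => rfl
    refine ⟨⟨c, ?_, ?_⟩, ?_⟩
    · intro x y
      obtain ⟨x, rfl⟩ := W.mkQ_surjective x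
      obtain ⟨y, rfl⟩ := W.mkQ_surjective y
      rw [← h, hc, hc, b.2.1]
    · intro x hx
      obtain ⟨x, rfl⟩ := W.mkQ_surjective x
      rw [← LinearMap.mem_ker, W.ker_mkQ, ← b.2.2]
      intro y
      rw [← hc]; exact hx _
    · apply Subtype.ext; ext x y; exact hc x y

lemma altCount_eq_card_forms (h2 : (2 : F) ≠ 0) (g : V ≃ₗ[F] V) (t : Module.End F V)
    (ht : 1 + t = g.toLinearMap) :
    altCount g = Nat.card (forms t (-1 : F) 1 0) := by
  refine Nat.card_congr (Equiv.subtypeEquivRight fun b => ?_)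
  have hg : ∀ x, (1 + t) x = g x := fun x => LinearMap.congr_fun ht x
  change _ ↔ (_ ∧ _ ∧ _)
  simp only [hg, pow_one]
  constructor
  · rintro ⟨h1, h3⟩
    refine ⟨h3, fun x y => ?_, fun y => by simp⟩
    rw [h3, ← h1.neg]; ring
  · rintro ⟨h1, h3, -⟩
    refine ⟨fun x => ?_, h1⟩
    have := h3 x x
    rw [h1] at this
    have h4 : (2 : F) * b x x = 0 := by linear_combination this
    exact (mul_eq_zero.1 h4).resolve_left h2

lemma altCount_eq_sum [Finite F] [Finite V] (h2 : (2 : F) ≠ 0) (g : V ≃ₗ[F] V) :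
    (altCount g : ℤ) = ∑ W : Submodule F V, (Nat.card (RadForms g W) : ℤ) *
      ∑ v with v ∈ W, weight ((g : V →ₗ[F] V) - 1 : Module.End F V) v := by
  set t : Module.End F V := (g : V →ₗ[F] V) - 1 with ht
  have ht' : 1 + t = g.toLinearMap := by rw [ht]; abel
  rw [altCount_eq_card_forms h2 g t ht', ← sum_weight_card_forms h2 t
      (by rw [ht']; exact g.injective)]
  have hg : ∀ x, (1 + t) x = g x := fun x => LinearMap.congr_fun ht' x
  have : Finite (V →ₗ[F] V →ₗ[F] F) := by
    have : Finite (V →ₗ[F] F) := DFunLike.finite _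
    exact DFunLike.finite _
  have h3 : ∀ v : V, (Nat.card (forms t (1 : F) 0 v) : ℤ) =
      ∑ W : Submodule F V, if v ∈ W then (Nat.card (RadForms g W) : ℤ) else 0 := by
    intro v
    let rad : (V →ₗ[F] V →ₗ[F] F) → Submodule F V := LinearMap.ker
    have e : forms t (1 : F) 0 v ≃ Σ W : {W : Submodule F V // v ∈ W}, RadForms g W.1 :=
      { toFun := fun b => ⟨⟨LinearMap.ker b.1, by
            rw [LinearMap.mem_ker]; ext y; exact b.2.2.2 y⟩, b.1, fun x y => by
              have := b.2.2.1 x y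
              rwa [hg, pow_zero, one_mul] at this, fun x => by
              rw [LinearMap.mem_ker]
              exact ⟨fun h => LinearMap.ext h, fun h y => by rw [h, LinearMap.zero_apply]⟩⟩
        invFun := fun p => ⟨p.2.1, fun x y => by
            rw [hg, hg, ← p.2.2.1, ← p.2.2.1], fun x y => by
            rw [hg, pow_zero, one_mul]; exact p.2.2.1 x y, fun y => (p.2.2.2 v).2 p.1.2 y⟩
        left_inv := fun b => rfl
        right_inv := by
          rintro ⟨⟨W, hW⟩, b, hb⟩
          have : W = LinearMap.ker b := by
            ext x; rw [← hb.2, LinearMap.mem_ker]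
            exact ⟨fun h => LinearMap.ext h, fun h y => by rw [h, LinearMap.zero_apply]⟩
          subst this
          rfl }
    rw [Nat.card_congr e, Nat.card_sigma, Nat.cast_sum, ← Finset.sum_filter]
    exact (Finset.sum_subtype (Finset.univ.filter fun W : Submodule F V => v ∈ W) (by simp)
        (fun W => (Nat.card (RadForms g W) : ℤ))).symm
  simp_rw [h3, Finset.mul_sum, Finset.sum_filter]
  rw [Finset.sum_comm]
  refine Finset.sum_congr rfl fun W _ => Finset.sum_congr rfl fun v _ => ?_
  split_ifs <;> ring

/-- The embeddings of a Jordan cell in `W` intertwining the shift with `g`. -/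
abbrev CellEmbeddings (g : V ≃ₗ[F] V) (W : Submodule F V) (r : ℕ) :=
  {ι : Cell F r →ₗ[F] V // Function.Injective ι ∧ LinearMap.range ι ≤ W ∧ ∀ y, ι (shift F r y) =
      g (ι y)}

lemma sum_weight_eq [Finite V] [FiniteDimensional F V] (g : V ≃ₗ[F] V) (W : Submodule F V)
    (hW : ∀ w ∈ W, g w ∈ W) :
    ∑ v with v ∈ W, weight ((g : V →ₗ[F] V) - 1 : Module.End F V) v =
      ∑ r ∈ Finset.range (Module.finrank F V + 1), (-1) ^ r * (Nat.card (CellEmbeddings g W r) :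
          ℤ) := by
  set t : Module.End F V := (g : V →ₗ[F] V) - 1 with ht
  have h1 : ∀ v, weight t v = ∑ r ∈ Finset.range (Module.finrank F V + 1),
      if (t ^ r) v = 0 ∧ ∀ k < r, (t ^ k) v ≠ 0 then (-1) ^ r else 0 := by
    intro v
    rw [weight]
    split_ifs with h
    · rw [Finset.sum_eq_single (Nat.find h)]
      · rw [if_pos ⟨Nat.find_spec h, fun k hk => Nat.find_min h hk⟩]
      · intro r _ hr
        rw [if_neg]
        rintro ⟨h3, h4⟩
        exact hr ((Nat.find_eq_iff h).2 ⟨h3, h4⟩).symm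
      · intro hr
        exfalso
        apply hr
        rw [Finset.mem_range, Nat.lt_succ_iff]
        refine Nat.find_min' h ?_
        exact Module.End.ker_pow_le_ker_pow_finrank t (Nat.find h) (Nat.find_spec h)
    · symm
      refine Finset.sum_eq_zero fun r _ => if_neg fun h3 => h ⟨r, h3.1⟩
  simp_rw [h1]
  rw [Finset.sum_comm]
  refine Finset.sum_congr rfl fun r _ => ?_
  rw [card_embeddings g W hW, ← Finset.sum_filter, Finset.sum_const, Finset.filter_filter,
    ← Fintype.card_subtype, ← Nat.card_eq_fintype_card, nsmul_eq_mul, mul_comm]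

theorem asymCount_eq [Finite F] [Finite V] [FiniteDimensional F V] (h2 : (2 : F) ≠ 0)
    (g : V ≃ₗ[F] V) :
    (asymCount g : ℤ) = altCount g - ∑ r ∈ Finset.range (Module.finrank F V + 1), (-1) ^ r *
      ∑ W : Submodule F V with W ≠ ⊥, (Nat.card (RadForms g W) : ℤ) * Nat.card
          (CellEmbeddings g W r) := by
  have h3 : ∀ W : Submodule F V, (Nat.card (RadForms g W) : ℤ) *
      ∑ v with v ∈ W, weight ((g : V →ₗ[F] V) - 1 : Module.End F V) v =
      ∑ r ∈ Finset.range (Module.finrank F V + 1), (-1) ^ r * ((Nat.card (RadForms g W) : ℤ) *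
        Nat.card (CellEmbeddings g W r)) := by
    intro W
    rcases isEmpty_or_nonempty (RadForms g W) with h | ⟨⟨b⟩⟩
    · simp
    · rw [sum_weight_eq g W fun w => mem_of_radForms b, Finset.mul_sum]
      exact Finset.sum_congr rfl fun r _ => by ring
  have h4 : ∑ v with v ∈ (⊥ : Submodule F V), weight ((g : V →ₗ[F] V) - 1 : Module.End F V) v = 1 :=
      by
    rw [Finset.sum_eq_single_of_mem 0 (by simp) fun v hv hv0 =>
        absurd (by simpa using hv) hv0, weight_zero]
  rw [altCount_eq_sum h2, ← Finset.add_sum_erase _ _ (Finset.mem_univ ⊥), h4, card_radForms_bot]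
  have h5 : Finset.univ.erase (⊥ : Submodule F V) = Finset.univ.filter (fun W => W ≠ ⊥) := by
    ext; simp
  rw [h5, Finset.sum_congr rfl fun W _ => h3 W, Finset.sum_comm]
  simp_rw [Finset.mul_sum]
  ring

end Rad

end AsymForms

namespace AsymForms

open JordanCell SymplecticTrace

section Adapted

variable {F J V : Type} [Field F] [AddCommGroup J] [Module F J] [AddCommGroup V] [Module F V]
  {W : Submodule F V} {ι : J →ₗ[F] V}

lemma exists_adapted (hι : Function.Injective ι) (hW : LinearMap.range ι ≤ W) :
    ∃ (K : Submodule F V) (e : (J × K × (V ⧸ W)) ≃ₗ[F] V),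
      (∀ x, e (x, 0, 0) = ι x) ∧ ∀ p, W.mkQ (e p) = p.2.2 := by
  obtain ⟨s, hs⟩ := W.mkQ.exists_rightInverse_of_surjective W.range_mkQ
  obtain ⟨C, hC⟩ := (LinearMap.range ι).exists_isCompl
  have hs' : ∀ z, W.mkQ (s z) = z := fun z => LinearMap.congr_fun hs z
  have hιW : ∀ x, W.mkQ (ι x) = 0 := fun x =>
    (Submodule.Quotient.mk_eq_zero W).2 (hW (LinearMap.mem_range_self ι x))
  set K := C ⊓ W
  have hKW : ∀ k : K, W.mkQ (k : V) = 0 := fun k => (Submodule.Quotient.mk_eq_zero W).2 k.2.2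
  set f : (J × K × (V ⧸ W)) →ₗ[F] V := ι.coprod (K.subtype.coprod s)
  have hf : ∀ p, f p = ι p.1 + (p.2.1 + s p.2.2) := fun p => rfl
  have hq : ∀ p, W.mkQ (f p) = p.2.2 := by
    intro p
    rw [hf, map_add, map_add, hιW, hKW, hs', zero_add, zero_add]
  have hinj : Function.Injective f := by
    rw [injective_iff_map_eq_zero]
    intro p hp
    have h1 : p.2.2 = 0 := by rw [← hq, hp, map_zero]
    have h2 : ι p.1 + p.2.1 = 0 := by rw [hf, h1, map_zero, add_zero] at hp; exact hp
    have h3 : ι p.1 ∈ LinearMap.range ι ⊓ C := by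
      refine ⟨LinearMap.mem_range_self ι _, ?_⟩
      rw [eq_neg_of_add_eq_zero_left h2]
      exact C.neg_mem p.2.1.2.1
    rw [hC.inf_eq_bot, Submodule.mem_bot] at h3
    have h4 : p.1 = 0 := hι (by rw [h3, map_zero])
    rw [h3, zero_add] at h2
    exact Prod.ext h4 (Prod.ext (Subtype.ext h2) h1)
  have hsurj : Function.Surjective f := by
    intro v
    have h1 : v - s (W.mkQ v) ∈ W := by
      rw [← Submodule.Quotient.mk_eq_zero W, ← Submodule.mkQ_apply, map_sub, hs', sub_self]
    obtain ⟨_, ⟨x, rfl⟩, c, hc, hxc⟩ := Submodule.mem_sup.1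
      (hC.sup_eq_top ▸ Submodule.mem_top : v - s (W.mkQ v) ∈ LinearMap.range ι ⊔ C)
    have h2 : c ∈ W := by
      rw [← add_sub_cancel_left (ι x) c, hxc]
      exact W.sub_mem h1 (hW (LinearMap.mem_range_self ι x))
    refine ⟨(x, ⟨c, hc, h2⟩, W.mkQ v), ?_⟩
    rw [hf]
    change ι x + (c + s (W.mkQ v)) = v
    rw [← add_assoc, hxc, sub_add_cancel]
  refine ⟨K, LinearEquiv.ofBijective f ⟨hinj, hsurj⟩, fun x => ?_, hq⟩
  refine (hf _).trans ?_
  simp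

/-- The action on `V` of automorphisms of the outer pieces of a decomposition of `V`. -/
def blockHom {K Q : Type} [AddCommGroup K] [Module F K] [AddCommGroup Q] [Module F Q]
    (e : (J × K × Q) ≃ₗ[F] V) : (J ≃ₗ[F] J) × (Q ≃ₗ[F] Q) →* (V ≃ₗ[F] V) where
  toFun p := e.symm.trans
    ((p.1.prodCongr ((LinearEquiv.refl F K).prodCongr p.2)).trans e)
  map_one' := by ext v; simp
  map_mul' p p' := by ext v; simp

lemma blockHom_apply {K Q : Type} [AddCommGroup K] [Module F K] [AddCommGroup Q] [Module F Q]
    (e : (J × K × Q) ≃ₗ[F] V) (a : J ≃ₗ[F] J) (b : Q ≃ₗ[F] Q) (x : J) (k : K) (z : Q) :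
    blockHom e (a, b) (e (x, k, z)) = e (a x, k, b z) := by
  simp [blockHom]

variable (W ι)

/-- The automorphisms inducing the identity on `J` and on `V ⧸ W`. -/
def unipotentGroup : Subgroup (V ≃ₗ[F] V) where
  carrier := {h | (∀ x, h (ι x) = ι x) ∧ ∀ v, W.mkQ (h v) = W.mkQ v}
  one_mem' := ⟨fun _ => rfl, fun _ => rfl⟩
  mul_mem' {a b} ha hb := ⟨fun x => by rw [LinearEquiv.mul_apply, hb.1, ha.1],
    fun v => by rw [LinearEquiv.mul_apply, ha.2, hb.2]⟩
  inv_mem' {a} ha := ⟨fun x => by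
      rw [LinearEquiv.coe_inv, LinearEquiv.symm_apply_eq, ha.1],
    fun v => by rw [LinearEquiv.coe_inv, ← ha.2, LinearEquiv.apply_symm_apply]⟩

variable {W ι}

lemma conj_mem_unipotentGroup {g : V ≃ₗ[F] V} (a : J ≃ₗ[F] J) (b : (V ⧸ W) ≃ₗ[F] (V ⧸ W))
    (ha : ∀ x, g (ι x) = ι (a x)) (hb : ∀ v, W.mkQ (g v) = b (W.mkQ v))
    {h : V ≃ₗ[F] V} (hh : h ∈ unipotentGroup W ι) : g * h * g⁻¹ ∈ unipotentGroup W ι := by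
  constructor
  · intro x
    have : g⁻¹ (ι x) = ι (a.symm x) := by
      rw [LinearEquiv.coe_inv, LinearEquiv.symm_apply_eq, ha, LinearEquiv.apply_symm_apply]
    rw [LinearEquiv.mul_apply, LinearEquiv.mul_apply, this, hh.1, ha, LinearEquiv.apply_symm_apply]
  · intro v
    rw [LinearEquiv.mul_apply, LinearEquiv.mul_apply, hb, hh.2, ← hb, LinearEquiv.coe_inv,
      LinearEquiv.apply_symm_apply]

section Count

variable {K : Type} [AddCommGroup K] [Module F K] (e : (J × K × (V ⧸ W)) ≃ₗ[F] V)

lemma blockHom_apply_embedding (he : ∀ x, e (x, 0, 0) = ι x) (a : J ≃ₗ[F] J)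
    (b : (V ⧸ W) ≃ₗ[F] (V ⧸ W)) (x : J) : blockHom e (a, b) (ι x) = ι (a x) := by
  rw [← he, blockHom_apply, map_zero, he]

lemma mkQ_blockHom_apply (he' : ∀ p, W.mkQ (e p) = p.2.2) (a : J ≃ₗ[F] J)
    (b : (V ⧸ W) ≃ₗ[F] (V ⧸ W)) (v : V) : W.mkQ (blockHom e (a, b) v) = b (W.mkQ v) := by
  obtain ⟨p, rfl⟩ := e.surjective v
  obtain ⟨x, k, z⟩ := p
  rw [blockHom_apply, he', he']

lemma mkQ_apply_of_mem (he' : ∀ p, W.mkQ (e p) = p.2.2)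
    (a : J ≃ₗ[F] J) {h : V ≃ₗ[F] V} (hh : h ∈ unipotentGroup W ι) (l : (V ⧸ W) ≃ₗ[F] (V ⧸ W))
    (v : V) : W.mkQ ((blockHom e (a, 1) * h * blockHom e (1, l)) v) = l (W.mkQ v) := by
  rw [LinearEquiv.mul_apply, LinearEquiv.mul_apply, mkQ_blockHom_apply e he', hh.2,
    mkQ_blockHom_apply e he']
  rfl

lemma apply_embedding_of_mem (he : ∀ x, e (x, 0, 0) = ι x)
    (a : J ≃ₗ[F] J) {h : V ≃ₗ[F] V} (hh : h ∈ unipotentGroup W ι) (l : (V ⧸ W) ≃ₗ[F] (V ⧸ W))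
    (x : J) : (blockHom e (a, 1) * h * blockHom e (1, l)) (ι x) = ι (a x) := by
  rw [LinearEquiv.mul_apply, LinearEquiv.mul_apply, blockHom_apply_embedding e he]
  change blockHom e (a, 1) (h (ι x)) = _
  rw [hh.1, blockHom_apply_embedding e he]

lemma map_eq_of_mkQ {g : V ≃ₗ[F] V} (l : (V ⧸ W) ≃ₗ[F] (V ⧸ W))
    (hl : ∀ v, W.mkQ (g v) = l (W.mkQ v)) : W.map g.toLinearMap = W := by
  have key : ∀ v, g v ∈ W ↔ v ∈ W := by
    intro v
    rw [← Submodule.Quotient.mk_eq_zero W, ← Submodule.mkQ_apply, hl, LinearEquiv.map_eq_zero_iff,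
      Submodule.mkQ_apply, Submodule.Quotient.mk_eq_zero W]
  ext v
  constructor
  · rintro ⟨w, hw, rfl⟩
    exact (key w).2 hw
  · intro hv
    refine ⟨g.symm v, (key _).1 ?_, g.apply_symm_apply v⟩
    rwa [LinearEquiv.apply_symm_apply]

lemma exists_eq_of_map_eq (he : ∀ x, e (x, 0, 0) = ι x) (he' : ∀ p, W.mkQ (e p) = p.2.2)
    (a : J ≃ₗ[F] J) {g : V ≃ₗ[F] V} (hg : W.map g.toLinearMap = W) (hgι : ∀ x, g (ι x) = ι (a x)) :
    ∃ (h : unipotentGroup W ι) (l : (V ⧸ W) ≃ₗ[F] (V ⧸ W)),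
      blockHom e (a, 1) * h * blockHom e (1, l) = g := by
  set l : (V ⧸ W) ≃ₗ[F] (V ⧸ W) := Submodule.Quotient.equiv W W g hg
  have hl : ∀ v, W.mkQ (g v) = l (W.mkQ v) := fun v => rfl
  refine ⟨⟨blockHom e (a⁻¹, 1) * g * blockHom e (1, l⁻¹), ?_, ?_⟩, l, ?_⟩
  · intro x
    rw [LinearEquiv.mul_apply, LinearEquiv.mul_apply, blockHom_apply_embedding e he]
    change blockHom e (a⁻¹, 1) (g (ι x)) = _
    rw [hgι, blockHom_apply_embedding e he, LinearEquiv.coe_inv, LinearEquiv.symm_apply_apply]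
  · intro v
    rw [LinearEquiv.mul_apply, LinearEquiv.mul_apply, mkQ_blockHom_apply e he', hl,
      mkQ_blockHom_apply e he']
    rw [LinearEquiv.coe_inv, LinearEquiv.coe_one, id]
    exact l.apply_symm_apply _
  · have h1 : blockHom e (a, 1) * blockHom e (a⁻¹, 1) = 1 := by
      rw [← map_mul, Prod.mk_mul_mk, mul_inv_cancel, mul_one, ← Prod.one_eq_mk, map_one]
    have h2 : blockHom e (1, l⁻¹) * blockHom e (1, l) = 1 := by
      rw [← map_mul, Prod.mk_mul_mk, inv_mul_cancel, mul_one, ← Prod.one_eq_mk, map_one]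
    change blockHom e (a, 1) * (blockHom e (a⁻¹, 1) * g * blockHom e (1, l⁻¹)) * blockHom e (1, l) =
        g
    rw [mul_assoc, mul_assoc, h2, mul_one, ← mul_assoc, h1, one_mul]

lemma injective_mul (he' : ∀ p, W.mkQ (e p) = p.2.2) (a : J ≃ₗ[F] J) :
    Function.Injective fun p : unipotentGroup W ι × ((V ⧸ W) ≃ₗ[F] (V ⧸ W)) =>
      blockHom e (a, 1) * (p.1 : V ≃ₗ[F] V) * blockHom e (1, p.2) := by
  rintro ⟨h, l⟩ ⟨h', l'⟩ hp
  dsimp only at hp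
  have hl : l = l' := by
    ext z
    obtain ⟨v, rfl⟩ := W.mkQ_surjective z
    rw [← mkQ_apply_of_mem e he' a h.2, hp, mkQ_apply_of_mem e he' a h'.2]
  subst hl
  rw [mul_left_inj, mul_right_inj] at hp
  rw [Subtype.ext hp]

lemma card_stabilizer_eq (he : ∀ x, e (x, 0, 0) = ι x) (he' : ∀ p, W.mkQ (e p) = p.2.2) :
    Nat.card {g : V ≃ₗ[F] V // W.map g.toLinearMap = W ∧ ∀ x, g (ι x) = ι x} =
      Nat.card (unipotentGroup W ι) * Nat.card ((V ⧸ W) ≃ₗ[F] (V ⧸ W)) := by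
  rw [← Nat.card_prod]
  symm
  refine Nat.card_congr (Equiv.ofBijective (fun p =>
    ⟨blockHom e (1, 1) * (p.1 : V ≃ₗ[F] V) * blockHom e (1, p.2),
      map_eq_of_mkQ p.2 (mkQ_apply_of_mem e he' 1 p.1.2 p.2),
      apply_embedding_of_mem e he 1 p.1.2 p.2⟩) ⟨?_, ?_⟩)
  · intro p p' hp
    exact injective_mul e he' 1 (Subtype.ext_iff.1 hp)
  · rintro ⟨g, hg1, hg2⟩
    obtain ⟨h, l, hh⟩ := exists_eq_of_map_eq e he he' 1 hg1 hg2
    exact ⟨(h, l), Subtype.ext hh⟩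

end Count

end Adapted

section Even

local instance (priority := 10) (α : Type*) [Finite α] : Fintype α := Fintype.ofFinite α

variable {F V : Type} [Field F] [AddCommGroup V] [Module F V] [Finite V]

local instance : Finite (V ≃ₗ[F] V) := DFunLike.finite _

theorem isEvenMultiple_embedding {W : Submodule F V} {r : ℕ} {ι : Cell F r →ₗ[F] V}
    (hι : Function.Injective ι) (hW : LinearMap.range ι ≤ W)
    (hIH : IsEvenWeight (fun a : (V ⧸ W) ≃ₗ[F] (V ⧸ W) => (asymCount a : ℂ)))
    {E : Type} [AddCommGroup E] [Module ℂ E] [FiniteDimensional ℂ E]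
    (ρ : Representation ℂ (V ≃ₗ[F] V) E) (hρ : IsSymplectic ρ) :
    IsEvenMultiple (Nat.card {g : V ≃ₗ[F] V // W.map g.toLinearMap = W ∧ ∀ x, g (ι x) = ι x})
      (∑ g : V ≃ₗ[F] V, if ∀ y, ι (shift F r y) = g (ι y) then
        ρ.character g * (Nat.card (RadForms g W) : ℂ) else 0) := by
  obtain ⟨K, e, he, he'⟩ := exists_adapted hι hW
  rw [card_stabilizer_eq e he he']
  set u := blockHom e (shift F r, 1)
  set τ := blockHom e (flip F r, 1)
  set j : ((V ⧸ W) ≃ₗ[F] (V ⧸ W)) →* (V ≃ₗ[F] V) := (blockHom e).comp (MonoidHom.inr _ _)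
  have hj : ∀ l, j l = blockHom e (1, l) := fun l => rfl
  have key := isEvenMultiple_sum_character (unipotentGroup W ι) ρ hρ j u τ
    (m := Nat.card (V ≃ₗ[F] V)) Nat.card_pos pow_card_eq_one'
    (by rw [← map_mul, Prod.mk_mul_mk, flip_mul_flip, mul_one, ← Prod.one_eq_mk, map_one])
    (by rw [← map_mul, ← map_mul, ← map_inv, Prod.mk_mul_mk, Prod.mk_mul_mk, flip_shift_flip,
          Prod.inv_mk]; simp)
    (fun h hh => conj_mem_unipotentGroup _ _ (blockHom_apply_embedding e he _ _)
      (mkQ_blockHom_apply e he' _ _) hh)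
    (fun h hh => conj_mem_unipotentGroup _ _ (blockHom_apply_embedding e he _ _)
      (mkQ_blockHom_apply e he' _ _) hh)
    (fun l h hh => conj_mem_unipotentGroup _ _ (blockHom_apply_embedding e he _ _)
      (mkQ_blockHom_apply e he' _ _) hh)
    (fun l => by rw [hj, ← map_mul, ← map_mul]; simp)
    (fun l => by rw [hj, ← map_mul, ← map_mul]; simp) _ hIH
  convert key using 1
  rw [← Fintype.sum_prod_type']
  symm
  refine Finset.sum_of_injOn (fun p : unipotentGroup W ι × ((V ⧸ W) ≃ₗ[F] (V ⧸ W)) =>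
      u * (p.1 : V ≃ₗ[F] V) * j p.2) (injective_mul e he' _).injOn
    (fun _ _ => Finset.mem_coe.2 (Finset.mem_univ _)) ?_ ?_
  · intro g _ hg
    split_ifs with h
    · by_contra hne
      have h1 : Nat.card (RadForms g W) ≠ 0 := by
        intro h0; rw [h0, Nat.cast_zero, mul_zero] at hne; exact hne rfl
      obtain ⟨⟨b⟩, -⟩ := Nat.card_ne_zero.1 h1
      have h2 : W.map g.toLinearMap = W := by
        refine Submodule.eq_of_le_of_finrank_eq ?_ (LinearEquiv.finrank_map_eq g W)
        rintro _ ⟨w, hw, rfl⟩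
        exact mem_of_radForms b hw
      obtain ⟨h', l, hh⟩ := exists_eq_of_map_eq e he he' (shift F r) h2 fun x => (h x).symm
      exact hg ⟨(h', l), Finset.mem_coe.2 (Finset.mem_univ _), hh⟩
    · rfl
  · rintro ⟨h, l⟩ _
    dsimp only
    rw [if_pos, card_radForms_quotient (u * (h : V ≃ₗ[F] V) * j l) W l
      (mkQ_apply_of_mem e he' _ h.2 l)]
    intro y
    exact (apply_embedding_of_mem e he _ h.2 l y).symm

/-- Automorphisms of `V` act on pairs of a subspace of `V` and a linear map to `V`. -/
abbrev pairAction (J : Type) [AddCommGroup J] [Module F J] :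
    MulAction (V ≃ₗ[F] V) (Submodule F V × (J →ₗ[F] V)) where
  smul γ p := (p.1.map γ.toLinearMap, γ.toLinearMap ∘ₗ p.2)
  one_smul p := Prod.ext (Submodule.map_id p.1) (LinearMap.id_comp p.2)
  mul_smul γ γ' p := Prod.ext (Submodule.map_comp γ'.toLinearMap γ.toLinearMap p.1) rfl

/-- Automorphisms of `V` act on bilinear forms. -/
abbrev formAction : MulAction (V ≃ₗ[F] V) {b : V →ₗ[F] V →ₗ[F] F // b.IsAlt} where
  smul γ b := ⟨b.1.compl₁₂ γ.symm.toLinearMap γ.symm.toLinearMap, fun _ => b.2 _⟩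
  one_smul _ := rfl
  mul_smul _ _ _ := rfl

theorem isEvenMultiple_sum_alt [Finite F] {E : Type} [AddCommGroup E] [Module ℂ E]
    [FiniteDimensional ℂ E]
    (ρ : Representation ℂ (V ≃ₗ[F] V) E) (hρ : IsSymplectic ρ) :
    IsEvenMultiple (Nat.card (V ≃ₗ[F] V)) (∑ g, ρ.character g * (altCount g : ℂ)) := by
  let _ := formAction (F := F) (V := V)
  have : Finite (V →ₗ[F] F) := DFunLike.finite _
  have : Finite (V →ₗ[F] V →ₗ[F] F) := DFunLike.finite _
  set c : {b : V →ₗ[F] V →ₗ[F] F // b.IsAlt} → ℂ := fun b =>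
    ∑ g : V ≃ₗ[F] V, if ∀ x y, b.1 (g x) (g y) = b.1 x y then ρ.character g else 0
  have hsmul : ∀ (γ : V ≃ₗ[F] V) (b : {b : V →ₗ[F] V →ₗ[F] F // b.IsAlt}) x y,
    (γ • b).1 x y = b.1 (γ.symm x) (γ.symm y) := fun _ _ _ _ => rfl
  have key : IsEvenMultiple (Nat.card (V ≃ₗ[F] V)) (∑ b, c b) := by
    refine isEvenMultiple_sum_of_stabilizer c ?_ ?_
    · intro γ b
      refine Fintype.sum_equiv (MulAut.conj γ⁻¹).toEquiv _ _ fun g => ?_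
      have h1 : ρ.character ((MulAut.conj γ⁻¹).toEquiv g) = ρ.character g := by
        change ρ.character (γ⁻¹ * g * γ⁻¹⁻¹) = _
        rw [Representation.char_conj]
      rw [h1]
      congr 1
      refine propext ⟨fun h x y => ?_, fun h x y => ?_⟩
      · have := h (γ x) (γ y)
        rw [hsmul, hsmul, LinearEquiv.symm_apply_apply, LinearEquiv.symm_apply_apply] at this
        rw [← this]; simp
      · rw [hsmul, hsmul, ← h (γ.symm x)]; simp
    · intro b
      have := isEvenMultiple_sum_character (L := Unit) (MulAction.stabilizer (V ≃ₗ[F] V) b) ρ hρ 1 1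
          1
        (m := 1) one_pos (one_pow 1) (mul_one 1) (by simp) (fun h hh => by simpa using hh)
        (fun h hh => by simpa using hh) (fun l h hh => by simpa using hh) (by simp) (by simp) _
        isEvenWeight_trivial
      rw [Nat.card_unique (α := Unit), mul_one] at this
      convert this using 1
      simp only [one_mul, MonoidHom.one_apply, mul_one, Finset.sum_const, Finset.card_univ,
        Fintype.card_unit, one_smul, c]
      rw [← Finset.sum_filter]
      refine Finset.sum_subtype _ (fun g => ?_) _
      rw [Finset.mem_filter, and_iff_right (Finset.mem_univ _), MulAction.mem_stabilizer_iff]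
      constructor
      · intro h
        ext x y
        rw [hsmul, ← h]; simp
      · intro h x y
        conv_lhs => rw [← h]
        rw [hsmul]; simp
  convert key using 1
  simp only [c]
  rw [Finset.sum_comm]
  refine Finset.sum_congr rfl fun g _ => ?_
  rw [← Finset.sum_filter, Finset.sum_const, nsmul_eq_mul, mul_comm]
  congr 2
  rw [altCount, ← Nat.subtype_card (Finset.univ.filter _) (p :=
      fun b : {b : V →ₗ[F] V →ₗ[F] F // b.IsAlt} =>
    ∀ x y, b.1 (g x) (g y) = b.1 x y) (by simp)]
  exact Nat.card_congr (Equiv.subtypeSubtypeEquivSubtypeInter (fun b : V →ₗ[F] V →ₗ[F] F => b.IsAlt)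
    fun b => ∀ x y, b (g x) (g y) = b x y).symm

theorem isEvenMultiple_sum_rad [Finite F] (r : ℕ)
    (hIH : ∀ W : Submodule F V, W ≠ ⊥ →
      IsEvenWeight (fun a : (V ⧸ W) ≃ₗ[F] (V ⧸ W) => (asymCount a : ℂ)))
    {E : Type} [AddCommGroup E] [Module ℂ E] [FiniteDimensional ℂ E]
    (ρ : Representation ℂ (V ≃ₗ[F] V) E) (hρ : IsSymplectic ρ) :
    IsEvenMultiple (Nat.card (V ≃ₗ[F] V)) (∑ g, ρ.character g *
      ∑ W ∈ Finset.univ.filter (fun W : Submodule F V => W ≠ ⊥),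
        (Nat.card (RadForms g W) : ℂ) * Nat.card (CellEmbeddings g W r)) := by
  let _ := pairAction (F := F) (V := V) (Cell F r)
  have : Finite (Cell F r) := Module.finite_of_finite F
  have : Finite (Cell F r →ₗ[F] V) := DFunLike.finite _
  set P : Submodule F V × (Cell F r →ₗ[F] V) → Prop := fun p =>
    p.1 ≠ ⊥ ∧ Function.Injective p.2 ∧ LinearMap.range p.2 ≤ p.1
  set c : Submodule F V × (Cell F r →ₗ[F] V) → ℂ := fun p => if P p then
    ∑ g : V ≃ₗ[F] V, if ∀ y, p.2 (shift F r y) = g (p.2 y) then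
      ρ.character g * (Nat.card (RadForms g p.1) : ℂ) else 0 else 0
  have hsmul : ∀ (γ : V ≃ₗ[F] V) (p : Submodule F V × (Cell F r →ₗ[F] V)),
    γ • p = (p.1.map γ.toLinearMap, γ.toLinearMap ∘ₗ p.2) := fun _ _ => rfl
  have key : IsEvenMultiple (Nat.card (V ≃ₗ[F] V)) (∑ p, c p) := by
    refine isEvenMultiple_sum_of_stabilizer c ?_ ?_
    · intro γ p
      have h0 : P (γ • p) ↔ P p := by
        rw [hsmul]
        simp only [P]
        refine and_congr ?_ (and_congr ?_ ?_)
        · rw [ne_eq, Submodule.map_eq_bot_iff]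
        · rw [LinearMap.coe_comp]
          exact γ.injective.of_comp_iff _
        · rw [LinearMap.range_comp]
          exact Submodule.map_le_map_iff_of_injective γ.injective _ _
      simp only [c]
      refine if_congr h0 ?_ rfl
      symm
      refine Fintype.sum_equiv (MulAut.conj γ).toEquiv _ _ fun g => ?_
      have h1 : ρ.character ((MulAut.conj γ).toEquiv g) = ρ.character g := by
        change ρ.character (γ * g * γ⁻¹) = _
        rw [Representation.char_conj]
      rw [h1]
      refine if_congr ?_ ?_ rfl
      · rw [hsmul]
        refine forall_congr' fun y => ?_
        change _ ↔ γ (p.2 (shift F r y)) = γ (g (γ⁻¹ (γ (p.2 y))))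
        rw [γ.injective.eq_iff, LinearEquiv.coe_inv, LinearEquiv.symm_apply_apply]
      · rw [hsmul, ← card_radForms_conj γ g]
        rfl
    · rintro ⟨W, ι⟩
      simp only [c, P]
      split_ifs with h
      · have := isEvenMultiple_embedding h.2.1 h.2.2 (hIH W h.1) ρ hρ
        convert this using 1
        swap
        · exact Finset.sum_congr rfl fun g _ => by congr!
        refine Nat.card_congr (Equiv.subtypeEquivRight fun g => ?_)
        rw [MulAction.mem_stabilizer_iff, hsmul, Prod.mk.injEq, LinearMap.ext_iff]
        rfl
      · exact ⟨0, isIntegral_zero, by simp⟩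
  convert key using 1
  rw [Fintype.sum_prod_type]
  simp only [c, P]
  have e : ∀ W : Submodule F V, ∑ ι : Cell F r →ₗ[F] V,
      (if W ≠ ⊥ ∧ Function.Injective ι ∧ LinearMap.range ι ≤ W then
        ∑ g : V ≃ₗ[F] V, if ∀ y, ι (shift F r y) = g (ι y) then
          ρ.character g * (Nat.card (RadForms g W) : ℂ) else 0 else 0) =
      if W ≠ ⊥ then ∑ g : V ≃ₗ[F] V, ρ.character g *
        ((Nat.card (RadForms g W) : ℂ) * Nat.card (CellEmbeddings g W r)) else 0 := by
    intro W
    by_cases hW : W ≠ ⊥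
    · simp only [if_pos hW, and_iff_right hW]
      have : ∀ ι : Cell F r →ₗ[F] V, (if Function.Injective ι ∧ LinearMap.range ι ≤ W then
          ∑ g : V ≃ₗ[F] V, if ∀ y, ι (shift F r y) = g (ι y) then
          ρ.character g * (Nat.card (RadForms g W) : ℂ) else 0 else 0) =
          ∑ g : V ≃ₗ[F] V, if Function.Injective ι ∧ LinearMap.range ι ≤ W ∧
            (∀ y, ι (shift F r y) = g (ι y)) then
            ρ.character g * (Nat.card (RadForms g W) : ℂ) else 0 := by
        intro ι
        split_ifs with h
        · refine Finset.sum_congr rfl fun g _ => if_congr ?_ rfl rfl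
          exact ⟨fun h' => ⟨h.1, h.2, h'⟩, fun h' => h'.2.2⟩
        · symm
          exact Finset.sum_eq_zero fun g _ => if_neg fun h' => h ⟨h'.1, h'.2.1⟩
      simp_rw [this]
      rw [Finset.sum_comm]
      refine Finset.sum_congr rfl fun g _ => ?_
      rw [← Finset.sum_filter, Finset.sum_const, nsmul_eq_mul, mul_comm, mul_assoc]
      congr 3
      exact (Nat.subtype_card _ (by simp)).symm
    · simp [hW]
  simp_rw [e]
  rw [← Finset.sum_filter, Finset.sum_comm]
  simp_rw [Finset.mul_sum]

end Even

section Main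

variable {F : Type} [Field F] [Finite F]

local instance (priority := 10) (α : Type*) [Finite α] : Fintype α := Fintype.ofFinite α

local instance (V : Type) [AddCommGroup V] [Module F V] [Finite V] : Finite (V ≃ₗ[F] V) :=
  DFunLike.finite _

/-- The number of nondegenerate forms with asymmetry `g` is an even weight in `g`. -/
theorem isEvenWeight_asymCount (h2 : (2 : F) ≠ 0) (n : ℕ) :
    ∀ (V : Type) [AddCommGroup V] [Module F V] [Finite V], Module.finrank F V = n →
      IsEvenWeight (fun g : V ≃ₗ[F] V => (asymCount g : ℂ)) := by
  induction n using Nat.strong_induction_on with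
  | _ n ih =>
    intro V _ _ _ hn E _ _ _ ρ hρ
    have hIH : ∀ W : Submodule F V, W ≠ ⊥ →
        IsEvenWeight (fun a : (V ⧸ W) ≃ₗ[F] (V ⧸ W) => (asymCount a : ℂ)) := by
      intro W hW
      refine ih (Module.finrank F (V ⧸ W)) ?_ (V ⧸ W) rfl
      have h1 := W.finrank_quotient_add_finrank
      have h3 : Module.finrank F W ≠ 0 := fun h => hW (Submodule.finrank_eq_zero.1 h)
      omega
    have h : ∀ g : V ≃ₗ[F] V, (asymCount g : ℂ) = altCount g -
        ∑ r ∈ Finset.range (Module.finrank F V + 1), (-1) ^ r *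
          ∑ W ∈ Finset.univ.filter (fun W : Submodule F V => W ≠ ⊥),
            (Nat.card (RadForms g W) : ℂ) * Nat.card (CellEmbeddings g W r) := by
      intro g
      have := congrArg (Int.cast : ℤ → ℂ) (asymCount_eq h2 g)
      push_cast at this
      exact this
    have h' : ∑ g : V ≃ₗ[F] V, ρ.character g * (asymCount g : ℂ) =
        (∑ g : V ≃ₗ[F] V, ρ.character g * (altCount g : ℂ)) -
        ∑ r ∈ Finset.range (Module.finrank F V + 1), (∑ g : V ≃ₗ[F] V, ρ.character g *
          ∑ W ∈ Finset.univ.filter (fun W : Submodule F V => W ≠ ⊥),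
            (Nat.card (RadForms g W) : ℂ) * Nat.card (CellEmbeddings g W r)) * (-1) ^ r := by
      simp_rw [h, mul_sub, Finset.sum_sub_distrib, Finset.sum_mul]
      rw [Finset.sum_comm (s := Finset.range _)]
      congr 1
      refine Finset.sum_congr rfl fun g _ => ?_
      rw [Finset.mul_sum]
      exact Finset.sum_congr rfl fun r _ => by ring
    rw [h', sub_eq_add_neg, ← Finset.sum_neg_distrib]
    obtain ⟨z, hz, hz'⟩ := isEvenMultiple_sum_alt ρ hρ
    obtain ⟨z', hy, hy'⟩ := IsEvenMultiple.sum (s := Finset.range (Module.finrank F V + 1))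
      (fun r _ => (isEvenMultiple_sum_rad r hIH ρ hρ).integral_mul
        ((isIntegral_one.neg : IsIntegral ℤ (-1 : ℂ)).pow (r + 1)))
    refine ⟨z + z', hz.add hy, ?_⟩
    rw [mul_add, ← hz', ← hy']
    congr 1
    exact Finset.sum_congr rfl fun r _ => by ring

end Main

end AsymForms

namespace SelfAdjoint

open Polynomial

variable {F : Type} [Field F]

lemma exists_functional_of_monic {f : F[X]} (hf : f.Monic) :
    ∃ φ : (F[X] ⧸ Ideal.span {f}) →ₗ[F] F, ∀ a, (∀ b, φ (a * b) = 0) → a = 0 := by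
  set φ : AdjoinRoot f →ₗ[F] F := lcoeff F (f.natDegree - 1) ∘ₗ AdjoinRoot.modByMonicHom hf
  refine ⟨φ, fun a ha => ?_⟩
  change AdjoinRoot f at a
  by_contra hne
  obtain ⟨p, rfl⟩ := AdjoinRoot.mk_surjective a
  have hf1 : f ≠ 1 := by
    rintro rfl
    exact hne (AdjoinRoot.mk_eq_zero.2 (one_dvd p))
  set r := p %ₘ f
  have hr : AdjoinRoot.mk f p = AdjoinRoot.mk f r := by
    conv_lhs => rw [← modByMonic_add_div p f]
    rw [map_add, map_mul, AdjoinRoot.mk_self, zero_mul, add_zero]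
  have hr0 : r ≠ 0 := by
    intro h
    rw [h, map_zero] at hr
    exact hne hr
  have hd : r.natDegree < f.natDegree := natDegree_modByMonic_lt p hf hf1
  have h := ha (AdjoinRoot.mk f (X ^ (f.natDegree - 1 - r.natDegree)))
  change φ (AdjoinRoot.mk f p * _) = 0 at h
  rw [hr, ← map_mul] at h
  simp only [φ, LinearMap.comp_apply, AdjoinRoot.modByMonicHom_mk, lcoeff_apply] at h
  rw [(modByMonic_eq_self_iff hf).2, coeff_mul_X_pow', if_pos (by omega)] at h
  · rw [show f.natDegree - 1 - (f.natDegree - 1 - r.natDegree) = r.natDegree by omega] at h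
    exact hr0 (leadingCoeff_eq_zero.1 h)
  · refine degree_lt_degree ?_
    rw [natDegree_mul_X_pow _ hr0]
    omega

lemma exists_functional {f : F[X]} (hf : f ≠ 0) :
    ∃ φ : (F[X] ⧸ Ideal.span {f}) →ₗ[F] F, ∀ a, (∀ b, φ (a * b) = 0) → a = 0 := by
  have h : Ideal.span {f} = Ideal.span {f * C f.leadingCoeff⁻¹} := by
    rw [Ideal.span_singleton_mul_right_unit]
    exact isUnit_C.2 (inv_ne_zero (leadingCoeff_ne_zero.2 hf)).isUnit
  rw [h]
  exact exists_functional_of_monic (monic_mul_leadingCoeff_inv hf)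

/-- Every endomorphism is self-adjoint for some nondegenerate form. -/
theorem exists_form {V : Type} [AddCommGroup V] [Module F V] [FiniteDimensional F V]
    (g : V →ₗ[F] V) :
    ∃ B : V →ₗ[F] V →ₗ[F] F, B.SeparatingLeft ∧ ∀ x y, B (g x) y = B x (g y) := by
  have htor : Module.IsTorsion F[X] (Module.AEval' g) :=
    Module.AEval.isTorsion_of_finiteDimensional F V g
  obtain ⟨ι, _, p, hp, e, ⟨E⟩⟩ := Module.equiv_directSum_of_isTorsion htor
  have h0 : ∀ i, p i ^ e i ≠ 0 := fun i => pow_ne_zero _ (hp i).ne_zero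
  choose φ hφ using fun i => exists_functional (h0 i)
  set E' := E.trans (DirectSum.linearEquivFunOnFintype F[X] ι _)
  set T : V → ∀ i, F[X] ⧸ Ideal.span {p i ^ e i} := fun v => E' (Module.AEval'.of g v)
  have hadd : ∀ v w, T (v + w) = T v + T w := fun v w => by
    simp only [T]; rw [map_add, map_add]
  have hsmul : ∀ (c : F) v, T (c • v) = c • T v := fun c v => by
    simp only [T]; rw [map_smul, ← Module.AEval.C_smul, map_smul]
    ext i
    exact algebraMap_smul F[X] c (T v i)
  have hX : ∀ v, T (g v) = (X : F[X]) • T v := fun v => by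
    simp only [T]; rw [← Module.AEval'.X_smul_of, map_smul]
  refine ⟨LinearMap.mk₂ F (fun x y => ∑ i, φ i (T x i * T y i)) ?_ ?_ ?_ ?_, ?_, ?_⟩
  · intro x x' y; simp [hadd, add_mul, Finset.sum_add_distrib]
  · intro c x y; simp [hsmul, Finset.mul_sum, smul_mul_assoc, map_smul]
  · intro x y y'; simp [hadd, mul_add, Finset.sum_add_distrib]
  · intro c x y; simp [hsmul, Finset.mul_sum, mul_smul_comm, map_smul]
  · intro x hx
    have : T x = 0 := by
      ext i
      refine hφ i _ fun b => ?_
      obtain ⟨y, hy⟩ : ∃ y, T y = Pi.single i b := by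
        obtain ⟨z, hz⟩ := E'.surjective (Pi.single i b)
        obtain ⟨y, rfl⟩ := (Module.AEval'.of g).surjective z
        exact ⟨y, hz⟩
      have := hx y
      rw [LinearMap.mk₂_apply, hy, Finset.sum_eq_single i, Pi.single_eq_same] at this
      · exact this
      · intro j _ hj
        rw [Pi.single_eq_of_ne hj, mul_zero, map_zero]
      · simp
    exact (Module.AEval'.of g).injective (E'.injective (this.trans (by rw [map_zero, map_zero])))
  · intro x y
    simp only [LinearMap.mk₂_apply, hX, Pi.smul_apply, smul_mul_assoc, mul_smul_comm]

open Matrix in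
theorem exists_transpose_mul_eq {n : ℕ} (g : Matrix (Fin n) (Fin n) F) :
    ∃ b : GL (Fin n) F, gᵀ * (b : Matrix (Fin n) (Fin n) F) = b * g := by
  obtain ⟨B, hB, h⟩ := exists_form (Matrix.toLin' g)
  have hdet : (LinearMap.toMatrix₂' F B).det ≠ 0 :=
      (LinearMap.separatingLeft_iff_det_ne_zero (Pi.basisFun F (Fin n))).1 hB
  refine ⟨Matrix.GeneralLinearGroup.mkOfDetNeZero _ hdet, ?_⟩
  have h1 : B.compl₁₂ (Matrix.toLin' g) LinearMap.id = B.compl₁₂ LinearMap.id (Matrix.toLin' g) :=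
      by
    exact LinearMap.ext₂ fun x y => h x y
  have h2 := congrArg (LinearMap.toMatrix₂' F) h1
  rw [LinearMap.toMatrix₂'_compl₁₂, LinearMap.toMatrix₂'_compl₁₂, LinearMap.toMatrix'_id,
    LinearMap.toMatrix'_toLin', Matrix.mul_one, Matrix.transpose_one, Matrix.one_mul] at h2
  exact h2

end SelfAdjoint

namespace Involutions

open Module

section Blocks

variable {F V A B : Type} [Field F] [AddCommGroup V] [Module F V] [AddCommGroup A] [Module F A]
  [AddCommGroup B] [Module F B]

/-- The involution acting as `1` on the first block and as `-1` on the second. -/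
def diagInv (e : (A × B) ≃ₗ[F] V) : V ≃ₗ[F] V :=
  e.symm.trans (((LinearEquiv.refl F A).prodCongr (LinearEquiv.neg F)).trans e)

lemma diagInv_apply (e : (A × B) ≃ₗ[F] V) (a : A) (b : B) : diagInv e (e (a, b)) = e (a, -b) := by
  simp [diagInv]

lemma eq_diagInv {e : (A × B) ≃ₗ[F] V} {g : V ≃ₗ[F] V} (h : ∀ a b, g (e (a, b)) = e (a, -b)) :
    g = diagInv e := by
  ext v
  obtain ⟨⟨a, b⟩, rfl⟩ := e.surjective v
  rw [h, diagInv_apply]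

lemma diagInv_mul_self (e : (A × B) ≃ₗ[F] V) : diagInv e * diagInv e = 1 := by
  ext v
  obtain ⟨⟨a, b⟩, rfl⟩ := e.surjective v
  rw [LinearEquiv.mul_apply, diagInv_apply, diagInv_apply, neg_neg]
  rfl

lemma conj_diagInv (γ : V ≃ₗ[F] V) (e : (A × B) ≃ₗ[F] V) :
    γ * diagInv e * γ⁻¹ = diagInv (e.trans γ) := by
  refine eq_diagInv fun a b => ?_
  rw [LinearEquiv.trans_apply, LinearEquiv.mul_apply, LinearEquiv.coe_inv,
    LinearEquiv.symm_apply_apply, LinearEquiv.mul_apply, diagInv_apply]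
  rfl

/-- The subspace fixed by an automorphism. -/
abbrev fixed (g : V ≃ₗ[F] V) : Submodule F V := LinearMap.eqLocus (g : V →ₗ[F] V) LinearMap.id

lemma mem_fixed {g : V ≃ₗ[F] V} {v : V} : v ∈ fixed g ↔ g v = v := Iff.rfl

lemma neg_eq_self_iff' (h2 : (2 : F) ≠ 0) {x : V} : -x = x ↔ x = 0 := by
  constructor
  · intro h
    have : (2 : F) • x = 0 := by
      rw [two_smul]
      nth_rewrite 1 [← h]
      exact neg_add_cancel x
    exact (smul_eq_zero.1 this).resolve_left h2
  · rintro rfl; exact neg_zero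

lemma finrank_fixed_diagInv (h2 : (2 : F) ≠ 0) (e : (A × B) ≃ₗ[F] V) :
    finrank F (fixed (diagInv e)) = finrank F A := by
  have : fixed (diagInv e) = LinearMap.range (e.toLinearMap ∘ₗ LinearMap.inl F A B) := by
    ext v
    rw [mem_fixed]
    obtain ⟨⟨a, b⟩, rfl⟩ := e.surjective v
    rw [diagInv_apply, e.injective.eq_iff, Prod.mk.injEq, and_iff_right rfl, neg_eq_self_iff' h2]
    constructor
    · rintro rfl; exact ⟨a, rfl⟩
    · rintro ⟨a', ha⟩
      have := e.injective ha
      exact (Prod.mk.inj this).2.symm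
  rw [this]
  exact LinearMap.finrank_range_of_inj (e.injective.comp LinearMap.inl_injective)

lemma exists_eq_diagInv [FiniteDimensional F V] [FiniteDimensional F A] [FiniteDimensional F B]
    (h2 : (2 : F) ≠ 0) (e : (A × B) ≃ₗ[F] V) {g : V ≃ₗ[F] V} (hg : g * g = 1)
    (hk : finrank F (fixed g) = finrank F A) : ∃ e' : (A × B) ≃ₗ[F] V, g = diagInv e' := by
  set N : Submodule F V := LinearMap.eqLocus (g : V →ₗ[F] V) (-LinearMap.id)
  have hN : ∀ v, v ∈ N ↔ g v = -v := fun v => Iff.rfl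
  have hgg : ∀ v, g (g v) = v := fun v => LinearEquiv.congr_fun hg v
  have hc : IsCompl (fixed g) N := by
    constructor
    · rw [Submodule.disjoint_def]
      intro v h1 h3
      rw [hN, mem_fixed.1 h1] at h3
      exact (neg_eq_self_iff' h2).1 h3.symm
    · rw [codisjoint_iff, eq_top_iff]
      intro v _
      rw [Submodule.mem_sup]
      refine ⟨(2⁻¹ : F) • (v + g v), ?_, (2⁻¹ : F) • (v - g v), ?_, ?_⟩
      · rw [mem_fixed, map_smul, map_add, hgg, add_comm]
      · rw [hN, map_smul, map_sub, hgg, ← smul_neg, neg_sub]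
      · rw [← smul_add, add_add_sub_cancel, ← two_smul F, smul_smul, inv_mul_cancel₀ h2, one_smul]
  have hB : finrank F N = finrank F B := by
    have h1 := Submodule.finrank_add_eq_of_isCompl hc
    have h3 := e.finrank_eq
    rw [finrank_prod] at h3
    omega
  refine ⟨((LinearEquiv.ofFinrankEq A (fixed g) hk.symm).prodCongr
    (LinearEquiv.ofFinrankEq B N hB.symm)).trans (Submodule.prodEquivOfIsCompl _ _ hc),
    eq_diagInv fun a b => ?_⟩
  have ha := mem_fixed.1 (LinearEquiv.ofFinrankEq A (fixed g) hk.symm a).2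
  have hb := (hN _).1 (LinearEquiv.ofFinrankEq B N hB.symm b).2
  simp only [LinearEquiv.trans_apply, LinearEquiv.prodCongr_apply,
      Submodule.coe_prodEquivOfIsCompl',
    map_add, map_neg, ha, hb, Submodule.coe_neg]

/-- Block diagonal automorphisms. -/
def blockDiag (e : (A × B) ≃ₗ[F] V) (p : (A ≃ₗ[F] A) × (B ≃ₗ[F] B)) : V ≃ₗ[F] V :=
  e.symm.trans ((p.1.prodCongr p.2).trans e)

lemma blockDiag_apply (e : (A × B) ≃ₗ[F] V) (p : (A ≃ₗ[F] A) × (B ≃ₗ[F] B)) (a : A) (b : B) :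
    blockDiag e p (e (a, b)) = e (p.1 a, p.2 b) := by
  simp [blockDiag]

lemma exists_blockDiag [FiniteDimensional F A] [FiniteDimensional F B] (h2 : (2 : F) ≠ 0)
    (e : (A × B) ≃ₗ[F] V) {γ : V ≃ₗ[F] V}
    (h : γ * diagInv e = diagInv e * γ) : ∃ p, blockDiag e p = γ := by
  set f : (A × B) ≃ₗ[F] (A × B) := (e.trans γ).trans e.symm
  have hf : ∀ x, e (f x) = γ (e x) := fun x => e.apply_symm_apply _
  have hcomm : ∀ a b, f (a, -b) = ((f (a, b)).1, -(f (a, b)).2) := by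
    intro a b
    apply e.injective
    rw [hf, ← diagInv_apply, ← diagInv_apply, hf]
    exact LinearEquiv.congr_fun h _
  have h1 : ∀ a, (f (a, 0)).2 = 0 := by
    intro a
    have := hcomm a 0
    rw [neg_zero] at this
    exact (neg_eq_self_iff' h2).1 (congrArg Prod.snd this).symm
  have h3 : ∀ b, (f (0, b)).1 = 0 := by
    intro b
    have h4 : f (0, -b) = - f (0, b) := by rw [← map_neg, Prod.neg_mk, neg_zero]
    have := hcomm 0 b
    rw [h4] at this
    exact (neg_eq_self_iff' h2).1 (congrArg Prod.fst this)
  set f₁ : A →ₗ[F] A := LinearMap.fst F A B ∘ₗ f.toLinearMap ∘ₗ LinearMap.inl F A B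
  set f₂ : B →ₗ[F] B := LinearMap.snd F A B ∘ₗ f.toLinearMap ∘ₗ LinearMap.inr F A B
  have e1 : ∀ a, f (a, 0) = (f₁ a, 0) := fun a => Prod.ext rfl (h1 a)
  have e2 : ∀ b, f (0, b) = (0, f₂ b) := fun b => Prod.ext (h3 b) rfl
  have hi1 : Function.Injective f₁ := by
    rw [injective_iff_map_eq_zero]
    intro a ha
    have := e1 a
    rw [ha] at this
    exact (Prod.mk.inj ((LinearEquiv.map_eq_zero_iff f).1 this)).1
  have hi2 : Function.Injective f₂ := by
    rw [injective_iff_map_eq_zero]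
    intro a ha
    have := e2 a
    rw [ha] at this
    exact (Prod.mk.inj ((LinearEquiv.map_eq_zero_iff f).1 this)).2
  refine ⟨(LinearEquiv.ofInjectiveEndo f₁ hi1, LinearEquiv.ofInjectiveEndo f₂ hi2), ?_⟩
  ext v
  obtain ⟨⟨a, b⟩, rfl⟩ := e.surjective v
  rw [blockDiag_apply, ← hf]
  congr 1
  have : ((a, b) : A × B) = (a, 0) + (0, b) := by simp
  rw [this, map_add, e1, e2]
  simp

lemma card_involutions_mul [Finite V] [FiniteDimensional F V] [FiniteDimensional F A]
    [FiniteDimensional F B]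
    (h2 : (2 : F) ≠ 0) (e : (A × B) ≃ₗ[F] V) :
    Nat.card {g : V ≃ₗ[F] V // g * g = 1 ∧ finrank F (fixed g) = finrank F A} *
      (Nat.card (A ≃ₗ[F] A) * Nat.card (B ≃ₗ[F] B)) = Nat.card (V ≃ₗ[F] V) := by
  have : Finite (V ≃ₗ[F] V) := DFunLike.finite _
  have hd : ∀ (g : V ≃ₗ[F] V) (e' : (A × B) ≃ₗ[F] V), g = diagInv e' →
      g * g = 1 ∧ finrank F (fixed g) = finrank F A := by
    rintro _ e' rfl
    exact ⟨diagInv_mul_self _, finrank_fixed_diagInv h2 _⟩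
  have horb : Nat.card (MulAction.orbit (ConjAct (V ≃ₗ[F] V)) (diagInv e)) =
      Nat.card {g : V ≃ₗ[F] V // g * g = 1 ∧ finrank F (fixed g) = finrank F A} := by
    refine Nat.card_congr (Equiv.subtypeEquivRight fun g => ?_)
    constructor
    · rintro ⟨γ, rfl⟩
      have : γ • diagInv e = diagInv (e.trans (ConjAct.ofConjAct γ)) := by
        rw [ConjAct.smul_def, conj_diagInv]
      exact hd _ _ this
    · rintro ⟨hg, hk⟩
      obtain ⟨e', rfl⟩ := exists_eq_diagInv h2 e hg hk
      refine ⟨ConjAct.toConjAct (e.symm.trans e'), ?_⟩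
      dsimp only
      rw [ConjAct.smul_def, ConjAct.ofConjAct_toConjAct, conj_diagInv, ← LinearEquiv.trans_assoc,
        LinearEquiv.self_trans_symm, LinearEquiv.refl_trans]
  have hstab : Nat.card (MulAction.stabilizer (ConjAct (V ≃ₗ[F] V)) (diagInv e)) =
      Nat.card (A ≃ₗ[F] A) * Nat.card (B ≃ₗ[F] B) := by
    rw [← Nat.card_prod]
    symm
    refine Nat.card_congr (Equiv.ofBijective
      (fun p => ⟨ConjAct.toConjAct (blockDiag e p), ?_⟩) ⟨?_, ?_⟩)
    · rw [MulAction.mem_stabilizer_iff, ConjAct.smul_def, ConjAct.ofConjAct_toConjAct, conj_diagInv]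
      symm
      refine eq_diagInv fun a b => ?_
      rw [LinearEquiv.trans_apply, LinearEquiv.trans_apply, blockDiag_apply, diagInv_apply,
        blockDiag_apply, map_neg]
    · intro p p' h
      have h' : blockDiag e p = blockDiag e p' := congrArg Subtype.val h
      have key : ∀ a b, (p.1 a, p.2 b) = (p'.1 a, p'.2 b) := by
        intro a b
        apply e.injective
        rw [← blockDiag_apply, ← blockDiag_apply, h']
      exact Prod.ext (LinearEquiv.ext fun a => (Prod.mk.inj (key a 0)).1)
        (LinearEquiv.ext fun b => (Prod.mk.inj (key 0 b)).2)
    · rintro ⟨γ, hγ⟩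
      rw [MulAction.mem_stabilizer_iff, ConjAct.smul_def, mul_inv_eq_iff_eq_mul] at hγ
      obtain ⟨p, hp⟩ := exists_blockDiag h2 e hγ
      exact ⟨p, Subtype.ext hp⟩
  rw [← horb, ← hstab, ← Nat.card_prod]
  exact Nat.card_congr (MulAction.orbitProdStabilizerEquivGroup _ _)

end Blocks

section Count

variable {F : Type} [Field F] [Fintype F]

lemma prod_pow_sub (x : ℝ) (n : ℕ) : ∏ i ∈ Finset.range n, (x ^ n - x ^ i) =
    x ^ (∑ i ∈ Finset.range n, i) * ∏ i ∈ Finset.range n, (x ^ (i + 1) - 1) := by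
  rw [← Finset.prod_range_reflect (fun i => x ^ (i + 1) - 1), ← Finset.prod_pow_eq_pow_sum,
      ← Finset.prod_mul_distrib]
  refine Finset.prod_congr rfl fun i hi => ?_
  have := Finset.mem_range.1 hi
  rw [mul_sub, ← pow_add, mul_one]
  congr 2
  omega

lemma card_linearEquiv (F : Type) [Field F] [Fintype F] (n : ℕ) :
    (Nat.card ((Fin n → F) ≃ₗ[F] (Fin n → F)) : ℝ) = (Fintype.card F : ℝ) ^ (∑ i ∈ Finset.range n,
        i) *
      ∏ i ∈ Finset.range n, ((Fintype.card F : ℝ) ^ (i + 1) - 1) := by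
  rw [← prod_pow_sub, ← Nat.card_congr (Matrix.GeneralLinearGroup.toLin.trans
    (LinearMap.GeneralLinearGroup.generalLinearEquiv F (Fin n → F))).toEquiv, Matrix.card_GL_field,
        Nat.cast_prod,
    ← Fin.prod_univ_eq_prod_range (fun i => (Fintype.card F : ℝ) ^ n - (Fintype.card F : ℝ) ^ i)]
  refine Finset.prod_congr rfl fun i _ => ?_
  rw [Nat.cast_sub, Nat.cast_pow, Nat.cast_pow]
  exact Nat.pow_le_pow_right Fintype.card_pos i.2.le

lemma prod_range_ne_zero {x : ℝ} (hx : 1 < x) (n : ℕ) : ∏ i ∈ Finset.range n, (x ^ (i + 1) - 1) ≠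
    0 :=
  Finset.prod_ne_zero_iff.2 fun i _ => (sub_pos.2 (one_lt_pow₀ hx (Nat.succ_ne_zero i))).ne'

lemma sum_range_add_id (a b : ℕ) : ∑ i ∈ Finset.range (a + b), i =
    (∑ i ∈ Finset.range a, i) + (∑ i ∈ Finset.range b, i) + a * b := by
  induction b with
  | zero => simp
  | succ b ih => rw [← add_assoc, Finset.sum_range_succ, ih, Finset.sum_range_succ]; ring

lemma gbinom_eq {x : ℝ} (hx : 1 < x) {n k : ℕ} (hk : k ≤ n) :
    gbinom n k x = (∏ i ∈ Finset.range n, (x ^ (i + 1) - 1)) /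
      ((∏ i ∈ Finset.range k, (x ^ (i + 1) - 1)) * ∏ i ∈ Finset.range (n - k), (x ^ (i + 1) - 1)) :=
          by
  obtain ⟨m, rfl⟩ := Nat.exists_eq_add_of_le' hk
  rw [Nat.add_sub_cancel, Finset.prod_range_add, eq_div_iff
    (mul_ne_zero (prod_range_ne_zero hx _) (prod_range_ne_zero hx _)), gbinom,
        Finset.prod_div_distrib,
    Nat.add_sub_cancel]
  have e : ∀ f : ℕ → ℝ, ∏ i ∈ Finset.Icc 1 k, f i = ∏ i ∈ Finset.range k, f (i + 1) := by
    intro f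
    rw [Finset.range_eq_Ico, Finset.prod_Ico_add' f 0 k 1]
    rfl
  rw [e, e, div_mul_eq_mul_div, div_eq_iff (prod_range_ne_zero hx _)]
  simp_rw [add_assoc]
  ring

/-- The number of involutions (including the identity) of a general linear group. -/
theorem card_involutions (h2 : (2 : F) ≠ 0) (n : ℕ) :
    (Nat.card {g : (Fin n → F) ≃ₗ[F] (Fin n → F) // g * g = 1} : ℝ) =
      ∑ k ∈ Finset.range (n + 1), (Fintype.card F : ℝ) ^ (k * (n - k)) * gbinom n k
          (Fintype.card F : ℝ) := by
  have hq : 1 < (Fintype.card F : ℝ) := by exact_mod_cast Fintype.one_lt_card (α := F)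
  have : Finite ((Fin n → F) ≃ₗ[F] (Fin n → F)) := DFunLike.finite _
  have := Fintype.ofFinite ((Fin n → F) ≃ₗ[F] (Fin n → F))
  have key : ∀ k ∈ Finset.range (n + 1),
      (Fintype.card F : ℝ) ^ (k * (n - k)) * gbinom n k (Fintype.card F : ℝ) =
          (((Finset.univ.filter fun g : (Fin n → F) ≃ₗ[F] (Fin n → F) => g * g = 1).filter
        fun g => finrank F (fixed g) = k).card : ℝ) := by
    intro k hk
    have hkn : k ≤ n := Nat.lt_succ_iff.1 (Finset.mem_range.1 hk)
    obtain ⟨m, rfl⟩ := Nat.exists_eq_add_of_le hkn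
    have e : ((Fin k → F) × (Fin m → F)) ≃ₗ[F] (Fin (k + m) → F) :=
      LinearEquiv.ofFinrankEq _ _ (by simp)
    have h := congrArg (Nat.cast : ℕ → ℝ) (card_involutions_mul h2 e)
    rw [Nat.cast_mul, Nat.cast_mul, card_linearEquiv, card_linearEquiv, card_linearEquiv,
        finrank_fin_fun] at h
    rw [Finset.filter_filter, ← Nat.subtype_card (p :=
        fun g : (Fin (k + m) → F) ≃ₗ[F] (Fin (k + m) → F) =>
      g * g = 1 ∧ finrank F (fixed g) = k) _ (by simp), gbinom_eq hq hkn, ← mul_div_assoc,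
          div_eq_iff
      (mul_ne_zero (prod_range_ne_zero hq _) (prod_range_ne_zero hq _)), Nat.add_sub_cancel_left]
    rw [sum_range_add_id, pow_add, pow_add] at h
    have h0 : (Fintype.card F : ℝ) ^ (∑ i ∈ Finset.range k, i) * (Fintype.card F : ℝ) ^
        (∑ i ∈ Finset.range m, i) ≠ 0 := by positivity
    apply mul_left_cancel₀ h0
    linear_combination -h
  rw [Finset.sum_congr rfl key, ← Nat.cast_sum, Nat.cast_inj, ← Finset.card_eq_sum_card_fiberwise]
  · exact Nat.subtype_card _ (by simp)
  · intro g _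
    rw [Finset.mem_coe, Finset.mem_range, Nat.lt_succ_iff]
    exact (Submodule.finrank_le _).trans (finrank_fin_fun F).le

end Count

end Involutions

namespace FrobeniusSchur

open Representation
open scoped MonoidAlgebra

variable {G : Type} [Group G] [Fintype G]

theorem sum_smul_eq_zero_of_isIrreducible {E : Type} [AddCommGroup E] [Module ℂ E]
    [FiniteDimensional ℂ E] (σ : Representation ℂ G E) [IsIrreducible σ] (f : G → ℂ)
    (hf : ∀ g h, f (h * g * h⁻¹) = f g) (h0 : ∑ x, f x * σ.character x = 0) :
    ∑ x, f x • σ x = 0 := by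
  have hcomm : ∀ (g : G) (v : E), (∑ x, f x • σ x) (σ g v) = σ g ((∑ x, f x • σ x) v) := by
    intro g v
    have : σ g * (∑ x, f x • σ x) = (∑ x, f x • σ x) * σ g := by
      rw [Finset.mul_sum, Finset.sum_mul]
      refine Fintype.sum_equiv (MulAut.conj g).toEquiv _ _ fun x => ?_
      have hx : (MulAut.conj g).toEquiv x = g * x * g⁻¹ := rfl
      rw [hx, hf, mul_smul_comm, smul_mul_assoc, ← map_mul, ← map_mul, inv_mul_cancel_right]
    exact (LinearMap.congr_fun this v).symm
  obtain ⟨c, hc⟩ := IsIrreducible.algebraMap_intertwiningMap_bijective_of_isAlgClosed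
    (k := ℂ) (ρ := σ) |>.2 (LinearMap.intertwiningMap_of_isIntertwiningMap σ σ _ hcomm)
  have hc' : ∑ x, f x • σ x = c • (LinearMap.id : E →ₗ[ℂ] E) := by
    have := congrArg IntertwiningMap.toLinearMap hc
    rw [Algebra.algebraMap_eq_smul_one] at this
    exact this.symm
  have htr := congrArg (LinearMap.trace ℂ E) hc'
  simp only [map_sum, map_smul, LinearMap.trace_id, smul_eq_mul] at htr
  have hE : Nontrivial E := by
    by_contra hE
    rw [not_nontrivial_iff_subsingleton] at hE
    have := IsIrreducible.finrank_intertwiningMap_self (k := ℂ) σ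
    have hs : Subsingleton (IntertwiningMap σ σ) :=
      ⟨fun a b => IntertwiningMap.ext (Subsingleton.elim _ _)⟩
    rw [Module.finrank_zero_of_subsingleton] at this
    exact zero_ne_one this
  have hd : (Module.finrank ℂ E : ℂ) ≠ 0 := by
    exact_mod_cast (Module.finrank_pos (R := ℂ) (M := E)).ne'
  have : c = 0 := by
    have h1 : c * Module.finrank ℂ E = 0 := by rw [← htr]; exact h0
    exact (mul_eq_zero.mp h1).resolve_right hd
  rw [hc', this, zero_smul]

/-- A class function orthogonal to all irreducible characters vanishes. -/
theorem eq_zero_of_sum_mul_character_eq_zero (f : G → ℂ)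
    (hf : ∀ g h, f (h * g * h⁻¹) = f g)
    (h0 : ∀ (E : Type) [AddCommGroup E] [Module ℂ E] [FiniteDimensional ℂ E]
      (σ : Representation ℂ G E), IsIrreducible σ → ∑ x, f x * σ.character x = 0) : f = 0 := by
  set c : ℂ[G] := ∑ x, MonoidAlgebra.single x (f x) with hc
  have key : ∀ S : Submodule ℂ[G] ℂ[G], IsSimpleModule ℂ[G] S → ∀ s ∈ S, c * s = 0 := by
    intro S hS s hs
    let σ : Representation ℂ G S := ofModule' S
    have hσ : ∀ (a : ℂ[G]) (x : S), σ.asAlgebraHom a x = a • x := by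
      intro a x
      have : σ.asAlgebraHom = Algebra.lsmul ℂ ℂ S := by simp [σ, ofModule', asAlgebraHom]
      rw [this]
      rfl
    let e : σ.asModule ≃ₗ[ℂ[G]] S :=
      { toFun := fun x => σ.asModuleEquiv x
        map_add' := fun _ _ => rfl
        map_smul' := fun a x => (σ.asModuleEquiv_map_smul a x).trans (hσ a _)
        invFun := fun x => σ.asModuleEquiv.symm x
        left_inv := fun _ => rfl
        right_inv := fun _ => rfl }
    have hirr : IsIrreducible σ :=
      (irreducible_iff_isSimpleModule_asModule σ).mpr (IsSimpleModule.congr e)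
    have hfin : FiniteDimensional ℂ S := by
      have : FiniteDimensional ℂ (S.restrictScalars ℂ) := inferInstance
      exact this
    have h1 := sum_smul_eq_zero_of_isIrreducible σ f hf (h0 _ _ hirr)
    have h3 : σ.asAlgebraHom c = 0 := by
      rw [← h1, hc, map_sum]
      exact Finset.sum_congr rfl fun x _ => asAlgebraHom_single _ _ _
    have h4 := hσ c ⟨s, hs⟩
    rw [h3, LinearMap.zero_apply] at h4
    exact congrArg Subtype.val h4.symm
  let K : Submodule ℂ[G] ℂ[G] := sSup {S | IsSimpleModule ℂ[G] S}
  have hK : K = ⊤ := IsSemisimpleModule.sSup_simples_eq_top ℂ[G] ℂ[G]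
  have h1 : ∀ s ∈ K, c * s = 0 := by
    intro s hs
    simp only [K, sSup_eq_iSup] at hs
    refine Submodule.iSup_induction' (motive := fun s _ => c * s = 0) _ ?_ ?_ ?_ hs
    · intro S x hx
      refine Submodule.iSup_induction' (motive := fun s _ => c * s = 0) _ ?_ ?_ ?_ hx
      · exact fun hS x hx => key S hS x hx
      · exact mul_zero c
      · intro x y _ _ hx hy
        rw [mul_add, hx, hy, add_zero]
    · exact mul_zero c
    · intro x y _ _ hx hy
      rw [mul_add, hx, hy, add_zero]
  have h2 : c = 0 := by
    have := h1 1 (hK ▸ Submodule.mem_top)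
    rwa [mul_one] at this
  funext x
  have h3 : c.coeff x = 0 := by rw [h2]; rfl
  rw [hc, MonoidAlgebra.coeff_sum, Finsupp.finsetSum_apply, Finset.sum_eq_single x] at h3
  · simpa using h3
  · intro y _ hy
    simp [hy.symm]
  · simp

end FrobeniusSchur

namespace FrobeniusSchur

open Representation
open scoped MonoidAlgebra Matrix

variable {G : Type} [Group G] [Fintype G]
variable {d : Type} [Fintype d] [DecidableEq d]

theorem trace_matrix_end (L : Matrix d d ℂ →ₗ[ℂ] Matrix d d ℂ) :
    LinearMap.trace ℂ _ L = ∑ i, ∑ j, L (Matrix.single i j 1) i j := by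
  rw [LinearMap.trace_eq_matrix_trace ℂ (Matrix.stdBasis ℂ d d), Matrix.trace,
    Fintype.sum_prod_type]
  refine Finset.sum_congr rfl fun i _ => Finset.sum_congr rfl fun j _ => ?_
  rw [Matrix.diag_apply, LinearMap.toMatrix_apply, Matrix.stdBasis_eq_single]
  simp [Matrix.stdBasis]

/-- The action of `G` on bilinear forms, the second argument being twisted by `τ`. -/
def formRep (M : G →* Matrix d d ℂ) (τ : G →* G) : Representation ℂ G (Matrix d d ℂ) where
  toFun g :=
    { toFun := fun X => (M g⁻¹)ᵀ * X * M (τ g⁻¹)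
      map_add' := fun X Y => by rw [mul_add, add_mul]
      map_smul' := fun c X => by simp }
  map_one' := by
    ext1 X
    simp
  map_mul' g h := by
    ext1 X
    simp [Matrix.transpose_mul, mul_assoc]

omit [Fintype G] in
theorem formRep_apply (M : G →* Matrix d d ℂ) (τ : G →* G) (g : G) (X : Matrix d d ℂ) :
    formRep M τ g X = (M g⁻¹)ᵀ * X * M (τ g⁻¹) := rfl

theorem mul_single_mul_apply (P Q : Matrix d d ℂ) (i j k l : d) :
    (Pᵀ * Matrix.single i j 1 * Q : Matrix d d ℂ) k l = P i k * Q j l := by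
  rw [Matrix.mul_assoc, Matrix.mul_apply, Finset.sum_eq_single i]
  · simp
  · intro b _ hb
    simp [hb]
  · simp

omit [Fintype G] in
theorem character_formRep (M : G →* Matrix d d ℂ) (τ : G →* G) (g : G) :
    (formRep M τ).character g = (M g⁻¹).trace * (M (τ g⁻¹)).trace := by
  rw [Representation.character, trace_matrix_end]
  simp only [formRep_apply, mul_single_mul_apply]
  rw [Matrix.trace, Matrix.trace, Finset.sum_mul_sum]
  rfl

omit [Fintype G] in
theorem trace_transpose_comp_formRep (M : G →* Matrix d d ℂ) (τ : G →* G) (g : G) :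
    LinearMap.trace ℂ _ ((Matrix.transposeLinearEquiv d d ℂ ℂ).toLinearMap ∘ₗ formRep M τ g)
      = (M (g⁻¹ * τ g⁻¹)).trace := by
  rw [trace_matrix_end, map_mul, Matrix.trace]
  refine Finset.sum_congr rfl fun i _ => ?_
  rw [Matrix.diag_apply, Matrix.mul_apply]
  refine Finset.sum_congr rfl fun j _ => ?_
  change (formRep M τ g (Matrix.single i j 1)) j i = _
  rw [formRep_apply, mul_single_mul_apply]

theorem sum_trace_mul_eq (M : G →* Matrix d d ℂ) (τ : G →* G) :
    ∑ g, (M (g * τ g)).trace = LinearMap.trace ℂ _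
      ((Matrix.transposeLinearEquiv d d ℂ ℂ).toLinearMap ∘ₗ ∑ g, formRep M τ g) := by
  have h : (Matrix.transposeLinearEquiv d d ℂ ℂ).toLinearMap ∘ₗ ∑ g, formRep M τ g
      = ∑ g, (Matrix.transposeLinearEquiv d d ℂ ℂ).toLinearMap ∘ₗ formRep M τ g :=
    Finset.mul_sum (R := Module.End ℂ (Matrix d d ℂ)) _ _ _
  rw [h, map_sum]
  refine Fintype.sum_equiv (Equiv.inv G) _ _ fun g => ?_
  rw [trace_transpose_comp_formRep]
  simp

/-- The twisted Frobenius–Schur alternative. -/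
theorem exists_sign_of_sum_eq_card (M : G →* Matrix d d ℂ) (τ : G →* G)
    (hτ : ∀ g, τ (τ g) = g)
    (h : ∑ g, (M g).trace * (M (τ g)).trace = Nat.card G) :
    ∃ (ε : ℤ) (X : Matrix d d ℂ), (ε = 1 ∨ ε = -1) ∧
      ∑ g, (M (g * τ g)).trace = ε * Nat.card G ∧ X ≠ 0 ∧
      (∀ g, (M g)ᵀ * X * M (τ g) = X) ∧ Xᵀ = (ε : ℂ) • X := by
  have hG : (Nat.card G : ℂ) ≠ 0 := Nat.cast_ne_zero.mpr Nat.card_pos.ne'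
  have := invertibleOfNonzero hG
  have : Invertible (Fintype.card G : ℂ) := by rw [Fintype.card_eq_nat_card]; assumption
  set σ := formRep M τ with hσ
  have hdim : Module.finrank ℂ (invariants σ) = 1 := by
    have h1 := card_inv_mul_sum_char_eq_finrank (k := ℂ) σ
    have h2 : ∑ g, σ.character g = Nat.card G := by
      rw [← h]
      refine Fintype.sum_equiv (Equiv.inv G) _ _ fun g => ?_
      rw [hσ, character_formRep]
      rfl
    rw [h2, inv_mul_cancel₀ hG] at h1
    exact_mod_cast h1.symm
  obtain ⟨X', hX0', hX'⟩ := finrank_eq_one_iff'.mp hdim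
  obtain ⟨X, hXinv⟩ := X'
  have hX0 : X ≠ 0 := fun h0 => hX0' (Subtype.ext h0)
  have hX : ∀ Y ∈ invariants σ, ∃ c : ℂ, Y = c • X := by
    intro Y hY
    obtain ⟨c, hc⟩ := hX' ⟨Y, hY⟩
    exact ⟨c, (congrArg Subtype.val hc).symm⟩
  have hinv : ∀ Y ∈ invariants σ, ∀ g, (M g)ᵀ * Y * M (τ g) = Y := by
    intro Y hY g
    have h1 := hY g⁻¹
    rwa [hσ, formRep_apply, inv_inv] at h1
  have hT : Xᵀ ∈ invariants σ := by
    intro g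
    have h1 := congrArg Matrix.transpose (hinv X hXinv (τ g⁻¹))
    rw [hτ, Matrix.transpose_mul, Matrix.transpose_mul, Matrix.transpose_transpose,
      ← Matrix.mul_assoc] at h1
    rw [hσ, formRep_apply, h1]
  obtain ⟨e, he⟩ := hX _ hT
  have hee : e * e = 1 := by
    have h1 := congrArg Matrix.transpose he
    rw [Matrix.transpose_transpose, Matrix.transpose_smul, he, smul_smul] at h1
    have h2 : (e * e - 1) • X = 0 := by rw [sub_smul, one_smul, ← h1, sub_self]
    exact sub_eq_zero.mp ((smul_eq_zero.mp h2).resolve_right hX0)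
  obtain ⟨ε, hε, hεe⟩ : ∃ ε : ℤ, (ε = 1 ∨ ε = -1) ∧ (ε : ℂ) = e := by
    rcases mul_self_eq_one_iff.mp hee with h1 | h1
    · exact ⟨1, Or.inl rfl, by simp [h1]⟩
    · exact ⟨-1, Or.inr rfl, by simp [h1]⟩
  refine ⟨ε, X, hε, ?_, hX0, hinv X hXinv, by rw [hεe, he]⟩
  set T := (Matrix.transposeLinearEquiv d d ℂ ℂ).toLinearMap with hTdef
  have hTA : T ∘ₗ averageMap σ = e • averageMap σ := by
    ext1 Y
    obtain ⟨c, hc⟩ := hX _ (averageMap_invariant σ Y)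
    rw [LinearMap.comp_apply, LinearMap.smul_apply, hc]
    change (c • X)ᵀ = _
    rw [Matrix.transpose_smul, he, smul_comm]
  have htr := congrArg (LinearMap.trace ℂ _) hTA
  rw [map_smul, (isProj_averageMap σ).trace, hdim] at htr
  have hA : averageMap σ = (Nat.card G : ℂ)⁻¹ • ∑ g, σ g := by
    simp [averageMap, GroupAlgebra.average, map_sum]
  rw [hA, LinearMap.comp_smul, map_smul, hTdef, hσ, ← sum_trace_mul_eq] at htr
  rw [smul_eq_mul, Nat.cast_one, smul_eq_mul, mul_one, inv_mul_eq_iff_eq_mul₀ hG] at htr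
  rw [htr, hεe, mul_comm]

/-- If there is no invariant form, the Frobenius–Schur sum vanishes. -/
theorem sum_eq_zero_of_sum_eq_zero (M : G →* Matrix d d ℂ) (τ : G →* G)
    (h : ∑ g, (M g).trace * (M (τ g)).trace = 0) :
    ∑ g, (M (g * τ g)).trace = 0 := by
  have hG : (Nat.card G : ℂ) ≠ 0 := Nat.cast_ne_zero.mpr Nat.card_pos.ne'
  have := invertibleOfNonzero hG
  have : Invertible (Fintype.card G : ℂ) := by rw [Fintype.card_eq_nat_card]; assumption
  set σ := formRep M τ with hσ
  have hdim : Module.finrank ℂ (invariants σ) = 0 := by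
    have h1 := card_inv_mul_sum_char_eq_finrank (k := ℂ) σ
    have h2 : ∑ g, σ.character g = 0 := by
      rw [← h]
      refine Fintype.sum_equiv (Equiv.inv G) _ _ fun g => ?_
      rw [hσ, character_formRep]
      rfl
    rw [h2, mul_zero] at h1
    exact_mod_cast h1.symm
  have hbot : invariants σ = ⊥ := Submodule.finrank_eq_zero.mp hdim
  have hzero : averageMap σ = 0 := by
    ext1 Y
    have := averageMap_invariant σ Y
    rw [hbot, Submodule.mem_bot] at this
    exact this
  have hA : averageMap σ = (Nat.card G : ℂ)⁻¹ • ∑ g, σ g := by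
    simp [averageMap, GroupAlgebra.average, map_sum]
  have hs : ∑ g, σ g = 0 := by
    rw [hzero] at hA
    exact (smul_eq_zero.mp hA.symm).resolve_left (inv_ne_zero hG)
  rw [sum_trace_mul_eq, ← hσ, hs, LinearMap.comp_zero, map_zero]

end FrobeniusSchur

namespace FrobeniusSchur

open Representation
open scoped MonoidAlgebra Matrix ComplexOrder

variable {G : Type} [Group G] [Fintype G]
variable {E : Type} [AddCommGroup E] [Module ℂ E] [FiniteDimensional ℂ E]

theorem sum_character_mul_inv (ρ : Representation ℂ G E) [IsIrreducible ρ] :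
    ∑ g, ρ.character g * ρ.character g⁻¹ = Nat.card G := by
  have hG : (Nat.card G : ℂ) ≠ 0 := Nat.cast_ne_zero.mpr Nat.card_pos.ne'
  have := invertibleOfNonzero hG
  have h := card_inv_mul_sum_char_mul_char_eq_finrank ρ ρ
  rw [IsIrreducible.finrank_intertwiningMap_self, inv_mul_eq_iff_eq_mul₀ hG] at h
  simpa using h

theorem isIrreducible_of_sum_character (ρ : Representation ℂ G E)
    (h : ∑ g, ρ.character g * ρ.character g⁻¹ = Nat.card G) : IsIrreducible ρ := by
  have hG : (Nat.card G : ℂ) ≠ 0 := Nat.cast_ne_zero.mpr Nat.card_pos.ne'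
  have := invertibleOfNonzero hG
  have : Invertible (Fintype.card G : ℂ) := by rw [Fintype.card_eq_nat_card]; assumption
  have h1 := card_inv_mul_sum_char_mul_char_eq_finrank ρ ρ
  rw [h, inv_mul_cancel₀ hG] at h1
  have h2 : Module.finrank ℂ (Module.End ℂ[G] ρ.asModule) = 1 := by
    rw [← (IntertwiningMap.equivAlgEnd (ρ := ρ)).toLinearEquiv.finrank_eq]
    exact_mod_cast h1.symm
  have hnt : Nontrivial (Module.End ℂ[G] ρ.asModule) :=
    Module.nontrivial_of_finrank_pos (R := ℂ) (by omega)
  have hM : Nontrivial ρ.asModule := by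
    by_contra hM
    rw [not_nontrivial_iff_subsingleton] at hM
    obtain ⟨a, b, hab⟩ := hnt
    exact hab (LinearMap.ext fun x => Subsingleton.elim _ _)
  rw [irreducible_iff_isSimpleModule_asModule, isSimpleModule_iff]
  refine { eq_bot_or_eq_top := fun W => ?_ }
  obtain ⟨W', hW⟩ := exists_isCompl W
  let p : Module.End ℂ[G] ρ.asModule := W.projection W' hW
  obtain ⟨c, hc⟩ := (finrank_eq_one_iff_of_nonzero' (1 : Module.End ℂ[G] ρ.asModule)
    one_ne_zero).mp h2 p
  have hp : ∀ x, c • x = p x := fun x => by rw [← hc]; rfl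
  by_cases hc0 : c = 0
  · left
    rw [Submodule.eq_bot_iff]
    intro x hx
    have : p x = x := by simp [p, hx]
    rw [← this, ← hp, hc0, zero_smul]
  · right
    rw [Submodule.eq_top_iff']
    intro x
    have h3 : p (c⁻¹ • x) ∈ W := Submodule.projection_apply_mem hW _
    rwa [← hp, smul_inv_smul₀ hc0] at h3

theorem character_inv (ρ : Representation ℂ G E) (g : G) :
    ρ.character g⁻¹ = (starRingEnd ℂ) (ρ.character g) := by
  let b := Module.finBasis ℂ E
  let M : G →* Matrix (Fin (Module.finrank ℂ E)) (Fin (Module.finrank ℂ E)) ℂ :=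
    (LinearMap.toMatrixAlgEquiv b : _ →* _).comp ρ
  have hM : ∀ g, ρ.character g = (M g).trace := fun g =>
    LinearMap.trace_eq_matrix_trace ℂ b (ρ g)
  let H := ∑ x, (M x)ᴴ * M x
  have hH : H.PosDef := by
    have h1 : H = 1 + ∑ x ∈ Finset.univ.erase 1, (M x)ᴴ * M x := by
      simp only [H]
      rw [← Finset.add_sum_erase _ _ (Finset.mem_univ (1 : G))]
      simp
    rw [h1]
    exact Matrix.PosDef.one.add_posSemidef
      (Matrix.posSemidef_sum _ fun x _ => Matrix.posSemidef_conjTranspose_mul_self _)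
  have hinv : (M g)ᴴ * H * M g = H := by
    simp only [H]
    rw [Finset.mul_sum, Finset.sum_mul]
    refine Fintype.sum_equiv (Equiv.mulRight g) _ _ fun x => ?_
    rw [Equiv.coe_mulRight, map_mul, Matrix.conjTranspose_mul]
    simp only [mul_assoc]
  have hu : IsUnit H.det := (Matrix.isUnit_iff_isUnit_det H).mp hH.isUnit
  have h2 : M g⁻¹ = H⁻¹ * (M g)ᴴ * H := by
    have h3 : (M g)ᴴ * H = H * M g⁻¹ := by
      calc (M g)ᴴ * H = (M g)ᴴ * H * (M g * M g⁻¹) := by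
            rw [← map_mul, mul_inv_cancel, map_one, mul_one]
        _ = H * M g⁻¹ := by rw [← mul_assoc, hinv]
    rw [mul_assoc, h3, ← mul_assoc, Matrix.nonsing_inv_mul _ hu, one_mul]
  rw [hM, hM, h2, mul_assoc, Matrix.trace_mul_comm, mul_assoc, Matrix.mul_nonsing_inv _ hu, mul_one,
    Matrix.trace_conjTranspose]
  rfl

omit [Fintype G] [FiniteDimensional ℂ E] in
/-- The invariant bilinear form of an irreducible representation is nondegenerate. -/
theorem separatingLeft_of_invariant (ρ : Representation ℂ G E) [IsIrreducible ρ]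
    (B : E →ₗ[ℂ] E →ₗ[ℂ] ℂ) (hB0 : B ≠ 0) (hB : ∀ g v w, B (ρ g v) (ρ g w) = B v w) :
    B.SeparatingLeft := by
  have hpair : ∀ (g : G) (v : E), B (ρ g v) = ρ.dual g (B v) := by
    intro g v
    ext1 w
    rw [dual_apply, Module.Dual.transpose_apply, LinearMap.comp_apply, ← hB g v (ρ g⁻¹ w)]
    congr 1
    rw [← Module.End.mul_apply, ← map_mul, mul_inv_cancel, map_one, Module.End.one_apply]
  let f := LinearMap.intertwiningMap_of_isIntertwiningMap ρ ρ.dual B hpair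
  rcases IsIrreducible.injective_or_eq_zero f with h | h
  · intro v hv
    have : f v = f 0 := by
      rw [map_zero]
      exact LinearMap.ext hv
    exact h this
  · exact absurd (congrArg IntertwiningMap.toLinearMap h) hB0

variable (ρ : Representation ℂ G E) [IsIrreducible ρ]

/-- The matrices of a representation with respect to a chosen basis. -/
def matrixHom (ρ : Representation ℂ G E) :
    G →* Matrix (Fin (Module.finrank ℂ E)) (Fin (Module.finrank ℂ E)) ℂ :=
  (LinearMap.toMatrixAlgEquiv (Module.finBasis ℂ E) : _ →* _).comp ρ

omit [Fintype G] in
theorem trace_matrixHom (ρ : Representation ℂ G E) (g : G) :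
    (matrixHom ρ g).trace = ρ.character g :=
  (LinearMap.trace_eq_matrix_trace ℂ (Module.finBasis ℂ E) (ρ g)).symm

/-- The twisted Frobenius–Schur indicator is a sign when twisting gives the dual character. -/
theorem twisted_sum_character (τ : G →* G) (hτ : ∀ g, τ (τ g) = g)
    (h : ∀ g, ρ.character (τ g) = ρ.character g⁻¹) :
    ∃ ε : ℤ, (ε = 1 ∨ ε = -1) ∧ ∑ g, ρ.character (g * τ g) = ε * Nat.card G := by
  obtain ⟨ε, -, hε, h1, -⟩ := exists_sign_of_sum_eq_card (matrixHom ρ) τ hτ (by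
    simp_rw [trace_matrixHom, h]
    exact sum_character_mul_inv ρ)
  refine ⟨ε, hε, ?_⟩
  simpa only [trace_matrixHom] using h1

theorem sum_character_sq_of_not_real (h : ¬ ∀ g, ρ.character g⁻¹ = ρ.character g) :
    ∑ g, ρ.character (g * g) = 0 := by
  have hG : (Nat.card G : ℂ) ≠ 0 := Nat.cast_ne_zero.mpr Nat.card_pos.ne'
  have := invertibleOfNonzero hG
  have hd : IsIrreducible ρ.dual := isIrreducible_of_sum_character _ (by
    simp_rw [char_dual, inv_inv]
    rw [← sum_character_mul_inv ρ]
    exact Finset.sum_congr rfl fun g _ => mul_comm _ _)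
  have h1 := char_orthonormal ρ ρ.dual
  rw [if_neg] at h1
  · simp_rw [char_dual, inv_inv] at h1
    have h2 := (mul_eq_zero.mp h1).resolve_left (inv_ne_zero hG)
    have h3 := sum_eq_zero_of_sum_eq_zero (matrixHom ρ) (MonoidHom.id G) (by
      simpa only [trace_matrixHom, MonoidHom.id_apply] using h2)
    simpa only [trace_matrixHom, MonoidHom.id_apply] using h3
  · rintro ⟨φ⟩
    refine h fun g => ?_
    rw [← char_dual, char_iso φ]

open SymplecticTrace in
/-- A real irreducible character is either orthogonal or symplectic. -/
theorem sum_character_sq_or_isSymplectic (h : ∀ g, ρ.character g⁻¹ = ρ.character g) :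
    ∑ g, ρ.character (g * g) = Nat.card G ∨ IsSymplectic ρ := by
  obtain ⟨ε, X, hε, h1, hX0, hX, hXT⟩ := exists_sign_of_sum_eq_card (matrixHom ρ)
    (MonoidHom.id G) (fun _ => rfl) (by
    simp_rw [MonoidHom.id_apply, trace_matrixHom]
    rw [← sum_character_mul_inv ρ]
    simp_rw [h])
  rcases hε with rfl | rfl
  · left
    simpa only [trace_matrixHom, MonoidHom.id_apply, Int.cast_one, one_mul] using h1
  · right
    let b := Module.finBasis ℂ E
    let B : E →ₗ[ℂ] E →ₗ[ℂ] ℂ := Matrix.toLinearMap₂ b b X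
    have hXT' : Xᵀ = -X := by simpa using hXT
    have hBX : LinearMap.toMatrix₂ b b B = X := LinearMap.toMatrix₂_toLinearMap₂ b b X
    have hB0 : B ≠ 0 := by
      intro h0
      rw [h0, map_zero] at hBX
      exact hX0 hBX.symm
    have hinv : ∀ g v w, B (ρ g v) (ρ g w) = B v w := by
      intro g v w
      have : B.compl₁₂ (ρ g) (ρ g) = B := by
        apply (LinearMap.toMatrix₂ b b).injective
        rw [LinearMap.toMatrix₂_compl₁₂ b b b b, hBX]
        exact hX g
      exact LinearMap.congr_fun₂ this v w
    have hflip : B.flip = -B := by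
      apply (LinearMap.toMatrix₂ b b).injective
      rw [map_neg, hBX, ← hXT', ← hBX]
      ext i j
      simp [LinearMap.toMatrix₂_apply]
    refine ⟨B, fun v => ?_, separatingLeft_of_invariant ρ B hB0 hinv, hinv⟩
    have h2 : B v v = - B v v := LinearMap.congr_fun₂ hflip v v
    linear_combination (1 / 2 : ℂ) * h2

open SymplecticTrace in
/-- An even weight pairing to `± |G|` with a real irreducible character forces the character to be
orthogonal. -/
theorem sum_character_sq_of_isEvenWeight (N : G → ℂ) (hN : IsEvenWeight N)
    (ε : ℤ) (hε : ε = 1 ∨ ε = -1) (h1 : ∑ g, ρ.character g * N g = ε * Nat.card G)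
    (h : ∀ g, ρ.character g⁻¹ = ρ.character g) :
    ∑ g, ρ.character (g * g) = Nat.card G := by
  refine (sum_character_sq_or_isSymplectic ρ h).resolve_right fun hs => ?_
  obtain ⟨z, hz, hz2⟩ := hN E ρ hs
  have hG : (Nat.card G : ℂ) ≠ 0 := Nat.cast_ne_zero.mpr Nat.card_pos.ne'
  have h2 : (ε : ℂ) = 2 * z := by
    rw [h1] at hz2
    exact mul_right_cancel₀ hG (by rw [hz2]; ring)
  have h3 : z = algebraMap ℚ ℂ ((ε : ℚ) / 2) := by
    simp
    linear_combination (-1 / 2 : ℂ) * h2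
  rw [h3, isIntegral_algebraMap_iff (algebraMap ℚ ℂ).injective,
    IsIntegrallyClosed.isIntegral_iff] at hz
  obtain ⟨y, hy⟩ := hz
  have h4 : (2 * y : ℚ) = ε := by
    have : (y : ℚ) = ε / 2 := by simpa using hy
    rw [this]
    ring
  have h5 : 2 * y = ε := by exact_mod_cast h4
  omega

end FrobeniusSchur

namespace FrobeniusSchur

open Representation CategoryTheory

variable {G : Type} [Group G] [Fintype G]

section Complete

variable {ι : Type} [Fintype ι] (R : ι → FDRep ℂ G) (hsimple : ∀ i, Simple (R i))
  (hdistinct : ∀ i j : ι, Nonempty (R i ≅ R j) → i = j)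
  (hcomplete : ∀ ρ : FDRep ℂ G, Simple ρ → ∃ i, Nonempty (ρ ≅ R i))

include hsimple hdistinct hcomplete in
/-- Column orthogonality at the identity. -/
theorem sum_finrank_mul_character (x : G) :
    ∑ i, (Module.finrank ℂ (R i) : ℂ) * (R i).character x = if x = 1 then (Nat.card G : ℂ) else 0 :=
        by
  have hG : (Nat.card G : ℂ) ≠ 0 := Nat.cast_ne_zero.mpr Nat.card_pos.ne'
  have := invertibleOfNonzero hG
  let f : G → ℂ := fun x => (if x = 1 then (Nat.card G : ℂ) else 0)
    - ∑ i, (Module.finrank ℂ (R i) : ℂ) * (R i).character x⁻¹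
  have hf0 : f = 0 := by
    refine eq_zero_of_sum_mul_character_eq_zero f ?_ ?_
    · intro g h
      have h1 : ∀ i, (R i).character (h * g * h⁻¹)⁻¹ = (R i).character g⁻¹ := fun i => by
        rw [← FDRep.char_conj (R i) g⁻¹ h]
        congr 1
        group
      simp only [f, h1, conj_eq_one_iff]
    · intro E _ _ _ σ hσ
      have hS : Simple (FDRep.of σ) := by
        rw [FDRep.simple_iff_char_is_norm_one]
        exact sum_character_mul_inv σ
      obtain ⟨i₀, ⟨φ⟩⟩ := hcomplete _ hS
      have hdim : (Module.finrank ℂ (R i₀) : ℂ) = σ.character 1 := by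
        rw [← FDRep.char_one, ← FDRep.char_iso φ]
        rfl
      have horth : ∀ i, ∑ x, (R i).character x⁻¹ * σ.character x =
          if i = i₀ then (Nat.card G : ℂ) else 0 := by
        intro i
        have := hsimple i
        have h1 := FDRep.char_orthonormal (FDRep.of σ) (R i)
        rw [inv_mul_eq_iff_eq_mul₀ hG] at h1
        have h2 : ∑ x, (R i).character x⁻¹ * σ.character x
            = ∑ x, (FDRep.of σ).character x * (R i).character x⁻¹ :=
          Finset.sum_congr rfl fun x _ => mul_comm _ _
        have h3 : Nonempty (FDRep.of σ ≅ R i) ↔ i = i₀ := by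
          constructor
          · rintro ⟨ψ⟩
            exact hdistinct _ _ ⟨ψ.symm ≪≫ φ⟩
          · rintro rfl
            exact ⟨φ⟩
        rw [h2, h1]
        simp only [h3]
        split_ifs <;> simp
      simp only [f, sub_mul, Finset.sum_sub_distrib, Finset.sum_mul, mul_assoc]
      rw [Finset.sum_comm]
      simp_rw [← Finset.mul_sum, horth]
      simp [hdim, mul_comm]
  have h := congrFun hf0 x⁻¹
  simp only [f, inv_inv, inv_eq_one, Pi.zero_apply] at h
  exact (sub_eq_zero.mp h).symm

theorem forall_real_iff (V : FDRep ℂ G) :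
    (∀ g, ∃ r : ℝ, V.character g = r) ↔ ∀ g, character V.ρ g⁻¹ = character V.ρ g := by
  refine forall_congr' fun g => ?_
  rw [character_inv, Complex.conj_eq_iff_real]
  rfl

include hsimple hdistinct hcomplete in
/-- If all real irreducible characters are orthogonal, the sum of the degrees of the real
irreducible characters is the number of elements with square one. -/
theorem sum_finrank_real_eq_card
    (hreal : ∀ i, (∀ g, character (R i).ρ g⁻¹ = character (R i).ρ g) →
      ∑ g, character (R i).ρ (g * g) = Nat.card G) :
    ∑ i ∈ Finset.univ.filter (fun i => ∀ g, ∃ r : ℝ, (R i).character g = r),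
      (Module.finrank ℂ (R i) : ℝ) = Nat.card {g : G // g * g = 1} := by
  have hG : (Nat.card G : ℂ) ≠ 0 := Nat.cast_ne_zero.mpr Nat.card_pos.ne'
  have hind : ∀ i, ∑ g, (R i).character (g * g) =
      if (∀ g, ∃ r : ℝ, (R i).character g = r) then (Nat.card G : ℂ) else 0 := by
    intro i
    have hirr : IsIrreducible (R i).ρ := isIrreducible_of_sum_character _
      ((FDRep.simple_iff_char_is_norm_one (R i)).mp (hsimple i))
    split_ifs with h
    · exact hreal i ((forall_real_iff (R i)).mp h)
    · exact sum_character_sq_of_not_real (R i).ρ (fun h' => h ((forall_real_iff (R i)).mpr h'))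
  have h1 : (∑ i ∈ Finset.univ.filter (fun i => ∀ g, ∃ r : ℝ, (R i).character g = r),
      (Module.finrank ℂ (R i) : ℂ)) * Nat.card G = Nat.card {g : G // g * g = 1} * Nat.card G := by
    calc _ = ∑ i, (Module.finrank ℂ (R i) : ℂ) * ∑ g, (R i).character (g * g) := by
          rw [Finset.sum_mul, Finset.sum_filter]
          refine Finset.sum_congr rfl fun i _ => ?_
          rw [hind]
          split_ifs <;> simp
      _ = ∑ g : G, ∑ i, (Module.finrank ℂ (R i) : ℂ) * (R i).character (g * g) := by
          simp_rw [Finset.mul_sum]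
          exact Finset.sum_comm
      _ = ∑ g : G, if g * g = 1 then (Nat.card G : ℂ) else 0 := by
          simp_rw [sum_finrank_mul_character R hsimple hdistinct hcomplete]
      _ = _ := by
          rw [← Finset.sum_filter, Finset.sum_const, nsmul_eq_mul,
            Nat.card_eq_fintype_card (α := {g : G // g * g = 1}), Fintype.card_subtype]
  have h2 := mul_right_cancel₀ hG h1
  exact_mod_cast h2

end Complete

open SymplecticTrace in
theorem IsEvenWeight.comp_mulEquiv {L : Type} [Group L] [Fintype L] {N : L → ℂ}
    (hN : IsEvenWeight N) (e : G ≃* L) : IsEvenWeight (fun g => N (e g)) := by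
  intro E _ _ _ ρ hρ
  obtain ⟨B, h1, h2, h3⟩ := hρ
  have := hN E (ρ.comp (e.symm : L →* G)) ⟨B, h1, h2, fun g => h3 _⟩
  rw [Nat.card_congr e.toEquiv]
  convert this using 1
  refine Fintype.sum_equiv e.toEquiv _ _ fun g => ?_
  change _ = ρ.character (e.symm (e g)) * N (e g)
  rw [e.symm_apply_apply]

end FrobeniusSchur

namespace RealDegrees

open Representation AsymForms

variable {F : Type} [Field F] {n : ℕ}

/-- The identification of matrices and linear automorphisms. -/
def glEquiv (F : Type) [Field F] (n : ℕ) : GL (Fin n) F ≃* ((Fin n → F) ≃ₗ[F] (Fin n → F)) :=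
  Matrix.GeneralLinearGroup.toLin.trans (LinearMap.GeneralLinearGroup.generalLinearEquiv F
      (Fin n → F))

/-- The inverse transpose automorphism. -/
def invTranspose : GL (Fin n) F →* GL (Fin n) F where
  toFun a := ⟨(↑a⁻¹ : Matrix (Fin n) (Fin n) F)ᵀ, (a : Matrix (Fin n) (Fin n) F)ᵀ, by
    rw [← Matrix.transpose_mul, ← Units.val_mul, mul_inv_cancel, Units.val_one,
      Matrix.transpose_one], by
    rw [← Matrix.transpose_mul, ← Units.val_mul, inv_mul_cancel, Units.val_one,
      Matrix.transpose_one]⟩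
  map_one' := by
    ext1
    simp
  map_mul' a b := by
    ext1
    simp [Matrix.transpose_mul, _root_.mul_inv_rev]

theorem val_invTranspose (a : GL (Fin n) F) :
    (invTranspose a : Matrix (Fin n) (Fin n) F) = (↑a⁻¹ : Matrix (Fin n) (Fin n) F)ᵀ := rfl

theorem invTranspose_invTranspose (a : GL (Fin n) F) : invTranspose (invTranspose a) = a := by
  ext1
  rw [val_invTranspose, ← map_inv, val_invTranspose, inv_inv, Matrix.transpose_transpose]

theorem exists_conj_invTranspose (a : GL (Fin n) F) :
    ∃ b : GL (Fin n) F, invTranspose a = b * a⁻¹ * b⁻¹ := by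
  obtain ⟨b, hb⟩ := SelfAdjoint.exists_transpose_mul_eq (↑a⁻¹ : Matrix (Fin n) (Fin n) F)
  refine ⟨b, eq_mul_inv_of_mul_eq ?_⟩
  ext1
  exact hb

theorem asymCount_glEquiv (g : GL (Fin n) F) :
    asymCount (glEquiv F n g) = Nat.card {a : GL (Fin n) F // a * invTranspose a = g} := by
  have key : ∀ b : (Fin n → F) →ₗ[F] (Fin n → F) →ₗ[F] F,
      (∀ x y, b x y = b y (glEquiv F n g x)) ↔
        (LinearMap.toMatrix₂' F b)ᵀ = LinearMap.toMatrix₂' F b * (g : Matrix (Fin n) (Fin n) F) :=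
            by
    intro b
    have h1 : LinearMap.toMatrix₂' F (b.compl₁₂ LinearMap.id
        (Matrix.toLin' (g : Matrix (Fin n) (Fin n) F)))
        = LinearMap.toMatrix₂' F b * (g : Matrix (Fin n) (Fin n) F) := by
      rw [LinearMap.toMatrix₂'_compl₁₂]
      simp
    have h2 : (LinearMap.toMatrix₂' F b)ᵀ = LinearMap.toMatrix₂' F b.flip := by
      ext i j
      simp [LinearMap.toMatrix₂'_apply]
    rw [h2, ← h1, (LinearMap.toMatrix₂' F).injective.eq_iff, LinearMap.ext_iff₂]
    exact forall_comm
  refine Nat.card_congr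
    { toFun := fun b => ⟨(Matrix.GeneralLinearGroup.mkOfDetNeZero (LinearMap.toMatrix₂' F b.1)
        ((LinearMap.separatingLeft_iff_det_ne_zero (Pi.basisFun F (Fin n))).1 b.2.2))⁻¹, ?_⟩
      invFun := fun a => ⟨Matrix.toLinearMap₂' F (↑(a.1)⁻¹ : Matrix (Fin n) (Fin n) F), ?_, ?_⟩
      left_inv := fun b => ?_
      right_inv := fun a => ?_ }
  · rw [inv_mul_eq_iff_eq_mul]
    ext1
    rw [val_invTranspose, inv_inv]
    exact (key b.1).1 b.2.1
  · rw [key, LinearMap.toMatrix'_toLinearMap₂']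
    have hag : a.1⁻¹ * g = invTranspose a.1 := inv_mul_eq_of_eq_mul a.2.symm
    rw [← Units.val_mul, hag]
    rfl
  · rw [LinearMap.separatingLeft_toLinearMap₂'_iff_det_ne_zero]
    exact ((Matrix.isUnit_iff_isUnit_det _).1 (a.1⁻¹).isUnit).ne_zero
  · apply Subtype.ext
    simp [Matrix.GeneralLinearGroup.mkOfDetNeZero]
  · apply Subtype.ext
    rw [inv_eq_iff_eq_inv]
    ext1
    exact LinearMap.toMatrix'_toLinearMap₂' _

variable [Fintype F]

theorem sum_character_mul_asymCount (χ : GL (Fin n) F → ℂ) :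
    ∑ g, χ g * asymCount (glEquiv F n g) = ∑ a, χ (a * invTranspose a) := by
  simp_rw [asymCount_glEquiv, Nat.card_eq_fintype_card, Fintype.card_subtype, Finset.card_filter,
    Nat.cast_sum, Finset.mul_sum]
  rw [Finset.sum_comm]
  refine Finset.sum_congr rfl fun a _ => ?_
  simp

local instance (priority := 10) (α : Type*) [Finite α] : Fintype α := Fintype.ofFinite α

open SymplecticTrace in
theorem sum_character_sq_eq_card (h2 : (2 : F) ≠ 0) {E : Type} [AddCommGroup E] [Module ℂ E]
    [FiniteDimensional ℂ E] (ρ : Representation ℂ (GL (Fin n) F) E) [IsIrreducible ρ]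
    (hreal : ∀ g, ρ.character g⁻¹ = ρ.character g) :
    ∑ g, ρ.character (g * g) = Nat.card (GL (Fin n) F) := by
  have : Finite ((Fin n → F) ≃ₗ[F] (Fin n → F)) := DFunLike.finite _
  have hN := FrobeniusSchur.IsEvenWeight.comp_mulEquiv
    (isEvenWeight_asymCount h2 n (Fin n → F) (Module.finrank_fin_fun F)) (glEquiv F n)
  obtain ⟨ε, hε, h1⟩ := FrobeniusSchur.twisted_sum_character ρ invTranspose
    invTranspose_invTranspose (fun g => by
      obtain ⟨b, hb⟩ := exists_conj_invTranspose g
      rw [hb, Representation.char_conj])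
  refine FrobeniusSchur.sum_character_sq_of_isEvenWeight ρ _ hN ε hε ?_ hreal
  rw [← h1]
  exact sum_character_mul_asymCount _

omit [Fintype F] in
theorem card_sq_eq_one :
    Nat.card {g : GL (Fin n) F // g * g = 1} =
      Nat.card {g : (Fin n → F) ≃ₗ[F] (Fin n → F) // g * g = 1} := by
  refine Nat.card_congr ((glEquiv F n).toEquiv.subtypeEquiv fun g => ?_)
  change _ ↔ glEquiv F n g * glEquiv F n g = 1
  rw [← map_mul, EmbeddingLike.map_eq_one_iff]

end RealDegrees

theorem stmt_4 (n : ℕ) (q : ℕ) (hq : ∃ p r : ℕ, p.Prime ∧ Odd p ∧ 0 < r ∧ q = p ^ r)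
    (F : Type) [Field F] [Fintype F] [DecidableEq F] (hF : Fintype.card F = q)
    (ι : Type) [Fintype ι] (R : ι → FDRep ℂ (GL (Fin n) F))
    (hsimple : ∀ i, Simple (R i))
    (hdistinct : ∀ i j : ι, Nonempty (R i ≅ R j) → i = j)
    (hcomplete : ∀ ρ : FDRep ℂ (GL (Fin n) F), Simple ρ → ∃ i, Nonempty (ρ ≅ R i)) :
    ∑ i ∈ Finset.univ.filter (fun i => IsRealValued (R i).character),
        (Module.finrank ℂ (R i) : ℝ)
      = ∑ k ∈ Finset.range (n + 1), (q : ℝ) ^ (k * (n - k)) * gbinom n k (q : ℝ) := by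
  subst hF
  have h2 : (2 : F) ≠ 0 := by
    obtain ⟨p, r, hp, hodd, hr, hq⟩ := hq
    intro h
    have hc : (Fintype.card F : F) = 0 := FiniteField.cast_card_eq_zero F
    obtain ⟨m, hm⟩ : Odd (Fintype.card F) := hq ▸ hodd.pow
    rw [hm] at hc
    push_cast at hc
    rw [h, zero_mul, zero_add] at hc
    exact one_ne_zero hc
  rw [← Involutions.card_involutions h2, ← RealDegrees.card_sq_eq_one,
    ← FrobeniusSchur.sum_finrank_real_eq_card R hsimple hdistinct hcomplete]
  · refine Finset.sum_congr (Finset.ext fun i => ?_) fun _ _ => rfl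
    exact ⟨fun h => Finset.mem_filter.mpr ⟨Finset.mem_univ i, (Finset.mem_filter.mp h).2⟩,
      fun h => Finset.mem_filter.mpr ⟨Finset.mem_univ i, (Finset.mem_filter.mp h).2⟩⟩
  · intro i hreal
    have hirr : Representation.IsIrreducible (R i).ρ :=
      FrobeniusSchur.isIrreducible_of_sum_character _
        ((FDRep.simple_iff_char_is_norm_one (R i)).mp (hsimple i))
    convert RealDegrees.sum_character_sq_eq_card h2 (R i).ρ hreal

end
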